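/- POTL is expressively equivalent to first-order logic with one free variable on OP ω-words: for every POTL formula φ there is a FO formula ν_φ(x) over the signature (<, χ, monadic predicates for AP) such that for all OP ω-words w and positions i ∈ ℕ, (w,i) ⊨ φ iff w ⊨ ν_φ(i); and conversely, for every FO formula ψ(x) with one free variable there is a POTL formula ψ' such that for all OP ω-words w and positions i, w ⊨ ψ(i) iff (w,i) ⊨ ψ'. Consequently, on OP ω-words every FO formula with at most one free variable is equivalent to one using at most three distinct variables. -/

import Mathlib

noncomputable section

namespace OPLTheory

attribute [local instance] Classical.propDecidable

/-- The three operator precedence relations `⋖`, `≐`, `⋗`. -/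
inductive Prec : Type where
  | lt : Prec
  | eq : Prec
  | gt : Prec

/-- An operator precedence matrix over alphabet `α`; the delimiter `#` is `none`. -/
abbrev OPM (α : Type) : Type := Option α → Option α → Option Prec

mutual
  /-- `Chain prec i j`: positions `i` and `j` are the left and right contexts of a
      (simple or composed) chain, w.r.t. the precedence assignment `prec` on positions. -/
  inductive Chain (prec : ℕ → ℕ → Option Prec) : ℕ → ℕ → Prop where
    | mk {i k j : ℕ} : i < k → prec i k = some Prec.lt →
        Gap prec i k → Body prec k j → Chain prec i j
  /-- The body of a chain, from one of its terminals to the right context. -/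
  inductive Body (prec : ℕ → ℕ → Option Prec) : ℕ → ℕ → Prop where
    | last {k j : ℕ} : k < j → prec k j = some Prec.gt → Gap prec k j → Body prec k j
    | step {k k' j : ℕ} : k < k' → prec k k' = some Prec.eq → Gap prec k k' →
        Body prec k' j → Body prec k j
  /-- The gap between two consecutive terminals: empty or an inner chain. -/
  inductive Gap (prec : ℕ → ℕ → Option Prec) : ℕ → ℕ → Prop where
    | empty {a b : ℕ} : b = a + 1 → Gap prec a b
    | chain {a b : ℕ} : Chain prec a b → Gap prec a b
end

/-- A finite OP word: positions `0, …, n+1`, where `0` and `n+1` carry `#`. -/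
structure OPWord (AP : Type) : Type where
  n : ℕ
  P : AP → Set ℕ

namespace OPWord

variable {AP : Type}

def lab (w : OPWord AP) (i : ℕ) : Option (Set AP) :=
  if i = 0 ∨ w.n + 1 ≤ i then none else some {a | i ∈ w.P a}

def prec (w : OPWord AP) (M : OPM (Set AP)) (i j : ℕ) : Option Prec := M (w.lab i) (w.lab j)

def ltp (w : OPWord AP) (M : OPM (Set AP)) (i j : ℕ) : Prop := w.prec M i j = some Prec.lt
def eqp (w : OPWord AP) (M : OPM (Set AP)) (i j : ℕ) : Prop := w.prec M i j = some Prec.eq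
def gtp (w : OPWord AP) (M : OPM (Set AP)) (i j : ℕ) : Prop := w.prec M i j = some Prec.gt

/-- The chain relation χ. -/
def chi (w : OPWord AP) (M : OPM (Set AP)) (i j : ℕ) : Prop :=
  i + 1 < j ∧ j ≤ w.n + 1 ∧ Chain (w.prec M) i j

/-- Compatibility of a word with an OPM: consecutive letters and chain contexts
    have a defined precedence relation. -/
def Compatible (w : OPWord AP) (M : OPM (Set AP)) : Prop :=
  (∀ i, i ≤ w.n → (w.prec M i (i + 1)).isSome) ∧
  (∀ i j, j ≤ w.n + 1 → Chain (w.prec M) i j → (w.prec M i j).isSome)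

end OPWord

/-- An OP ω-word: positions are all of `ℕ`; position `0` carries `#`. -/
structure OPWordW (AP : Type) : Type where
  P : AP → Set ℕ

namespace OPWordW

variable {AP : Type}

def lab (w : OPWordW AP) (i : ℕ) : Option (Set AP) :=
  if i = 0 then none else some {a | i ∈ w.P a}

def prec (w : OPWordW AP) (M : OPM (Set AP)) (i j : ℕ) : Option Prec := M (w.lab i) (w.lab j)

def ltp (w : OPWordW AP) (M : OPM (Set AP)) (i j : ℕ) : Prop := w.prec M i j = some Prec.lt
def eqp (w : OPWordW AP) (M : OPM (Set AP)) (i j : ℕ) : Prop := w.prec M i j = some Prec.eq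
def gtp (w : OPWordW AP) (M : OPM (Set AP)) (i j : ℕ) : Prop := w.prec M i j = some Prec.gt

def chi (w : OPWordW AP) (M : OPM (Set AP)) (i j : ℕ) : Prop :=
  i + 1 < j ∧ Chain (w.prec M) i j

def Compatible (w : OPWordW AP) (M : OPM (Set AP)) : Prop :=
  (∀ i, (w.prec M i (i + 1)).isSome) ∧
  (∀ i j, Chain (w.prec M) i j → (w.prec M i j).isSome)

end OPWordW

/-- An abstract frame on which the temporal logics are interpreted:
    atomic satisfaction, the chain relation, the precedence of positions,
    and validity of positions (for finite words). -/
structure PFrame (AP : Type) : Type where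
  atomSat : AP → ℕ → Prop
  chi : ℕ → ℕ → Prop
  pr : ℕ → ℕ → Option Prec
  valid : ℕ → Prop

namespace PFrame

variable {AP : Type} (F : PFrame AP)

def ltp (i j : ℕ) : Prop := F.pr i j = some Prec.lt
def eqp (i j : ℕ) : Prop := F.pr i j = some Prec.eq
def gtp (i j : ℕ) : Prop := F.pr i j = some Prec.gt

/-- `i ⋖ j` or `i ≐ j` (used by downward operators). -/
def deq (i j : ℕ) : Prop := F.ltp i j ∨ F.eqp i j
/-- `i ⋗ j` or `i ≐ j` (used by upward operators). -/
def ueq (i j : ℕ) : Prop := F.gtp i j ∨ F.eqp i j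

/-- Candidate chain-jumps of a downward summary path bounded by `bnd`. -/
def dspSet (bnd a : ℕ) : Set ℕ := {h | h ≤ bnd ∧ F.chi a h ∧ F.deq a h}

/-- One step of the downward summary path with final position `bnd`. -/
def dspStep (bnd a b : ℕ) : Prop :=
  ((F.dspSet bnd a).Nonempty ∧ b = sSup (F.dspSet bnd a)) ∨
  (¬ (F.dspSet bnd a).Nonempty ∧ b = a + 1 ∧ F.deq a b)

def uspSet (bnd a : ℕ) : Set ℕ := {h | h ≤ bnd ∧ F.chi a h ∧ F.ueq a h}

def uspStep (bnd a b : ℕ) : Prop :=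
  ((F.uspSet bnd a).Nonempty ∧ b = sSup (F.uspSet bnd a)) ∨
  (¬ (F.uspSet bnd a).Nonempty ∧ b = a + 1 ∧ F.ueq a b)

/-- An upward hierarchical path with common left context `h`. -/
def IsUHP (h : ℕ) (l : List ℕ) : Prop :=
  l ≠ [] ∧ l.Chain' (· < ·) ∧ (∀ p ∈ l, F.chi h p ∧ F.ltp h p) ∧
  l.Chain' (fun a b => ¬ ∃ k, a < k ∧ k < b ∧ F.chi h k)

/-- A downward hierarchical path with common right context `h`. -/
def IsDHP (h : ℕ) (l : List ℕ) : Prop :=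
  l ≠ [] ∧ l.Chain' (· < ·) ∧ (∀ p ∈ l, F.chi p h ∧ F.gtp p h) ∧
  l.Chain' (fun a b => ¬ ∃ k, a < k ∧ k < b ∧ F.chi k h)

end PFrame

/-- `IsPath step l i j`: `l` is a path from `i` to `j` whose consecutive
    elements are related by `step`. -/
def IsPath (step : ℕ → ℕ → Prop) (l : List ℕ) (i j : ℕ) : Prop :=
  l.head? = some i ∧ l.getLast? = some j ∧ l.Chain' step

def OPWord.frame {AP : Type} (w : OPWord AP) (M : OPM (Set AP)) : PFrame AP where
  atomSat a i := i ∈ w.P a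
  chi := w.chi M
  pr := w.prec M
  valid i := i ≤ w.n + 1

def OPWordW.frame {AP : Type} (w : OPWordW AP) (M : OPM (Set AP)) : PFrame AP where
  atomSat a i := i ∈ w.P a
  chi := w.chi M
  pr := w.prec M
  valid _ := True

/-- Syntax of POTL. -/
inductive POTL (AP : Type) : Type where
  | tt : POTL AP
  | atom (a : AP) : POTL AP
  | neg (φ : POTL AP) : POTL AP
  | orf (φ ψ : POTL AP) : POTL AP
  | nextD (φ : POTL AP) : POTL AP
  | nextU (φ : POTL AP) : POTL AP
  | backD (φ : POTL AP) : POTL AP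
  | backU (φ : POTL AP) : POTL AP
  | chiFD (φ : POTL AP) : POTL AP
  | chiFU (φ : POTL AP) : POTL AP
  | chiPD (φ : POTL AP) : POTL AP
  | chiPU (φ : POTL AP) : POTL AP
  | untilD (φ ψ : POTL AP) : POTL AP
  | untilU (φ ψ : POTL AP) : POTL AP
  | sinceD (φ ψ : POTL AP) : POTL AP
  | sinceU (φ ψ : POTL AP) : POTL AP
  | hnextD (φ : POTL AP) : POTL AP
  | hnextU (φ : POTL AP) : POTL AP
  | hbackD (φ : POTL AP) : POTL AP
  | hbackU (φ : POTL AP) : POTL AP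
  | huntilD (φ ψ : POTL AP) : POTL AP
  | huntilU (φ ψ : POTL AP) : POTL AP
  | hsinceD (φ ψ : POTL AP) : POTL AP
  | hsinceU (φ ψ : POTL AP) : POTL AP

/-- Semantics of POTL on a frame. -/
def POTL.Sat {AP : Type} (F : PFrame AP) : POTL AP → ℕ → Prop
  | .tt, _ => True
  | .atom a, i => F.atomSat a i
  | .neg φ, i => ¬ POTL.Sat F φ i
  | .orf φ ψ, i => POTL.Sat F φ i ∨ POTL.Sat F ψ i
  | .nextD φ, i => F.valid (i + 1) ∧ F.deq i (i + 1) ∧ POTL.Sat F φ (i + 1)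
  | .nextU φ, i => F.valid (i + 1) ∧ F.ueq i (i + 1) ∧ POTL.Sat F φ (i + 1)
  | .backD φ, i => 1 ≤ i ∧ F.deq (i - 1) i ∧ POTL.Sat F φ (i - 1)
  | .backU φ, i => 1 ≤ i ∧ F.ueq (i - 1) i ∧ POTL.Sat F φ (i - 1)
  | .chiFD φ, i => ∃ j, F.chi i j ∧ F.deq i j ∧ POTL.Sat F φ j
  | .chiFU φ, i => ∃ j, F.chi i j ∧ F.ueq i j ∧ POTL.Sat F φ j
  | .chiPD φ, i => ∃ j, F.chi j i ∧ F.deq j i ∧ POTL.Sat F φ j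
  | .chiPU φ, i => ∃ j, F.chi j i ∧ F.ueq j i ∧ POTL.Sat F φ j
  | .untilD φ ψ, i => ∃ j, i ≤ j ∧ F.valid j ∧ ∃ l, IsPath (F.dspStep j) l i j ∧
      POTL.Sat F ψ j ∧ ∀ p ∈ l.dropLast, POTL.Sat F φ p
  | .untilU φ ψ, i => ∃ j, i ≤ j ∧ F.valid j ∧ ∃ l, IsPath (F.uspStep j) l i j ∧
      POTL.Sat F ψ j ∧ ∀ p ∈ l.dropLast, POTL.Sat F φ p
  | .sinceD φ ψ, i => ∃ j, j ≤ i ∧ ∃ l, IsPath (F.dspStep i) l j i ∧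
      POTL.Sat F ψ j ∧ ∀ p ∈ l.tail, POTL.Sat F φ p
  | .sinceU φ ψ, i => ∃ j, j ≤ i ∧ ∃ l, IsPath (F.uspStep i) l j i ∧
      POTL.Sat F ψ j ∧ ∀ p ∈ l.tail, POTL.Sat F φ p
  | .hnextU φ, i => ∃ h, h < i ∧ F.chi h i ∧ F.ltp h i ∧
      (∃ k, i < k ∧ F.chi h k ∧ F.ltp h k) ∧
      POTL.Sat F φ (sInf {k | i < k ∧ F.chi h k ∧ F.ltp h k})
  | .hbackU φ, i => ∃ h, h < i ∧ F.chi h i ∧ F.ltp h i ∧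
      (∃ k, k < i ∧ F.chi h k ∧ F.ltp h k) ∧
      POTL.Sat F φ (sSup {k | k < i ∧ F.chi h k ∧ F.ltp h k})
  | .hnextD φ, i => ∃ h, i < h ∧ F.chi i h ∧ F.gtp i h ∧
      (∃ k, i < k ∧ F.chi k h ∧ F.gtp k h) ∧
      POTL.Sat F φ (sInf {k | i < k ∧ F.chi k h ∧ F.gtp k h})
  | .hbackD φ, i => ∃ h, i < h ∧ F.chi i h ∧ F.gtp i h ∧
      (∃ k, k < i ∧ F.chi k h ∧ F.gtp k h) ∧
      POTL.Sat F φ (sSup {k | k < i ∧ F.chi k h ∧ F.gtp k h})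
  | .huntilU φ ψ, i => ∃ h l j, h < i ∧ F.IsUHP h l ∧ l.head? = some i ∧
      l.getLast? = some j ∧ POTL.Sat F ψ j ∧ ∀ p ∈ l.dropLast, POTL.Sat F φ p
  | .hsinceU φ ψ, i => ∃ h l j, h < j ∧ F.IsUHP h l ∧ l.getLast? = some i ∧
      l.head? = some j ∧ POTL.Sat F ψ j ∧ ∀ p ∈ l.tail, POTL.Sat F φ p
  | .huntilD φ ψ, i => ∃ h l j, j < h ∧ F.IsDHP h l ∧ l.head? = some i ∧
      l.getLast? = some j ∧ POTL.Sat F ψ j ∧ ∀ p ∈ l.dropLast, POTL.Sat F φ p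
  | .hsinceD φ ψ, i => ∃ h l j, i < h ∧ F.IsDHP h l ∧ l.getLast? = some i ∧
      l.head? = some j ∧ POTL.Sat F ψ j ∧ ∀ p ∈ l.tail, POTL.Sat F φ p

/-- Conjunction, as a derived POTL operator. -/
def POTL.andf {AP : Type} (φ ψ : POTL AP) : POTL AP := .neg (.orf (.neg φ) (.neg ψ))

/-- Syntax of OPTL. `suntil`/`ssince` take the set `Π ⊆ {⋖,≐,⋗}` of precedence
    relations allowed between consecutive positions. -/
inductive OPTL (AP : Type) : Type where
  | tt : OPTL AP
  | atom (a : AP) : OPTL AP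
  | neg (φ : OPTL AP) : OPTL AP
  | orf (φ ψ : OPTL AP) : OPTL AP
  | next (φ : OPTL AP) : OPTL AP
  | back (φ : OPTL AP) : OPTL AP
  | luntil (φ ψ : OPTL AP) : OPTL AP
  | lsince (φ ψ : OPTL AP) : OPTL AP
  | cnext (φ : OPTL AP) : OPTL AP
  | cback (φ : OPTL AP) : OPTL AP
  | suntil (pi : Set Prec) (φ ψ : OPTL AP) : OPTL AP
  | ssince (pi : Set Prec) (φ ψ : OPTL AP) : OPTL AP
  | hyuntil (φ ψ : OPTL AP) : OPTL AP
  | hysince (φ ψ : OPTL AP) : OPTL AP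
  | htuntil (φ ψ : OPTL AP) : OPTL AP
  | htsince (φ ψ : OPTL AP) : OPTL AP

/-- One step of an OPTL summary-until path bounded by `bnd`. -/
def optlUStep {AP : Type} (F : PFrame AP) (pi : Set Prec) (bnd a b : ℕ) : Prop :=
  (b ≤ bnd ∧ F.chi a b ∧ F.ueq a b) ∨
  ((¬ ∃ h, h ≤ bnd ∧ F.chi a h ∧ F.ueq a h) ∧ b = a + 1 ∧ ∃ π ∈ pi, F.pr a b = some π)

/-- One step of an OPTL summary-since path whose first position is `bnd`. -/
def optlSStep {AP : Type} (F : PFrame AP) (pi : Set Prec) (bnd a b : ℕ) : Prop :=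
  (bnd ≤ a ∧ F.chi a b ∧ F.deq a b) ∨
  ((¬ ∃ h, bnd ≤ h ∧ F.chi h b ∧ F.deq h b) ∧ b = a + 1 ∧ ∃ π ∈ pi, F.pr a b = some π)

/-- Semantics of OPTL on a frame. -/
def OPTL.Sat {AP : Type} (F : PFrame AP) : OPTL AP → ℕ → Prop
  | .tt, _ => True
  | .atom a, i => F.atomSat a i
  | .neg φ, i => ¬ OPTL.Sat F φ i
  | .orf φ ψ, i => OPTL.Sat F φ i ∨ OPTL.Sat F ψ i
  | .next φ, i => F.valid (i + 1) ∧ OPTL.Sat F φ (i + 1)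
  | .back φ, i => 1 ≤ i ∧ OPTL.Sat F φ (i - 1)
  | .luntil φ ψ, i => ∃ j, i ≤ j ∧ F.valid j ∧ OPTL.Sat F ψ j ∧
      ∀ p, i ≤ p → p < j → OPTL.Sat F φ p
  | .lsince φ ψ, i => ∃ j, j ≤ i ∧ OPTL.Sat F ψ j ∧
      ∀ p, j < p → p ≤ i → OPTL.Sat F φ p
  | .cnext φ, i => ∃ j, F.chi i j ∧ F.ueq i j ∧ OPTL.Sat F φ j
  | .cback φ, i => ∃ j, F.chi j i ∧ F.deq j i ∧ OPTL.Sat F φ j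
  | .suntil pi φ ψ, i => ∃ j, i ≤ j ∧ F.valid j ∧
      ∃ l, IsPath (optlUStep F pi j) l i j ∧ OPTL.Sat F ψ j ∧
        ∀ p ∈ l.dropLast, OPTL.Sat F φ p
  | .ssince pi φ ψ, i => ∃ j, j ≤ i ∧
      ∃ l, IsPath (optlSStep F pi j) l j i ∧ OPTL.Sat F ψ j ∧
        ∀ p ∈ l.tail, OPTL.Sat F φ p
  | .hyuntil φ ψ, i => ∃ l : List ℕ, l ≠ [] ∧ l.Chain' (· < ·) ∧
      (∀ p ∈ l, i < p ∧ F.chi i p ∧ F.ltp i p) ∧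
      (∀ j1, l.head? = some j1 → ∀ k, k < j1 → ¬ F.chi i k) ∧
      (∀ jn, l.getLast? = some jn → OPTL.Sat F ψ jn) ∧
      (∀ p ∈ l.dropLast, OPTL.Sat F φ p)
  | .hysince φ ψ, i => ∃ l : List ℕ, l ≠ [] ∧ l.Chain' (· < ·) ∧
      (∀ p ∈ l, i < p ∧ F.chi i p ∧ F.ltp i p) ∧
      (∀ jn, l.getLast? = some jn → ∀ k, jn < k → ¬ F.chi i k) ∧
      (∀ j1, l.head? = some j1 → OPTL.Sat F ψ j1) ∧
      (∀ p ∈ l.tail, OPTL.Sat F φ p)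
  | .htuntil φ ψ, i => ∃ l : List ℕ, l ≠ [] ∧ l.Chain' (· < ·) ∧
      (∀ p ∈ l, p < i ∧ F.chi p i ∧ F.gtp p i) ∧
      (∀ jn, l.getLast? = some jn → ∀ k, jn < k → k < i → ¬ F.chi k i) ∧
      (∀ jn, l.getLast? = some jn → OPTL.Sat F ψ jn) ∧
      (∀ p ∈ l.dropLast, OPTL.Sat F φ p)
  | .htsince φ ψ, i => ∃ l : List ℕ, l ≠ [] ∧ l.Chain' (· < ·) ∧
      (∀ p ∈ l, p < i ∧ F.chi p i ∧ F.gtp p i) ∧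
      (∀ j1, l.head? = some j1 → ∀ k, k < j1 → ¬ F.chi k i) ∧
      (∀ j1, l.head? = some j1 → OPTL.Sat F ψ j1) ∧
      (∀ p ∈ l.tail, OPTL.Sat F φ p)

/-- The OP word determined by a list of letters (position `i+1` carries letter `i`). -/
def listWord {AP : Type} (w : List (Set AP)) : OPWord AP :=
  ⟨w.length, fun a => {i | 1 ≤ i ∧ i ≤ w.length ∧ a ∈ w.getD (i - 1) ∅}⟩

def ListCompatible {AP : Type} (M : OPM (Set AP)) (w : List (Set AP)) : Prop :=
  (listWord w).Compatible M

/-- Satisfaction of a POTL formula at (0-based) letter position `i` of a list word. -/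
def POTL.SatL {AP : Type} (M : OPM (Set AP)) (w : List (Set AP)) (i : ℕ) (φ : POTL AP) :
    Prop :=
  POTL.Sat ((listWord w).frame M) φ (i + 1)

/-- Satisfaction of an OPTL formula at (0-based) letter position `i` of a list word. -/
def OPTL.SatL {AP : Type} (M : OPM (Set AP)) (w : List (Set AP)) (i : ℕ) (φ : OPTL AP) :
    Prop :=
  OPTL.Sat ((listWord w).frame M) φ (i + 1)

/-- An operator precedence automaton with states `Q` over `(Sig, M)`. -/
structure OPA (Sig Q : Type) (M : OPM Sig) : Type where
  I : Set Q
  F : Set Q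
  push : Q → Sig → Q → Prop
  shift : Q → Sig → Q → Prop
  pop : Q → Q → Q → Prop

/-- A move of an OPA between configurations `(input, state, stack)`. -/
def OPA.step {Sig Q : Type} {M : OPM Sig} (A : OPA Sig Q M) :
    List Sig × Q × List (Sig × Q) → List Sig × Q × List (Sig × Q) → Prop := fun c c' =>
  (∃ a x p q γ, c = (a :: x, p, γ) ∧ M (γ.head?.map Prod.fst) (some a) = some Prec.lt ∧
     A.push p a q ∧ c' = (x, q, (a, p) :: γ)) ∨
  (∃ b x q r a p γ, c = (b :: x, q, (a, p) :: γ) ∧ M (some a) (some b) = some Prec.eq ∧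
     A.shift q b r ∧ c' = (x, r, (b, p) :: γ)) ∨
  (∃ x q r a p γ, c = (x, q, (a, p) :: γ) ∧ M (some a) x.head? = some Prec.gt ∧
     A.pop q p r ∧ c' = (x, r, γ))

def OPA.lang {Sig Q : Type} {M : OPM Sig} (A : OPA Sig Q M) : Set (List Sig) :=
  {x | ∃ qI ∈ A.I, ∃ qF ∈ A.F, Relation.ReflTransGen A.step (x, qI, []) ([], qF, [])}

/-- `L` is an operator precedence language over `(Sig, M)`. -/
def IsOPL {Sig : Type} (M : OPM Sig) (L : Set (List Sig)) : Prop :=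
  ∃ (n : ℕ) (A : OPA Sig (Fin n) M), L = A.lang

/-- `v^k`: the `k`-fold repetition of the string `v`. -/
def listPow {α : Type} (v : List α) : ℕ → List α
  | 0 => []
  | k + 1 => v ++ listPow v k


/-! ### The alphabet of procedural traces and the OPM `M_call` -/

/-- Atomic propositions: the structural labels `call`, `ret`, `han`, `exc`,
    plus the ordinary proposition `p_A`. -/
inductive CallAP : Type where
  | call : CallAP
  | ret : CallAP
  | han : CallAP
  | exc : CallAP
  | pA : CallAP
deriving DecidableEq

/-- The matrix `M_call` on structural labels. -/
def callPrec : CallAP → CallAP → Option Prec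
  | .call, .call => some Prec.lt
  | .call, .ret => some Prec.eq
  | .call, .han => some Prec.lt
  | .call, .exc => some Prec.gt
  | .ret, .call => some Prec.gt
  | .ret, .ret => some Prec.gt
  | .ret, .han => some Prec.gt
  | .ret, .exc => some Prec.gt
  | .han, .call => some Prec.lt
  | .han, .ret => some Prec.gt
  | .han, .han => some Prec.lt
  | .han, .exc => some Prec.eq
  | .exc, .call => some Prec.gt
  | .exc, .ret => some Prec.gt
  | .exc, .han => some Prec.gt
  | .exc, .exc => some Prec.gt
  | _, _ => none

/-- The unique structural label of a label set, if it exists. -/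
def theStruct (s : Set CallAP) : Option CallAP :=
  if h : ∃! x : CallAP, x ∈ s ∧ x ≠ CallAP.pA then some h.choose else none

/-- The OPM `M_call`, lifted to label sets containing exactly one structural label;
    `#` yields precedence to anything and anything takes precedence over `#`. -/
def Mcall : OPM (Set CallAP) := fun a b =>
  match a, b with
  | none, none => none
  | none, some t => (theStruct t).bind fun _ => some Prec.lt
  | some s, none => (theStruct s).bind fun _ => some Prec.gt
  | some s, some t => (theStruct s).bind fun x => (theStruct t).bind fun y => callPrec x y

/-- The universe of words compatible with `M_call`. -/
def Lcall : Set (List (Set CallAP)) := {w | ListCompatible Mcall w}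

/-! ### First-order logic with named variables over a relational signature -/

/-- First-order formulas with binary relation symbols `R`, unary predicates `U`,
    and variables `V`. -/
inductive FOV (R U V : Type) : Type where
  | fal : FOV R U V
  | rel (r : R) (x y : V) : FOV R U V
  | un (u : U) (x : V) : FOV R U V
  | eqv (x y : V) : FOV R U V
  | imp (f g : FOV R U V) : FOV R U V
  | all (x : V) (f : FOV R U V) : FOV R U V

namespace FOV

variable {R U V D : Type}

def Realize [DecidableEq V] (relI : R → D → D → Prop) (unI : U → D → Prop) :
    FOV R U V → (V → D) → Prop
  | .fal, _ => False
  | .rel r x y, v => relI r (v x) (v y)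
  | .un u x, v => unI u (v x)
  | .eqv x y, v => v x = v y
  | .imp f g, v => Realize relI unI f v → Realize relI unI g v
  | .all x f, v => ∀ d : D, Realize relI unI f (Function.update v x d)

/-- Quantifier rank. -/
def qr : FOV R U V → ℕ
  | .fal => 0
  | .rel _ _ _ => 0
  | .un _ _ => 0
  | .eqv _ _ => 0
  | .imp f g => max f.qr g.qr
  | .all _ f => f.qr + 1

/-- Free variables. -/
def free : FOV R U V → Set V
  | .fal => ∅
  | .rel _ x y => {x, y}
  | .un _ x => {x}
  | .eqv x y => {x, y}
  | .imp f g => f.free ∪ g.free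
  | .all x f => f.free \ {x}

end FOV

/-- The relational signature of OP words: the linear order and the chain relation. -/
inductive OPRel : Type where
  | ord : OPRel
  | chain : OPRel

/-- Interpretation of the OP word signature on the positions of a finite OP word. -/
def wordRelI {AP : Type} (M : OPM (Set AP)) (w : OPWord AP) :
    OPRel → Fin (w.n + 2) → Fin (w.n + 2) → Prop
  | .ord => fun a b => (a : ℕ) < (b : ℕ)
  | .chain => fun a b => w.chi M a b

def wordUnI {AP : Type} (w : OPWord AP) : AP → Fin (w.n + 2) → Prop :=
  fun a p => (p : ℕ) ∈ w.P a

/-- Interpretation of the OP word signature on the positions of an OP ω-word. -/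
def wordRelIW {AP : Type} (M : OPM (Set AP)) (w : OPWordW AP) : OPRel → ℕ → ℕ → Prop
  | .ord => fun a b => a < b
  | .chain => fun a b => w.chi M a b

def wordUnIW {AP : Type} (w : OPWordW AP) : AP → ℕ → Prop := fun a p => p ∈ w.P a

/-! ### Unranked ordered trees -/

/-- An unranked ordered tree: nodes are sequences of child numbers; `hash` is
    the set of nodes labeled with the delimiter `#`. -/
structure UOT (AP : Type) : Type where
  S : Set (List ℕ)
  hash : Set (List ℕ)
  L : AP → Set (List ℕ)

/-- The child relation `R_⇓`. -/
def rdown (s t : List ℕ) : Prop := ∃ k : ℕ, t = s ++ [k]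

/-- The next-sibling relation `R_⇒`. -/
def rright (s t : List ℕ) : Prop := ∃ (r : List ℕ) (h : ℕ), s = r ++ [h] ∧ t = r ++ [h + 1]

namespace UOT

variable {AP : Type}

def nodeLab (T : UOT AP) (s : List ℕ) : Option (Set AP) :=
  if s ∈ T.hash then none else some {a | s ∈ T.L a}

def prec (T : UOT AP) (M : OPM (Set AP)) (s t : List ℕ) : Option Prec :=
  M (T.nodeLab s) (T.nodeLab t)

end UOT

/-- `t` is the rightmost child of `s` (in the node set of `T`). -/
def RightmostChild {AP : Type} (T : UOT AP) (s t : List ℕ) : Prop :=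
  t ∈ T.S ∧ rdown s t ∧ ¬ ∃ u ∈ T.S, rright t u

/-- The right context `Rc` of a node: its leftmost right sibling, or recursively the
    `Rc` of its parent; undefined if the node has a child in the `≐` relation with it. -/
inductive RcRel {AP : Type} (M : OPM (Set AP)) (T : UOT AP) : List ℕ → List ℕ → Prop where
  | sib {r : List ℕ} {h : ℕ} :
      (¬ ∃ c, rdown (r ++ [h]) c ∧ c ∈ T.S ∧ T.prec M (r ++ [h]) c = some Prec.eq) →
      r ++ [h + 1] ∈ T.S →
      RcRel M T (r ++ [h]) (r ++ [h + 1])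
  | up {r : List ℕ} {h : ℕ} {x : List ℕ} :
      (¬ ∃ c, rdown (r ++ [h]) c ∧ c ∈ T.S ∧ T.prec M (r ++ [h]) c = some Prec.eq) →
      r ++ [h + 1] ∉ T.S →
      RcRel M T r x →
      RcRel M T (r ++ [h]) x

/-- OPM-compatibility of a UOT (membership in `𝒯_M`). -/
def UOT.CompatibleM {AP : Type} (T : UOT AP) (M : OPM (Set AP)) : Prop :=
  (∀ s ∈ T.S, (s ∈ T.hash ↔ s = [] ∨ RightmostChild T [] s)) ∧
  (∀ s c, s ∈ T.S → RightmostChild T s c →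
    (T.prec M s c = some Prec.lt ∨ T.prec M s c = some Prec.eq)) ∧
  (∀ s c, s ∈ T.S → c ∈ T.S → rdown s c → ¬ RightmostChild T s c →
    T.prec M s c = some Prec.lt) ∧
  (∀ s r, s ∈ T.S → RcRel M T s r → T.prec M s r = some Prec.gt)

/-- `χ(i,j)` with `i ⋖ j` or `i ≐ j` (finite words). -/
def chiDeq {AP : Type} (w : OPWord AP) (M : OPM (Set AP)) (i j : ℕ) : Prop :=
  w.chi M i j ∧ (w.ltp M i j ∨ w.eqp M i j)

/-- `tau` is the map `τ` from the positions of the finite OP word `w` to the nodes of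
    the unranked ordered tree `T = τ(w)`. -/
def IsTauMap {AP : Type} (M : OPM (Set AP)) (w : OPWord AP) (T : UOT AP)
    (tau : ℕ → List ℕ) : Prop :=
  tau 0 = [] ∧
  T.S = {s | ∃ i, i ≤ w.n + 1 ∧ tau i = s} ∧
  T.hash = {s | tau 0 = s ∨ tau (w.n + 1) = s} ∧
  (∀ a, T.L a = {s | ∃ i, i ≤ w.n + 1 ∧ tau i = s ∧ i ∈ w.P a}) ∧
  ∀ i, i ≤ w.n →
    ((w.eqp M i (i + 1) ∨ w.ltp M i (i + 1)) → tau (i + 1) = tau i ++ [0]) ∧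
    (w.eqp M i (i + 1) → ∀ j, j ≤ w.n + 1 → rdown (tau i) (tau j) → tau j = tau (i + 1)) ∧
    (w.gtp M i (i + 1) → ∀ j, j ≤ w.n + 1 → ¬ rdown (tau i) (tau j)) ∧
    (∀ j, chiDeq w M i j →
      tau j = tau i ++ [{j' | chiDeq w M i j' ∧ j' < j}.ncard + 1])

/-- `χ(i,j)` with `i ⋖ j` or `i ≐ j` (ω-words). -/
def chiDeqW {AP : Type} (w : OPWordW AP) (M : OPM (Set AP)) (i j : ℕ) : Prop :=
  w.chi M i j ∧ (w.ltp M i j ∨ w.eqp M i j)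

/-- `tau` is the map `τ` from the positions of the OP ω-word `w` to the nodes of
    the unranked ordered tree `T = τ(w)`. -/
def IsTauMapW {AP : Type} (M : OPM (Set AP)) (w : OPWordW AP) (T : UOT AP)
    (tau : ℕ → List ℕ) : Prop :=
  tau 0 = [] ∧
  T.S = Set.range tau ∧
  T.hash = {s | tau 0 = s} ∧
  (∀ a, T.L a = {s | ∃ i, tau i = s ∧ i ∈ w.P a}) ∧
  ∀ i,
    ((w.eqp M i (i + 1) ∨ w.ltp M i (i + 1)) → tau (i + 1) = tau i ++ [0]) ∧
    (w.eqp M i (i + 1) → ∀ j, rdown (tau i) (tau j) → tau j = tau (i + 1)) ∧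
    (w.gtp M i (i + 1) → ∀ j, ¬ rdown (tau i) (tau j)) ∧
    (∀ j, chiDeqW w M i j →
      tau j = tau i ++ [{j' | chiDeqW w M i j' ∧ j' < j}.ncard + 1])

/-- `T` is right-recursive, with `f` enumerating the pending nodes obtained by
    descending through rightmost children from the root. -/
def IsRR {AP : Type} (T : UOT AP) (f : ℕ → List ℕ) : Prop :=
  f 0 = [] ∧ ∀ p, RightmostChild T (f p) (f (p + 1))

/-- `T` is left-recursive, with `g` the node `r_∞` with infinitely many children,
    reached from the root by descending through rightmost children. -/
def IsLR {AP : Type} (T : UOT AP) (g : List ℕ) : Prop :=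
  (∃ (m : ℕ) (br : ℕ → List ℕ), br 0 = [] ∧ br m = g ∧
    ∀ p, p < m → RightmostChild T (br p) (br (p + 1))) ∧
  (∀ k : ℕ, g ++ [k] ∈ T.S)

/-- `t^R_w(s^R_p)`: the finite subtree rooted at the pending node `f p`, with the
    subtree rooted at its rightmost child `f (p+1)` removed. -/
def rrSubtree {AP : Type} (T : UOT AP) (f : ℕ → List ℕ) (p : ℕ) : Set (List ℕ) :=
  {t | t ∈ T.S ∧ f p <+: t ∧ ¬ f (p + 1) <+: t}

/-- `t^L(w,p)`: the finite subtree rooted at the `p`-th child of `r_∞ = g`. -/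
def lrSubtree {AP : Type} (T : UOT AP) (g : List ℕ) (p : ℕ) : Set (List ℕ) :=
  {t | t ∈ T.S ∧ (g ++ [p]) <+: t}

/-- `t_f(w)`: the finite tree obtained by removing all children of `r_∞ = g`
    (and their descendants). -/
def lrTf {AP : Type} (T : UOT AP) (g : List ℕ) : Set (List ℕ) :=
  {t | t ∈ T.S ∧ ¬ ∃ k : ℕ, (g ++ [k]) <+: t}

/-- The relational signature of unranked ordered trees. -/
inductive TreeRel : Type where
  | down : TreeRel
  | right : TreeRel

/-- Interpretation of the tree signature on a set `A` of nodes. -/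
def treeRelI (A : Set (List ℕ)) : TreeRel → ↥A → ↥A → Prop
  | .down => fun s t => rdown s.val t.val
  | .right => fun s t => rright s.val t.val

def treeUnI {AP : Type} (T : UOT AP) (A : Set (List ℕ)) : AP → ↥A → Prop :=
  fun a s => s.val ∈ T.L a

/-- `≡_k` for sentences, between two structures over the same signature. -/
def EquivKSent (R U : Type) {D1 D2 : Type}
    (rel1 : R → D1 → D1 → Prop) (un1 : U → D1 → Prop)
    (rel2 : R → D2 → D2 → Prop) (un2 : U → D2 → Prop) (k : ℕ) : Prop :=
  ∀ φ : FOV R U ℕ, φ.free = ∅ → φ.qr ≤ k →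
    ((∀ v, φ.Realize rel1 un1 v) ↔ (∀ v, φ.Realize rel2 un2 v))

/-- `≡_k` between two structures with a distinguished element. -/
def EquivKPt (R U : Type) {D1 D2 : Type}
    (rel1 : R → D1 → D1 → Prop) (un1 : U → D1 → Prop) (a : D1)
    (rel2 : R → D2 → D2 → Prop) (un2 : U → D2 → Prop) (b : D2) (k : ℕ) : Prop :=
  ∀ φ : FOV R U ℕ, φ.free ⊆ {0} → φ.qr ≤ k →
    (φ.Realize rel1 un1 (fun _ => a) ↔ φ.Realize rel2 un2 (fun _ => b))

/-- The rank-`k` type of the tree structure induced by `T` on the node set `A`. -/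
def rankType (AP : Type) (k : ℕ) (T : UOT AP) (A : Set (List ℕ)) :
    Set (FOV TreeRel AP ℕ) :=
  {φ | φ.free = ∅ ∧ φ.qr ≤ k ∧ ∀ v, φ.Realize (treeRelI A) (treeUnI T A) v}

/-! ### The tree logic `X_until` -/

inductive Xuntil (AP : Type) : Type where
  | tt : Xuntil AP
  | atom (a : AP) : Xuntil AP
  | neg (φ : Xuntil AP) : Xuntil AP
  | andf (φ ψ : Xuntil AP) : Xuntil AP
  | down (φ ψ : Xuntil AP) : Xuntil AP
  | up (φ ψ : Xuntil AP) : Xuntil AP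
  | right (φ ψ : Xuntil AP) : Xuntil AP
  | left (φ ψ : Xuntil AP) : Xuntil AP

/-- Strict semantics of `X_until` on a UOT. -/
def XSat {AP : Type} (T : UOT AP) : Xuntil AP → List ℕ → Prop
  | .tt, _ => True
  | .atom a, s => s ∈ T.L a
  | .neg φ, s => ¬ XSat T φ s
  | .andf φ ψ, s => XSat T φ s ∧ XSat T ψ s
  | .down φ ψ, s => ∃ t ∈ T.S, s <+: t ∧ s ≠ t ∧ XSat T ψ t ∧
      ∀ r ∈ T.S, s <+: r → s ≠ r → r <+: t → r ≠ t → XSat T φ r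
  | .up φ ψ, s => ∃ t ∈ T.S, t <+: s ∧ t ≠ s ∧ XSat T ψ t ∧
      ∀ r ∈ T.S, t <+: r → t ≠ r → r <+: s → r ≠ s → XSat T φ r
  | .right φ ψ, s => ∃ (r : List ℕ) (h h' : ℕ), s = r ++ [h] ∧ h < h' ∧
      r ++ [h'] ∈ T.S ∧ XSat T ψ (r ++ [h']) ∧
      ∀ h'', h < h'' → h'' < h' → XSat T φ (r ++ [h''])
  | .left φ ψ, s => ∃ (r : List ℕ) (h h' : ℕ), s = r ++ [h] ∧ h' < h ∧
      r ++ [h'] ∈ T.S ∧ XSat T ψ (r ++ [h']) ∧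
      ∀ h'', h' < h'' → h'' < h → XSat T φ (r ++ [h''])

/-- The subtree of `T_w` rooted at `r`, from which the subtree rooted at `r`'s
    rightmost child has been erased in case `α` holds at that child. -/
def prunedSubtree {AP : Type} (T : UOT AP) (α : Xuntil AP) (r : List ℕ) :
    Set (List ℕ) :=
  {t | t ∈ T.S ∧ r <+: t ∧ ¬ ∃ c, RightmostChild T r c ∧ XSat T α c ∧ c <+: t}

/-! ### Derived POTL operators -/

section Derived

variable {AP : Type} [Fintype AP]

def bigOr (l : List (POTL AP)) : POTL AP := l.foldr POTL.orf (POTL.neg POTL.tt)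
def bigAnd (l : List (POTL AP)) : POTL AP := l.foldr POTL.andf POTL.tt

/-- `σ_a`: exactly the propositions in `a` hold. -/
def sigmaF (a : Set AP) : POTL AP :=
  POTL.andf (bigAnd ((Finset.univ.filter (· ∈ a)).toList.map POTL.atom))
    (bigAnd ((Finset.univ.filter (· ∉ a)).toList.map fun p => POTL.neg (POTL.atom p)))

/-- All pairs of label sets in the precedence relation `π`. -/
def pairsWith (M : OPM (Set AP)) (π : Prec) : List (Set AP × Set AP) :=
  (Finset.univ.filter
    (fun ab : Set AP × Set AP => M (some ab.1) (some ab.2) = some π)).toList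

/-- `χ_F^π γ`: the restriction of `χ_F^d γ` to chains with contexts in `π ∈ {⋖,≐}`. -/
def chiFpi (M : OPM (Set AP)) (π : Prec) (γ : POTL AP) : POTL AP :=
  bigOr ((pairsWith M π).map fun ab =>
    POTL.andf (sigmaF ab.1) (POTL.chiFD (POTL.andf (sigmaF ab.2) γ)))

/-- `χ_P^π γ`. -/
def chiPpi (M : OPM (Set AP)) (π : Prec) (γ : POTL AP) : POTL AP :=
  bigOr ((pairsWith M π).map fun ab =>
    POTL.andf (sigmaF ab.2) (POTL.chiPD (POTL.andf (sigmaF ab.1) γ)))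

/-- `○^⋖ γ`: downward next restricted to the `⋖` relation. -/
def nextLt (M : OPM (Set AP)) (γ : POTL AP) : POTL AP :=
  bigOr ((pairsWith M Prec.lt).map fun ab =>
    POTL.andf (sigmaF ab.1) (POTL.nextD (POTL.andf (sigmaF ab.2) γ)))

/-- `⊖^⋖ γ`: downward back restricted to the `⋖` relation. -/
def backLt (M : OPM (Set AP)) (γ : POTL AP) : POTL AP :=
  bigOr ((pairsWith M Prec.lt).map fun ab =>
    POTL.andf (sigmaF ab.2) (POTL.backD (POTL.andf (sigmaF ab.1) γ)))

end Derived

end OPLTheory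

noncomputable section
namespace OPLTheory
inductive Code : Type where
  | eq | anc | dsc | lf | rt
deriving DecidableEq
instance : Finite Code :=
  Finite.of_injective (fun c : Code => match c with
    | .eq => (0 : Fin 5)
    | .anc => 1
    | .dsc => 2
    | .lf => 3
    | .rt => 4) (by intro a b; cases a <;> cases b <;> simp)
def Code.conv : Code → Code
  | .eq => .eq
  | .anc => .dsc
  | .dsc => .anc
  | .lf => .rt
  | .rt => .lf
structure Str (Γ : Type) : Type 1 where
  D : Type
  rel : D → D → Code
  lab : D → Γ
section EFsec
variable {Γ : Type}
def EF0 (A B : Str Γ) (l : List (A.D × B.D)) : Prop :=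
  ∀ p ∈ l, A.lab p.1 = B.lab p.2 ∧ ∀ q ∈ l, A.rel p.1 q.1 = B.rel p.2 q.2
def EF : ℕ → (A B : Str Γ) → List (A.D × B.D) → Prop
  | 0, A, B, l => EF0 A B l
  | k + 1, A, B, l => EF0 A B l ∧ (∀ a, ∃ b, EF k A B ((a, b) :: l)) ∧
      (∀ b, ∃ a, EF k A B ((a, b) :: l))
theorem EF.zero {A B : Str Γ} : ∀ {k : ℕ} {l : List (A.D × B.D)}, EF k A B l → EF0 A B l
  | 0, _, h => h
  | _ + 1, _, h => h.1
theorem EF0.mono {A B : Str Γ} {l l' : List (A.D × B.D)} (h : EF0 A B l) (hs : l' ⊆ l) :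
    EF0 A B l' :=
  fun p hp => ⟨(h p (hs hp)).1, fun q hq => (h p (hs hp)).2 q (hs hq)⟩
theorem EF.mono {A B : Str Γ} : ∀ {k : ℕ} {l l' : List (A.D × B.D)}, EF k A B l → l' ⊆ l →
    EF k A B l'
  | 0, _, _, h, hs => EF0.mono h hs
  | k + 1, _, _, h, hs => by
    refine ⟨EF0.mono h.1 hs, fun a => ?_, fun b => ?_⟩
    · obtain ⟨b, hb⟩ := h.2.1 a
      exact ⟨b, EF.mono hb (List.cons_subset_cons _ hs)⟩
    · obtain ⟨a, ha⟩ := h.2.2 b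
      exact ⟨a, EF.mono ha (List.cons_subset_cons _ hs)⟩
theorem EF.pred {A B : Str Γ} : ∀ {k : ℕ} {l : List (A.D × B.D)}, EF (k + 1) A B l →
    EF k A B l
  | 0, _, h => h.1
  | k + 1, _, h => by
    refine ⟨h.1, fun a => ?_, fun b => ?_⟩
    · obtain ⟨b, hb⟩ := h.2.1 a
      exact ⟨b, EF.pred hb⟩
    · obtain ⟨a, ha⟩ := h.2.2 b
      exact ⟨a, EF.pred ha⟩
theorem EF.symm {A B : Str Γ} : ∀ {k : ℕ} {l : List (A.D × B.D)}, EF k A B l →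
    EF k B A (l.map Prod.swap)
  | 0, l, h => by
    intro p hp
    simp only [List.mem_map] at hp
    obtain ⟨p, hp, rfl⟩ := hp
    refine ⟨(h p hp).1.symm, fun q hq => ?_⟩
    simp only [List.mem_map] at hq
    obtain ⟨q, hq, rfl⟩ := hq
    exact ((h p hp).2 q hq).symm
  | k + 1, l, h => by
    refine ⟨EF.symm (k := 0) h.1, fun a => ?_, fun b => ?_⟩
    · obtain ⟨b, hb⟩ := h.2.2 a
      exact ⟨b, EF.symm hb⟩
    · obtain ⟨a, ha⟩ := h.2.1 b
      exact ⟨a, EF.symm ha⟩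
theorem EF.trans {A B C : Str Γ} : ∀ {k : ℕ} {l : List (A.D × B.D × C.D)},
    EF k A B (l.map fun t => (t.1, t.2.1)) → EF k B C (l.map fun t => t.2) →
    EF k A C (l.map fun t => (t.1, t.2.2))
  | 0, l, h, h' => by
    intro p hp
    simp only [List.mem_map] at hp
    obtain ⟨p, hp, rfl⟩ := hp
    have e1 := h (p.1, p.2.1) (List.mem_map.2 ⟨p, hp, rfl⟩)
    have e2 := h' p.2 (List.mem_map.2 ⟨p, hp, rfl⟩)
    refine ⟨e1.1.trans e2.1, fun q hq => ?_⟩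
    simp only [List.mem_map] at hq
    obtain ⟨q, hq, rfl⟩ := hq
    exact (e1.2 (q.1, q.2.1) (List.mem_map.2 ⟨q, hq, rfl⟩)).trans
      (e2.2 q.2 (List.mem_map.2 ⟨q, hq, rfl⟩))
  | k + 1, l, h, h' => by
    refine ⟨EF.trans (k := 0) h.1 h'.1, fun a => ?_, fun c => ?_⟩
    · obtain ⟨b, hb⟩ := h.2.1 a
      obtain ⟨c, hc⟩ := h'.2.1 b
      exact ⟨c, EF.trans (l := (a, b, c) :: l) hb hc⟩
    · obtain ⟨b, hb⟩ := h'.2.2 c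
      obtain ⟨a, ha⟩ := h.2.2 b
      exact ⟨a, EF.trans (l := (a, b, c) :: l) ha hb⟩
theorem EF.of_map {A B : Str Γ} (f : A.D → B.D) (hf : Function.Surjective f)
    (hl : ∀ a, A.lab a = B.lab (f a)) (hr : ∀ a b, A.rel a b = B.rel (f a) (f b)) :
    ∀ (k : ℕ) (l : List (A.D × B.D)), (∀ p ∈ l, p.2 = f p.1) → EF k A B l
  | 0, l, h => fun p hp => ⟨by rw [h p hp]; exact hl _, fun q hq => by
      rw [h p hp, h q hq]; exact hr _ _⟩
  | k + 1, l, h => by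
    refine ⟨EF.of_map f hf hl hr 0 l h, fun a => ⟨f a, ?_⟩, fun b => ?_⟩
    · refine EF.of_map f hf hl hr k _ fun p hp => ?_
      rcases List.mem_cons.1 hp with rfl | hp
      · rfl
      · exact h p hp
    · obtain ⟨a, rfl⟩ := hf b
      refine ⟨a, EF.of_map f hf hl hr k _ fun p hp => ?_⟩
      rcases List.mem_cons.1 hp with rfl | hp
      · rfl
      · exact h p hp
structure Dec (A : Str Γ) {ι : Type} (B : ι → Str Γ) (g : ι → Γ → Γ)
    (cr : ι → ι → Γ → Γ → Code) where
  emb : ∀ i, (B i).D → A.D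
  cov : ∀ a, ∃ i b, emb i b = a
  lab : ∀ i b, A.lab (emb i b) = g i ((B i).lab b)
  same : ∀ i b c, A.rel (emb i b) (emb i c) = (B i).rel b c
  cross : ∀ i j b c, i ≠ j → A.rel (emb i b) (emb j c) = cr i j ((B i).lab b) ((B j).lab c)
theorem Dec.ef {A A' : Str Γ} {ι : Type} {B B' : ι → Str Γ} {g : ι → Γ → Γ}
    {cr : ι → ι → Γ → Γ → Code} (d : Dec A B g cr) (d' : Dec A' B' g cr) :
    ∀ (k : ℕ) (ls : ∀ i, List ((B i).D × (B' i).D)) (l : List (A.D × A'.D)),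
    (∀ i, EF k (B i) (B' i) (ls i)) →
    (∀ p ∈ l, ∃ i, ∃ q ∈ ls i, p = (d.emb i q.1, d'.emb i q.2)) → EF k A A' l := by
  classical
  have h0 : ∀ (ls : ∀ i, List ((B i).D × (B' i).D)) (l : List (A.D × A'.D)),
    (∀ i, EF0 (B i) (B' i) (ls i)) →
    (∀ p ∈ l, ∃ i, ∃ q ∈ ls i, p = (d.emb i q.1, d'.emb i q.2)) → EF0 A A' l := by
    intro ls l h hl p hp
    obtain ⟨i, q, hq, rfl⟩ := hl p hp
    refine ⟨?_, fun p' hp' => ?_⟩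
    · simp only [d.lab, d'.lab, (h i q hq).1]
    · obtain ⟨j, q', hq', rfl⟩ := hl p' hp'
      by_cases hij : i = j
      · subst hij
        simp only [d.same, d'.same, (h i q hq).2 q' hq']
      · simp only [d.cross _ _ _ _ hij, d'.cross _ _ _ _ hij, (h i q hq).1, (h j q' hq').1]
  intro k
  induction k with
  | zero => exact h0
  | succ k ih =>
    intro ls l h hl
    have key : ∀ i (q : (B i).D × (B' i).D), EF k (B i) (B' i) (q :: ls i) →
        EF k A A' ((d.emb i q.1, d'.emb i q.2) :: l) := by
      intro i q hq
      refine ih (Function.update ls i (q :: ls i)) _ (fun j => ?_) fun p hp => ?_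
      · by_cases hj : j = i
        · subst hj; simpa using hq
        · simpa [hj] using (h j).pred
      · rcases List.mem_cons.1 hp with rfl | hp
        · exact ⟨i, q, by simp, rfl⟩
        · obtain ⟨j, q', hq', rfl⟩ := hl p hp
          refine ⟨j, q', ?_, rfl⟩
          by_cases hj : j = i
          · subst hj; simp [hq']
          · simpa [hj] using hq'
    refine ⟨h0 ls l (fun i => (h i).zero) hl, fun a => ?_, fun b => ?_⟩
    · obtain ⟨i, b, rfl⟩ := d.cov a
      obtain ⟨b', hb'⟩ := (h i).2.1 b
      exact ⟨_, key i (b, b') hb'⟩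
    · obtain ⟨i, b, rfl⟩ := d'.cov b
      obtain ⟨b', hb'⟩ := (h i).2.2 b
      exact ⟨_, key i (b', b) hb'⟩
def FT (Γ : Type) : ℕ → ℕ → Type
  | 0, n => (Fin n → Γ) × (Fin n → Fin n → Code)
  | k + 1, n => ((Fin n → Γ) × (Fin n → Fin n → Code)) × Set (FT Γ k (n + 1))
instance FT.fin [Finite Γ] : ∀ k n, Finite (FT Γ k n)
  | 0, n => by unfold FT; infer_instance
  | k + 1, n => by
    have := FT.fin k (n + 1)
    unfold FT; infer_instance
def invt : ∀ (k n : ℕ) (A : Str Γ), (Fin n → A.D) → FT Γ k n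
  | 0, _, A, a => (fun i => A.lab (a i), fun i j => A.rel (a i) (a j))
  | k + 1, n, A, a => ((fun i => A.lab (a i), fun i j => A.rel (a i) (a j)),
      {t | ∃ x, invt k (n + 1) A (Fin.cons x a) = t})
theorem invt_ef {A B : Str Γ} : ∀ (k n : ℕ) (a : Fin n → A.D) (b : Fin n → B.D),
    invt k n A a = invt k n B b → EF k A B (List.ofFn fun i => (a i, b i)) := by
  have h0 : ∀ (n : ℕ) (a : Fin n → A.D) (b : Fin n → B.D),
    invt 0 n A a = invt 0 n B b → EF0 A B (List.ofFn fun i => (a i, b i)) := by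
    intro n a b h p hp
    obtain ⟨i, rfl⟩ := List.mem_ofFn.1 hp
    replace h := Prod.mk.inj h
    refine ⟨congrFun h.1 i, fun q hq => ?_⟩
    obtain ⟨j, rfl⟩ := List.mem_ofFn.1 hq
    exact congrFun (congrFun h.2 i) j
  intro k
  induction k with
  | zero => exact h0
  | succ k ih =>
    intro n a b h
    replace h := Prod.mk.inj h
    have hs : ∀ x y, invt k (n+1) A (Fin.cons x a) = invt k (n+1) B (Fin.cons y b) →
        EF k A B ((x, y) :: List.ofFn fun i => (a i, b i)) := by
      intro x y hxy
      have := ih _ _ _ hxy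
      rw [List.ofFn_succ] at this
      simpa using this
    refine ⟨h0 n a b h.1, fun x => ?_, fun y => ?_⟩
    · have : invt k (n+1) A (Fin.cons x a) ∈ {t | ∃ x, invt k (n + 1) B (Fin.cons x b) = t} := by
        rw [← h.2]; exact ⟨x, rfl⟩
      obtain ⟨y, hy⟩ := this
      exact ⟨y, hs x y hy.symm⟩
    · have : invt k (n+1) B (Fin.cons y b) ∈ {t | ∃ x, invt k (n + 1) A (Fin.cons x a) = t} := by
        rw [h.2]; exact ⟨y, rfl⟩
      obtain ⟨x, hx⟩ := this
      exact ⟨x, hs x y hx⟩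
def strSetoid (Γ : Type) (k : ℕ) : Setoid (Str Γ) where
  r A B := EF k A B []
  iseqv := ⟨fun A => EF.of_map id Function.surjective_id (fun _ => rfl) (fun _ _ => rfl) k []
      (by simp), fun h => EF.symm h, fun h h' => EF.trans (l := []) h h'⟩
def TyQ (Γ : Type) (k : ℕ) : Type 1 := Quotient (strSetoid Γ k)
def ty (k : ℕ) (A : Str Γ) : TyQ Γ k := Quotient.mk (strSetoid Γ k) A
theorem ty_eq {k : ℕ} {A B : Str Γ} : ty k A = ty k B ↔ EF k A B [] :=
  ⟨fun h => Quotient.exact h, fun h => Quotient.sound (s := strSetoid Γ k) h⟩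
instance [Finite Γ] (k : ℕ) : Finite (TyQ Γ k) := by
  refine Finite.of_injective (β := FT Γ k 0)
    (fun q => invt k 0 (Quotient.out (s := strSetoid Γ k) q) Fin.elim0) ?_
  intro q r h
  have := invt_ef _ _ _ _ h
  simp only [List.ofFn_zero] at this
  have := ty_eq.2 this
  simp only [ty] at this
  exact (Quotient.out_eq (s := strSetoid Γ k) q).symm.trans
    (this.trans (Quotient.out_eq (s := strSetoid Γ k) r))
end EFsec
section Mon
variable {Λ : Type}
def Str.mul (A B : Str (Λ × Code)) : Str (Λ × Code) where
  D := A.D ⊕ B.D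
  rel
    | .inl a, .inl b => A.rel a b
    | .inr a, .inr b => B.rel a b
    | .inl a, .inr _ => (A.lab a).2
    | .inr _, .inl b => (A.lab b).2.conv
  lab
    | .inl a => A.lab a
    | .inr b => B.lab b
def Str.one : Str (Λ × Code) where
  D := Empty
  rel := fun a => a.elim
  lab := fun a => a.elim
def mulCr (i j : Bool) (γ γ' : Λ × Code) : Code :=
  match i, j with
  | false, _ => γ.2
  | true, _ => γ'.2.conv
def mulDec (A B : Str (Λ × Code)) : Dec (A.mul B) (fun b : Bool => cond b B A) (fun _ γ => γ)
    mulCr where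
  emb b := match b with
    | false => Sum.inl
    | true => Sum.inr
  cov a := match a with
    | .inl a => ⟨false, a, rfl⟩
    | .inr a => ⟨true, a, rfl⟩
  lab b := match b with
    | false => fun _ => rfl
    | true => fun _ => rfl
  same b := match b with
    | false => fun _ _ => rfl
    | true => fun _ _ => rfl
  cross i j := match i, j with
    | false, false => by simp
    | false, true => fun _ _ _ => rfl
    | true, false => fun _ _ _ => rfl
    | true, true => by simp
theorem mul_ef {k : ℕ} {A A' B B' : Str (Λ × Code)} (h : EF k A A' []) (h' : EF k B B' []) :
    EF k (A.mul B) (A'.mul B') [] :=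
  (mulDec A B).ef (mulDec A' B') k (fun _ => []) [] (fun b => match b with
    | false => h
    | true => h') (by simp)
instance tyMonoid (k : ℕ) : Monoid (TyQ (Λ × Code) k) where
  mul := Quotient.map₂ Str.mul fun _ _ h _ _ h' => mul_ef h h'
  one := ty k Str.one
  mul_assoc a b c := by
    induction a using Quotient.ind with | _ A =>
    induction b using Quotient.ind with | _ B =>
    induction c using Quotient.ind with | _ C =>
    refine ty_eq.2 (EF.of_map (A := (A.mul B).mul C) (B := A.mul (B.mul C)) (fun x => match x with
      | .inl (.inl a) => .inl a
      | .inl (.inr a) => .inr (.inl a)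
      | .inr a => .inr (.inr a)) ?_ ?_ ?_ k [] (by simp))
    · rintro (a | a | a)
      · exact ⟨.inl (.inl a), rfl⟩
      · exact ⟨.inl (.inr a), rfl⟩
      · exact ⟨.inr a, rfl⟩
    · rintro ((a | a) | a) <;> rfl
    · rintro ((a | a) | a) ((b | b) | b) <;> rfl
  one_mul a := by
    induction a using Quotient.ind with | _ A =>
    refine ty_eq.2 (EF.of_map (A := Str.one.mul A) (B := A) (fun x => match x with
      | .inl a => (a : Empty).elim
      | .inr a => a) ?_ ?_ ?_ k [] (by simp))
    · intro a; exact ⟨.inr a, rfl⟩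
    · rintro (a | a)
      · exact (a : Empty).elim
      · rfl
    · rintro (a | a) (b | b)
      · exact (a : Empty).elim
      · exact (a : Empty).elim
      · exact (b : Empty).elim
      · rfl
  mul_one a := by
    induction a using Quotient.ind with | _ A =>
    refine ty_eq.2 (EF.of_map (A := A.mul Str.one) (B := A) (fun x => match x with
      | .inr a => (a : Empty).elim
      | .inl a => a) ?_ ?_ ?_ k [] (by simp))
    · intro a; exact ⟨.inl a, rfl⟩
    · rintro (a | a)
      · rfl
      · exact (a : Empty).elim
    · rintro (a | a) (b | b)
      · rfl
      · exact (b : Empty).elim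
      · exact (a : Empty).elim
      · exact (a : Empty).elim
theorem ty_mul (k : ℕ) (A B : Str (Λ × Code)) : ty k (A.mul B) = ty k A * ty k B := rfl
def powS (A : Str (Λ × Code)) (n : ℕ) : Str (Λ × Code) where
  D := {p : ℕ × A.D // p.1 < n}
  rel p q := if p.1.1 = q.1.1 then A.rel p.1.2 q.1.2 else if p.1.1 < q.1.1 then
    (A.lab p.1.2).2 else (A.lab q.1.2).2.conv
  lab p := A.lab p.1.2
theorem ty_pow (k : ℕ) (A : Str (Λ × Code)) (n : ℕ) : ty k (powS A n) = ty k A ^ n := by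
  induction n with
  | zero =>
    rw [pow_zero]
    refine ty_eq.2 (EF.of_map (A := powS A 0) (B := Str.one) (fun x => absurd x.2 (by simp)) ?_ ?_ ?_ k [] (by simp))
    · intro x; exact (x : Empty).elim
    · intro a; exact absurd a.2 (by simp)
    · intro a; exact absurd a.2 (by simp)
  | succ n ih =>
    rw [pow_succ, ← ih, ← ty_mul]
    symm
    refine ty_eq.2 (EF.of_map (A := (powS A n).mul A) (B := powS A (n + 1)) (fun x => match x with
      | .inl a => ⟨a.1, a.2.trans (Nat.lt_succ_self n)⟩
      | .inr a => ⟨(n, a), Nat.lt_succ_self n⟩) ?_ ?_ ?_ k [] (by simp))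
    · rintro ⟨⟨i, a⟩, h⟩
      rcases Nat.lt_succ_iff_lt_or_eq.1 h with h | h
      · exact ⟨.inl ⟨(i, a), h⟩, rfl⟩
      · refine ⟨.inr a, ?_⟩
        simp only at h
        subst h; rfl
    · rintro (a | a) <;> rfl
    · rintro (⟨⟨i, a⟩, hi⟩ | a) (⟨⟨j, b⟩, hj⟩ | b)
      · rfl
      · have hi : i < n := hi
        simp [powS, Str.mul, hi, hi.ne]
      · have hj : j < n := hj
        simp [powS, Str.mul, hj.ne', hj.le]
      · simp [powS, Str.mul]
def pow3 (A : Str (Λ × Code)) (i r : ℕ) : Fin 3 → Str (Λ × Code)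
  | 0 => powS A i
  | 1 => A
  | 2 => powS A r
def pow3Cr (i j : Fin 3) (γ γ' : Λ × Code) : Code := if i < j then γ.2 else γ'.2.conv
def powDec (A : Str (Λ × Code)) (i r n : ℕ) (h : n = i + 1 + r) :
    Dec (powS A n) (pow3 A i r) (fun _ γ => γ) pow3Cr where
  emb b := match b with
    | 0 => fun (x : (powS A i).D) => ⟨x.1, x.2.trans (by omega)⟩
    | 1 => fun (a : A.D) => ⟨(i, a), by simp; omega⟩
    | 2 => fun (x : (powS A r).D) => ⟨(i + 1 + x.1.1, x.1.2), by have := x.2; simp; omega⟩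
  cov := by
    rintro ⟨⟨j, a⟩, hj⟩
    simp only at hj
    rcases lt_trichotomy j i with h' | h' | h'
    · exact ⟨0, (⟨(j, a), h'⟩ : (powS A i).D), rfl⟩
    · subst h'; exact ⟨1, a, rfl⟩
    · refine ⟨2, (⟨(j - (i + 1), a), by simp; omega⟩ : (powS A r).D), ?_⟩
      apply Subtype.ext
      simp only [Prod.mk.injEq, and_true]
      omega
  lab b := match b with
    | 0 => fun _ => rfl
    | 1 => fun _ => rfl
    | 2 => fun _ => rfl
  same b := match b with
    | 0 => fun _ _ => rfl
    | 1 => fun (x y : A.D) => by simp [powS, pow3]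
    | 2 => fun (x y : (powS A r).D) => by simp [powS, pow3]
  cross b c := match b, c with
    | 0, 0 => fun _ _ h => absurd rfl h
    | 1, 1 => fun _ _ h => absurd rfl h
    | 2, 2 => fun _ _ h => absurd rfl h
    | 0, 1 => fun (x : (powS A i).D) (y : A.D) _ => by
        have := x.2
        have e1 : x.1.1 ≠ i := by omega
        simp [powS, pow3, pow3Cr, e1, this]
    | 0, 2 => fun (x : (powS A i).D) (y : (powS A r).D) _ => by
        have := x.2
        have e1 : x.1.1 ≠ i + 1 + y.1.1 := by omega
        have e2 : x.1.1 < i + 1 + y.1.1 := by omega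
        simp [powS, pow3, pow3Cr, e1, e2]
    | 1, 2 => fun (x : A.D) (y : (powS A r).D) _ => by
        have e1 : i ≠ i + 1 + y.1.1 := by omega
        have e2 : i < i + 1 + y.1.1 := by omega
        simp [powS, pow3, pow3Cr, e1, e2]
    | 1, 0 => fun (y : A.D) (x : (powS A i).D) _ => by
        have := x.2
        have e1 : i ≠ x.1.1 := by omega
        have e2 : ¬ i < x.1.1 := by omega
        simp [powS, pow3, pow3Cr, e1, e2]
    | 2, 0 => fun (y : (powS A r).D) (x : (powS A i).D) _ => by
        have := x.2
        have e1 : i + 1 + y.1.1 ≠ x.1.1 := by omega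
        have e2 : ¬ i + 1 + y.1.1 < x.1.1 := by omega
        simp [powS, pow3, pow3Cr, e1, e2]
    | 2, 1 => fun (y : (powS A r).D) (x : A.D) _ => by
        have e1 : i + 1 + y.1.1 ≠ i := by omega
        have e2 : ¬ i + 1 + y.1.1 < i := by omega
        simp [powS, pow3, pow3Cr, e1, e2]
theorem pow_ef (A : Str (Λ × Code)) : ∀ (k n m : ℕ), n = m ∨ (2 ^ k ≤ n + 1 ∧ 2 ^ k ≤ m + 1) →
    EF k (powS A n) (powS A m) [] := by
  intro k
  induction k with
  | zero => intro n m _ p hp; simp at hp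
  | succ k ih =>
    intro n m h
    by_cases hnm : n = m
    · subst hnm
      exact ty_eq.1 rfl
    have half : ∀ n m : ℕ, 2 ^ (k+1) ≤ n + 1 → 2 ^ (k+1) ≤ m + 1 → ∀ x : (powS A n).D,
        ∃ y : (powS A m).D, EF k (powS A n) (powS A m) [(x, y)] := by
      intro n m hn hm x
      have hx := x.2
      have hp : 2 ^ (k+1) = 2 ^ k + 2 ^ k := by ring
      have hp1 : 1 ≤ 2 ^ k := Nat.one_le_two_pow
      rw [hp] at hn hm
      obtain ⟨i', hi', h1, h2⟩ : ∃ i', i' < m ∧ (x.1.1 = i' ∨ (2 ^ k ≤ x.1.1 + 1 ∧ 2 ^ k ≤ i' + 1))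
          ∧ (n - 1 - x.1.1 = m - 1 - i' ∨ (2 ^ k ≤ n - 1 - x.1.1 + 1 ∧ 2 ^ k ≤ m - 1 - i' + 1)) := by
        by_cases c1 : x.1.1 + 1 < 2 ^ k
        · exact ⟨x.1.1, by omega, Or.inl rfl, Or.inr (by omega)⟩
        · by_cases c2 : n - 1 - x.1.1 + 1 < 2 ^ k
          · exact ⟨m - 1 - (n - 1 - x.1.1), by omega, Or.inr (by omega), Or.inl (by omega)⟩
          · exact ⟨2 ^ k - 1, by omega, Or.inr (by omega), Or.inr (by omega)⟩
      refine ⟨⟨(i', x.1.2), hi'⟩, ?_⟩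
      let d := powDec A x.1.1 (n - 1 - x.1.1) n (by omega)
      let d' := powDec A i' (m - 1 - i') m (by omega)
      refine d.ef d' k (fun b => match b with
        | 0 => []
        | 1 => [((x.1.2 : A.D), (x.1.2 : A.D))]
        | 2 => []) _ (fun b => match b with
        | 0 => ih _ _ h1
        | 1 => EF.of_map id Function.surjective_id (fun _ => rfl) (fun _ _ => rfl) k _
            (fun p hp => by rw [List.mem_singleton.1 hp]; rfl)
        | 2 => ih _ _ h2) ?_
      intro p hp
      rw [List.mem_singleton] at hp
      subst hp
      exact ⟨1, (x.1.2, x.1.2), List.mem_singleton.2 rfl, rfl⟩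
    rcases h with h | ⟨h1, h2⟩
    · exact absurd h hnm
    refine ⟨fun p hp => by simp at hp, half n m h1 h2, fun b => ?_⟩
    obtain ⟨a, ha⟩ := half m n h2 h1 b
    exact ⟨a, ha.symm⟩
theorem ty_aper {k : ℕ} (q t : TyQ (Λ × Code) k) {n : ℕ} (hn : 1 ≤ n) (h : q * t ^ n = q) :
    q * t = q := by
  induction t using Quotient.ind with | _ A =>
  change q * ty k A = q
  change q * ty k A ^ n = q at h
  have h2 : ∀ N, q * (ty k A) ^ (n * N) = q := by
    intro N
    induction N with
    | zero => simp
    | succ N ih => rw [Nat.mul_succ, pow_add, ← mul_assoc, ih, h]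
  have h3 : ty k A ^ (n * 2 ^ k) = ty k A ^ (n * 2 ^ k + 1) := by
    rw [← ty_pow, ← ty_pow, ty_eq]
    have : 2 ^ k ≤ n * 2 ^ k := Nat.le_mul_of_pos_left _ hn
    exact pow_ef A k _ _ (Or.inr (by omega))
  calc q * ty k A = q * ty k A ^ (n * 2 ^ k) * ty k A := by rw [h2]
    _ = q * ty k A ^ (n * 2 ^ k + 1) := by rw [pow_succ, mul_assoc]
    _ = q := by rw [← h3, h2]
end Mon
end OPLTheory
end
noncomputable section
namespace OPLTheory
section Key
open Relation
universe u v
variable {X : Type v}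
structure BCl (D : Set (Set X)) : Prop where
  tt : Set.univ ∈ D
  neg : ∀ {φ}, φ ∈ D → φᶜ ∈ D
  or : ∀ {φ ψ}, φ ∈ D → ψ ∈ D → φ ∪ ψ ∈ D
theorem BCl.and {D : Set (Set X)} (h : BCl D) {φ ψ : Set X} (a : φ ∈ D) (b : ψ ∈ D) :
    φ ∩ ψ ∈ D := by
  have := h.neg (h.or (h.neg a) (h.neg b))
  rwa [Set.compl_union, compl_compl, compl_compl] at this
theorem BCl.ff {D : Set (Set X)} (h : BCl D) : (∅ : Set X) ∈ D := by
  have := h.neg h.tt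
  rwa [Set.compl_univ] at this
theorem BCl.iUn {D : Set (Set X)} (h : BCl D) {ι : Type*} [Finite ι] {S : ι → Set X}
    (hS : ∀ i, S i ∈ D) : (⋃ i, S i) ∈ D := by
  classical
  have := Fintype.ofFinite ι
  have : ∀ s : Finset ι, (⋃ i ∈ s, S i) ∈ D := by
    intro s
    induction s using Finset.induction_on with
    | empty => simpa using h.ff
    | insert a s _ ih =>
      rw [Finset.set_biUnion_insert]
      exact h.or (hS a) ih
  simpa using this Finset.univ
theorem BCl.ifp {D : Set (Set X)} (h : BCl D) {p : Prop} {S : Set X} (hS : S ∈ D) :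
    {x | p ∧ x ∈ S} ∈ D := by
  by_cases hp : p
  · simpa [hp] using hS
  · simpa [hp] using h.ff
def EXs (step : X → X → Prop) (ψ : Set X) : Set X := {r | ∃ q, step r q ∧ q ∈ ψ}
def PXs (step : X → X → Prop) (ψ : Set X) : Set X := {q | ∃ r, step r q ∧ r ∈ ψ}
def EUs (step : X → X → Prop) (φ ψ : Set X) : Set X :=
  {r | ∃ x, ReflTransGen (fun p q => step p q ∧ q ∈ φ) r x ∧ x ∈ ψ}
def PSs (step : X → X → Prop) (φ ψ : Set X) : Set X :=
  {x | ∃ r, ReflTransGen (fun p q => step p q ∧ q ∈ φ) r x ∧ r ∈ ψ}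
def UPar (step : X → X → Prop) : Prop := ∀ p p' q, step p q → step p' q → p = p'
structure FC (D : Set (Set X)) (step : X → X → Prop) : Prop extends BCl D where
  ex : ∀ {ψ}, ψ ∈ D → EXs step ψ ∈ D
  px : ∀ {ψ}, ψ ∈ D → PXs step ψ ∈ D
  eu : ∀ {φ ψ}, φ ∈ D → ψ ∈ D → EUs step φ ψ ∈ D
  ps : ∀ {φ ψ}, φ ∈ D → ψ ∈ D → PSs step φ ψ ∈ D
  up : UPar step
inductive PathF {Q : Type u} (step : X → X → Prop) (lab : X → Q → Q) : X → X → (Q → Q) → Prop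
  | refl (r : X) : PathF step lab r r id
  | snoc {r p q : X} {f : Q → Q} : PathF step lab r p f → step p q →
      PathF step lab r q (lab q ∘ f)
inductive Clo {Q : Type u} (L : Set (Q → Q)) : (Q → Q) → Prop
  | one : Clo L id
  | comp {l f : Q → Q} : l ∈ L → Clo L f → Clo L (l ∘ f)
theorem Clo.mul {Q : Type u} {L : Set (Q → Q)} {f g : Q → Q} (hf : Clo L f) (hg : Clo L g) :
    Clo L (f ∘ g) := by
  induction hf with
  | one => exact hg
  | comp hl _ ih => exact Clo.comp (f := _ ∘ g) hl ih
theorem Clo.mono {Q : Type u} {L L' : Set (Q → Q)} (h : L ⊆ L') {f : Q → Q} (hf : Clo L f) :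
    Clo L' f := by
  induction hf with
  | one => exact Clo.one
  | comp hl _ ih => exact Clo.comp (h hl) ih
def CFree {Q : Type u} (L : Set (Q → Q)) : Prop :=
  ∀ f, Clo L f → ∀ n, 1 ≤ n → ∀ q, f^[n] q = q → f q = q
def FutP {Q : Type u} (step : X → X → Prop) (lab : X → Q → Q) (f : Q → Q) (ψ : Set X) : Set X :=
  {r | ∃ x, PathF step lab r x f ∧ x ∈ ψ}
def PastP {Q : Type u} (step : X → X → Prop) (lab : X → Q → Q) (f : Q → Q) (ψ : Set X) : Set X :=
  {x | ∃ r, PathF step lab r x f ∧ r ∈ ψ}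
theorem PathF.trans {Q : Type u} {step : X → X → Prop} {lab : X → Q → Q} {r p x : X}
    {f g : Q → Q} (h : PathF step lab r p f) (h' : PathF step lab p x g) :
    PathF step lab r x (g ∘ f) := by
  induction h' with
  | refl => exact h
  | snoc _ hs ih => exact PathF.snoc ih hs
theorem PathF.mono {Q : Type u} {step step' : X → X → Prop} {lab : X → Q → Q}
    (hm : ∀ p q, step p q → step' p q) {r p : X}
    {f : Q → Q} (h : PathF step lab r p f) : PathF step' lab r p f := by
  induction h with
  | refl => exact .refl _
  | snoc _ hs ih => exact .snoc ih (hm _ _ hs)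
theorem PathF.clo {Q : Type u} {step : X → X → Prop} {lab : X → Q → Q} {L : Set (Q → Q)}
    (hL : ∀ p q, step p q → lab q ∈ L) {r p : X}
    {f : Q → Q} (h : PathF step lab r p f) : Clo L f := by
  induction h with
  | refl => exact .one
  | snoc _ hs ih => exact .comp (hL _ _ hs) ih
theorem PathF.rtg {Q : Type u} {step : X → X → Prop} {lab : X → Q → Q} {r p : X}
    {f : Q → Q} (h : PathF step lab r p f) : ReflTransGen step r p := by
  induction h with
  | refl => exact .refl
  | snoc _ hs ih => exact ih.tail hs
theorem exists_path {Q : Type u} {step : X → X → Prop} (lab : X → Q → Q) {r p : X}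
    (h : ReflTransGen step r p) : ∃ f, PathF step lab r p f := by
  induction h with
  | refl => exact ⟨_, .refl _⟩
  | tail _ hs ih => obtain ⟨f, hf⟩ := ih; exact ⟨_, .snoc hf hs⟩
theorem key_base {Q : Type u} [Finite Q] {D : Set (Set X)} {step : X → X → Prop}
    (hD : FC D step) {L : Set (Q → Q)} {lab : X → Q → Q}
    (hL : ∀ p q, step p q → lab q ∈ L) (hcf : CFree L)
    (hs : ∀ f ∈ L, Function.Surjective f) (f : Q → Q) {ψ : Set X} (hψ : ψ ∈ D) :
    FutP step lab f ψ ∈ D ∧ PastP step lab f ψ ∈ D := by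
  have hid : ∀ f ∈ L, f = id := by
    intro f hf
    funext q
    have hb : Function.Bijective f := ⟨Finite.injective_iff_surjective.2 (hs f hf), hs f hf⟩
    let e : Equiv.Perm Q := Equiv.ofBijective f hb
    obtain ⟨n, hn, he⟩ := (isOfFinOrder_iff_pow_eq_one (x := e)).1 (isOfFinOrder_of_finite e)
    refine hcf f (by simpa using Clo.comp hf Clo.one) n hn q ?_
    have : (e ^ n) q = q := by rw [he]; rfl
    rwa [Equiv.Perm.coe_pow] at this
  have hp : ∀ r x, PathF step lab r x f ↔ f = id ∧
      ReflTransGen (fun p q => step p q ∧ q ∈ (Set.univ : Set X)) r x := by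
    intro r x
    simp only [Set.mem_univ, and_true]
    constructor
    · intro h
      refine ⟨?_, h.rtg⟩
      clear hψ
      induction h with
      | refl => rfl
      | snoc _ hs ih => rw [hid _ (hL _ _ hs), ih]; rfl
    · rintro ⟨rfl, h⟩
      induction h with
      | refl => exact .refl _
      | tail _ hs ih =>
        have := PathF.snoc ih hs
        rwa [hid _ (hL _ _ hs)] at this
  constructor
  · have := hD.ifp (p := f = id) (hD.eu hD.tt hψ)
    convert this using 1
    ext r
    simp only [FutP, hp, EUs, Set.mem_ofPred_eq]
    grind
  · have := hD.ifp (p := f = id) (hD.ps hD.tt hψ)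
    convert this using 1
    ext r
    simp only [PastP, hp, PSs, Set.mem_ofPred_eq]
    grind
section Ind
variable {Q : Type u} (step : X → X → Prop) (lab : X → Q → Q) (c : Q → Q)
def stepB (p q : X) : Prop := step p q ∧ lab q ≠ c
def stepC (p q : X) : Prop :=
  lab p = c ∧ lab q = c ∧ ∃ p', ReflTransGen (stepB step lab c) p p' ∧ step p' q
def segC (g : Q → Q) (q : X) : Prop :=
  ∃ p p', lab p = c ∧ PathF (stepB step lab c) lab p p' g ∧ step p' q
def cR (q : Q) : Set.range c := ⟨c q, q, rfl⟩
open Classical in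
def labC (q : X) : Set.range c → Set.range c :=
  if h : ∃ g, segC step lab c g q then fun z => cR c (h.choose z.1) else id
variable {step lab c}
theorem seg_unique (up : UPar step) {p1 p2 q : X} {f1 f2 : Q → Q}
    (h1 : lab p1 = c) (h2 : lab p2 = c) (r1 : PathF (stepB step lab c) lab p1 q f1)
    (r2 : PathF (stepB step lab c) lab p2 q f2) : p1 = p2 ∧ f1 = f2 := by
  induction r1 generalizing f2 with
  | refl =>
    cases r2 with
    | refl => exact ⟨rfl, rfl⟩
    | snoc _ hs => exact absurd h1 hs.2
  | snoc _ hs ih =>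
    cases r2 with
    | refl => exact absurd h2 hs.2
    | snoc h hs' =>
      cases up _ _ _ hs.1 hs'.1
      obtain ⟨e1, e2⟩ := ih h
      exact ⟨e1, by rw [e2]⟩
theorem segC_unique (up : UPar step) {q : X} {f1 f2 : Q → Q}
    (h1 : segC step lab c f1 q) (h2 : segC step lab c f2 q) : f1 = f2 := by
  obtain ⟨p, p', a, b, d⟩ := h1
  obtain ⟨r, r', a', b', d'⟩ := h2
  cases up _ _ _ d d'
  exact (seg_unique up a a' b b').2
theorem labC_eq (up : UPar step) {q : X} {g : Q → Q}
    (h : segC step lab c g q) : labC step lab c q = fun z => cR c (g z.1) := by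
  have hex : ∃ g, segC step lab c g q := ⟨g, h⟩
  unfold labC
  rw [dif_pos hex, segC_unique up hex.choose_spec h]
theorem stepB_rtg {φ : Set X} {p q : X}
    (h : ReflTransGen (stepB step lab c) p q) :
    ReflTransGen (fun p q => step p q ∧ q ∈ {x | lab x = c}ᶜ ∪ φ) p q :=
  ReflTransGen.mono (fun _ _ h => ⟨h.1, Or.inl h.2⟩) _ _ h
theorem stepC_rtg_iff {φ : Set X} {r : X} (hr : lab r = c) (x : X) :
    (ReflTransGen (fun p q => stepC step lab c p q ∧ q ∈ φ) r x) ↔ lab x = c ∧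
      ReflTransGen (fun p q => step p q ∧ q ∈ {x | lab x = c}ᶜ ∪ φ) r x := by
  constructor
  · intro h
    induction h with
    | refl => exact ⟨hr, .refl⟩
    | tail _ hs ih =>
      obtain ⟨⟨_, h2, p', h3, h4⟩, h5⟩ := hs
      exact ⟨h2, (ih.2.trans (stepB_rtg h3)).tail ⟨h4, Or.inr h5⟩⟩
  · rintro ⟨hx, h⟩
    have : ∃ z, lab z = c ∧ ReflTransGen (fun p q => stepC step lab c p q ∧ q ∈ φ) r z ∧
        ReflTransGen (stepB step lab c) z x := by
      clear hx
      induction h with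
      | refl => exact ⟨r, hr, .refl, .refl⟩
      | @tail y q _ hs ih =>
        obtain ⟨z, hz, h1, h2⟩ := ih
        by_cases hq : lab q = c
        · have hq' : q ∈ φ := hs.2.resolve_left fun h => h hq
          exact ⟨q, hq, h1.tail ⟨⟨hz, hq, y, h2, hs.1⟩, hq'⟩, .refl⟩
        · exact ⟨z, hz, h1, h2.tail ⟨hs.1, hq⟩⟩
    obtain ⟨z, hz, h1, h2⟩ := this
    rcases ReflTransGen.cases_tail h2 with e | ⟨_, _, e⟩
    · rwa [e]
    · exact absurd hx e.2
theorem stepC_rtg_ne {φ : Set X} {r x : X} (hr : lab r ≠ c ∨ lab x ≠ c) 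
    (h : ReflTransGen (fun p q => stepC step lab c p q ∧ q ∈ φ) r x) : r = x := by
  rcases hr with hr | hr
  · rcases ReflTransGen.cases_head h with e | ⟨_, e, _⟩
    · exact e
    · exact absurd e.1.1 hr
  · rcases ReflTransGen.cases_tail h with e | ⟨_, _, e⟩
    · exact e.symm
    · exact absurd e.1.2.1 hr
theorem fcB {D : Set (Set X)} (hD : FC D step) (hC : {x | lab x = c} ∈ D) :
    FC D (stepB step lab c) where
  toBCl := hD.toBCl
  ex {ψ} h := by
    convert hD.ex (hD.and (hD.neg hC) h) using 1
    ext x; simp [EXs, stepB]; grind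
  px {ψ} h := by
    convert hD.and (hD.neg hC) (hD.px h) using 1
    ext x; simp [PXs, stepB]; grind
  eu {φ ψ} h h' := by
    convert hD.eu (hD.and (hD.neg hC) h) h' using 1
    ext x; simp [EUs, stepB, and_assoc]
  ps {φ ψ} h h' := by
    convert hD.ps (hD.and (hD.neg hC) h) h' using 1
    ext x; simp [PSs, stepB, and_assoc]
  up _ _ _ h h' := hD.up _ _ _ h.1 h'.1
theorem fcC {D : Set (Set X)} (hD : FC D step) (hC : {x | lab x = c} ∈ D) :
    FC D (stepC step lab c) where
  toBCl := hD.toBCl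
  ex {ψ} h := by
    convert hD.and hC (hD.eu (hD.neg hC) (hD.ex (hD.and hC h))) using 1
    ext x
    constructor
    · rintro ⟨q, ⟨h1, h2, p', h3, h4⟩, h5⟩
      exact ⟨h1, p', h3, q, h4, h2, h5⟩
    · rintro ⟨h1, p', h3, q, h4, h2, h5⟩
      exact ⟨q, ⟨h1, h2, p', h3, h4⟩, h5⟩
  px {ψ} h := by
    convert hD.and hC (hD.px (hD.ps (hD.neg hC) (hD.and hC h))) using 1
    ext x
    constructor
    · rintro ⟨q, ⟨h1, h2, p', h3, h4⟩, h5⟩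
      exact ⟨h2, p', h4, q, h3, h1, h5⟩
    · rintro ⟨h2, p', h4, q, h3, h1, h5⟩
      exact ⟨q, ⟨h1, h2, p', h3, h4⟩, h5⟩
  eu {φ ψ} h h' := by
    convert hD.or (hD.and hC (hD.eu (hD.or (hD.neg hC) h) (hD.and hC h')))
      (hD.and (hD.neg hC) h') using 1
    ext r
    by_cases hr : lab r = c
    · constructor
      · rintro ⟨x, h0, h3⟩
        obtain ⟨h1, h2⟩ := (stepC_rtg_iff hr x).1 h0
        exact Or.inl ⟨hr, x, h2, h1, h3⟩
      · rintro (⟨_, x, h2, h1, h3⟩ | ⟨h1, _⟩)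
        · exact ⟨x, (stepC_rtg_iff hr x).2 ⟨h1, h2⟩, h3⟩
        · exact absurd hr h1
    · constructor
      · rintro ⟨x, h1, h2⟩
        rw [← stepC_rtg_ne (Or.inl hr) h1] at h2
        exact Or.inr ⟨hr, h2⟩
      · rintro (⟨h1, _⟩ | ⟨_, h1⟩)
        · exact absurd h1 hr
        · exact ⟨r, .refl, h1⟩
  ps {φ ψ} h h' := by
    convert hD.or (hD.and hC (hD.ps (hD.or (hD.neg hC) h) (hD.and hC h')))
      (hD.and (hD.neg hC) h') using 1
    ext r
    by_cases hr : lab r = c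
    · constructor
      · rintro ⟨x, h1, h3⟩
        have hx : lab x = c := by
          by_contra hx
          rw [stepC_rtg_ne (Or.inl hx) h1] at hx
          exact hx hr
        exact Or.inl ⟨hr, x, ((stepC_rtg_iff hx r).1 h1).2, hx, h3⟩
      · rintro (⟨_, x, h2, h1, h3⟩ | ⟨h1, _⟩)
        · exact ⟨x, (stepC_rtg_iff h1 r).2 ⟨hr, h2⟩, h3⟩
        · exact absurd hr h1
    · constructor
      · rintro ⟨x, h1, h2⟩
        rw [stepC_rtg_ne (Or.inr hr) h1] at h2
        exact Or.inr ⟨hr, h2⟩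
      · rintro (⟨h1, _⟩ | ⟨_, h1⟩)
        · exact absurd h1 hr
        · exact ⟨r, .refl, h1⟩
  up p p' q h h' := by
    obtain ⟨h1, h2, x, h3, h4⟩ := h
    obtain ⟨h1', h2', x', h3', h4'⟩ := h'
    cases hD.up _ _ _ h4 h4'
    obtain ⟨f, hf⟩ := exists_path lab h3
    obtain ⟨f', hf'⟩ := exists_path lab h3'
    exact (seg_unique hD.up h1 h1' hf hf').1
theorem path_C_of {y z : X} (hy : lab y = c) {f' : Set.range c → Set.range c}
    (h : PathF (stepC step lab c) (labC step lab c) y z f') : lab z = c := by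
  cases h with
  | refl => exact hy
  | snoc _ h => exact h.2.1
theorem path_decomp (up : UPar step) (r x : X) (f : Q → Q) :
    PathF step lab r x f ↔ PathF (stepB step lab c) lab r x f ∨
      ∃ (t : (Q → Q) × (Set.range c → Set.range c) × (Q → Q)),
        (∀ q, f q = t.2.2 (t.2.1 (cR c (t.1 q)))) ∧
        ∃ p' y z, PathF (stepB step lab c) lab r p' t.1 ∧ step p' y ∧ lab y = c ∧
          PathF (stepC step lab c) (labC step lab c) y z t.2.1 ∧
          PathF (stepB step lab c) lab z x t.2.2 := by
  constructor
  · intro h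
    induction h with
    | refl => exact Or.inl (.refl _)
    | @snoc p q f h hs ih =>
      by_cases hq : lab q = c
      · right
        rcases ih with ih | ⟨⟨f0, f1, f2⟩, hf, p', y, z, h1, h2, h3, h4, h5⟩
        · exact ⟨(f, id, id), fun s => by simp [cR, hq], p, q, q, ih, hs, hq, .refl _, .refl _⟩
        · refine ⟨(f0, labC step lab c q ∘ f1, id), fun s => ?_, p', y, q, h1, h2, h3,
            .snoc h4 ⟨path_C_of h3 h4, hq, p, h5.rtg, hs⟩, .refl _⟩
          rw [labC_eq up ⟨z, p, path_C_of h3 h4, h5, hs⟩]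
          simp only [Function.comp, hf, hq, cR, id]
      · rcases ih with ih | ⟨⟨f0, f1, f2⟩, hf, p', y, z, h1, h2, h3, h4, h5⟩
        · exact Or.inl (.snoc ih ⟨hs, hq⟩)
        · refine Or.inr ⟨(f0, f1, lab q ∘ f2), fun s => ?_, p', y, z, h1, h2, h3, h4,
            .snoc h5 ⟨hs, hq⟩⟩
          simp only [Function.comp, hf]
  · have hB : ∀ p q, stepB step lab c p q → step p q := fun p q h => h.1
    rintro (h | ⟨⟨f0, f1, f2⟩, hf, p', y, z, h1, h2, h3, h4, h5⟩)
    · exact h.mono hB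
    · simp only at h1 h4 h5 hf
      have : ∃ g : Q → Q, PathF step lab y z g ∧ ∀ s : Set.range c, g s.1 = (f1 s).1 := by
        clear hf h5
        induction h4 with
        | refl => exact ⟨id, .refl _, fun _ => rfl⟩
        | @snoc p q f' h hs ih =>
          obtain ⟨g, hg, hg'⟩ := ih
          obtain ⟨e1, e2, p'', e3, e4⟩ := hs
          obtain ⟨k, hk⟩ := exists_path lab e3
          refine ⟨_, hg.trans ((hk.mono hB).snoc e4), fun s => ?_⟩
          rw [labC_eq up ⟨p, p'', e1, hk, e4⟩]
          simp [Function.comp, hg', e2, cR]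
      obtain ⟨g, hg, hg'⟩ := this
      have := (((h1.mono hB).snoc h2).trans hg).trans (h5.mono hB)
      convert this using 1
      funext s
      rw [hf, Function.comp, Function.comp, ← hg', h3]
      rfl
theorem key_step [Finite Q] {D : Set (Set X)} (hD : FC D step)
    (hlab : ∀ f, {x | lab x = f} ∈ D) 
    (ihB : ∀ f ψ, ψ ∈ D → FutP (stepB step lab c) lab f ψ ∈ D ∧
      PastP (stepB step lab c) lab f ψ ∈ D)
    (ihC : (∀ f, {x | labC step lab c x = f} ∈ D) → ∀ f ψ, ψ ∈ D →
      FutP (stepC step lab c) (labC step lab c) f ψ ∈ D ∧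
      PastP (stepC step lab c) (labC step lab c) f ψ ∈ D) (f : Q → Q) {ψ : Set X} (hψ : ψ ∈ D) :
    FutP step lab f ψ ∈ D ∧ PastP step lab f ψ ∈ D := by
  have hC := hlab c
  have hseg : ∀ g, {q | segC step lab c g q} ∈ D := by
    intro g
    convert hD.px (ihB g _ hC).2 using 1
    ext q
    constructor
    · rintro ⟨p, p', h1, h2, h3⟩
      exact ⟨p', h3, p, h2, h1⟩
    · rintro ⟨p', h3, p, h2, h1⟩
      exact ⟨p, p', h1, h2, h3⟩
  have hlabC : ∀ f, {x | labC step lab c x = f} ∈ D := by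
    intro f
    have e1 := hD.iUn (S := fun g : Q → Q => {x | (fun z : Set.range c => cR c (g z.1)) = f ∧
      x ∈ {q | segC step lab c g q}}) (fun g => hD.ifp (hseg g))
    have e2 := hD.ifp (p := id = f) (hD.neg (hD.iUn hseg))
    convert hD.or e1 e2 using 1
    ext x
    by_cases hx : ∃ g, segC step lab c g x
    · obtain ⟨g, hg⟩ := hx
      have e : labC step lab c x = f ↔ (fun z : Set.range c => cR c (g z.1)) = f := by
        rw [labC_eq hD.up hg]
      simp only [Set.mem_union, Set.mem_iUnion, Set.mem_compl_iff, Set.mem_ofPred_eq, e]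
      constructor
      · intro h; exact Or.inl ⟨g, h, hg⟩
      · rintro (⟨g', h, hg'⟩ | ⟨_, h⟩)
        · rwa [segC_unique hD.up hg hg']
        · exact absurd ⟨g, hg⟩ h
    · have e : labC step lab c x = f ↔ id = f := by
        unfold labC; rw [dif_neg hx]
      simp only [Set.mem_union, Set.mem_iUnion, Set.mem_compl_iff, Set.mem_ofPred_eq, e]
      constructor
      · intro h; exact Or.inr ⟨h, hx⟩
      · rintro (⟨g', h, hg'⟩ | ⟨h, _⟩)
        · exact absurd ⟨g', hg'⟩ hx
        · exact h
  replace ihC := ihC hlabC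
  constructor
  · convert hD.or (ihB f ψ hψ).1 (hD.iUn
      (S := fun t : (Q → Q) × (Set.range c → Set.range c) × (Q → Q) =>
        {r | (∀ q, f q = t.2.2 (t.2.1 (cR c (t.1 q)))) ∧ r ∈ FutP (stepB step lab c) lab t.1
        (EXs step ({x | lab x = c} ∩ FutP (stepC step lab c) (labC step lab c) t.2.1
          (FutP (stepB step lab c) lab t.2.2 ψ)))}) (fun t => hD.ifp
        (ihB _ _ (hD.ex (hD.and hC (ihC _ _ (ihB _ _ hψ).1).1))).1)) using 1
    ext r
    simp only [Set.mem_union, Set.mem_iUnion, Set.mem_ofPred_eq]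
    constructor
    · rintro ⟨x, h, hx⟩
      rcases (path_decomp hD.up r x f).1 h with h | ⟨t, hf, p', y, z, h1, h2, h3, h4, h5⟩
      · exact Or.inl ⟨x, h, hx⟩
      · exact Or.inr ⟨t, hf, p', h1, y, h2, h3, z, h4, x, h5, hx⟩
    · rintro (⟨x, h, hx⟩ | ⟨t, hf, p', h1, y, h2, h3, z, h4, x, h5, hx⟩)
      · exact ⟨x, (path_decomp hD.up r x f).2 (Or.inl h), hx⟩
      · exact ⟨x, (path_decomp hD.up r x f).2 (Or.inr ⟨t, hf, p', y, z, h1, h2, h3, h4, h5⟩), hx⟩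
  · convert hD.or (ihB f ψ hψ).2 (hD.iUn
      (S := fun t : (Q → Q) × (Set.range c → Set.range c) × (Q → Q) =>
        {r | (∀ q, f q = t.2.2 (t.2.1 (cR c (t.1 q)))) ∧ r ∈ PastP (stepB step lab c) lab t.2.2
        (PastP (stepC step lab c) (labC step lab c) t.2.1
          ({x | lab x = c} ∩ PXs step (PastP (stepB step lab c) lab t.1 ψ)))}) (fun t => hD.ifp
        (ihB _ _ (ihC _ _ (hD.and hC (hD.px (ihB _ _ hψ).2))).2).2)) using 1
    ext x
    simp only [Set.mem_union, Set.mem_iUnion, Set.mem_ofPred_eq]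
    constructor
    · rintro ⟨r, h, hx⟩
      rcases (path_decomp hD.up r x f).1 h with h | ⟨t, hf, p', y, z, h1, h2, h3, h4, h5⟩
      · exact Or.inl ⟨r, h, hx⟩
      · exact Or.inr ⟨t, hf, z, h5, y, h4, h3, p', h2, r, h1, hx⟩
    · rintro (⟨r, h, hx⟩ | ⟨t, hf, z, h5, y, h4, h3, p', h2, r, h1, hx⟩)
      · exact ⟨r, (path_decomp hD.up r x f).2 (Or.inl h), hx⟩
      · exact ⟨r, (path_decomp hD.up r x f).2 (Or.inr ⟨t, hf, p', y, z, h1, h2, h3, h4, h5⟩), hx⟩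
end Ind
theorem key_aux {D : Set (Set X)} (n : ℕ) : ∀ (m : ℕ) {Q : Type u} [Finite Q]
    {step : X → X → Prop} (_ : FC D step) {L : Set (Q → Q)} {lab : X → Q → Q}
    (_ : ∀ f, {x | lab x = f} ∈ D)
    (_ : ∀ p q, step p q → lab q ∈ L) (_ : CFree L) (_ : Nat.card Q = n) (_ : L.ncard = m),
    ∀ (f : Q → Q) (ψ : Set X), ψ ∈ D → FutP step lab f ψ ∈ D ∧ PastP step lab f ψ ∈ D := by
  induction n using Nat.strong_induction_on with
  | _ n ihn =>
  intro m
  induction m using Nat.strong_induction_on with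
  | _ m ihm =>
  intro Q _ step hD L lab hlab hL hcf hn hm f ψ hψ
  by_cases hs : ∀ f ∈ L, Function.Surjective f
  · exact key_base hD hL hcf hs f hψ
  push Not at hs
  obtain ⟨c, hcL, hc⟩ := hs
  refine key_step (c := c) hD hlab ?_ ?_ f hψ
  · refine ihm (L \ {c}).ncard ?_ (fcB hD (hlab c)) (L := L \ {c}) hlab ?_ ?_ hn rfl
    · rw [← hm]
      exact Set.ncard_sdiff_singleton_lt_of_mem hcL (Set.toFinite _)
    · intro p q h
      exact ⟨hL p q h.1, h.2⟩
    · intro f hf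
      exact hcf f (hf.mono Set.sdiff_subset)
  · intro hlabC
    let L' : Set (Set.range c → Set.range c) := {f' | ∃ g, Clo L g ∧ ∀ z, (f' z).1 = g z.1}
    refine ihn (Nat.card (Set.range c)) ?_ _ (fcC hD (hlab c)) (L := L') hlabC ?_ ?_ rfl rfl
    · rw [← hn]
      have h1 : Set.range c ⊂ Set.univ := by
        rw [Set.ssubset_univ_iff]
        intro h
        exact hc (Set.range_eq_univ.1 h)
      have := Set.ncard_lt_ncard h1 (Set.toFinite _)
      rwa [Set.ncard_univ] at this
    · rintro p q ⟨h1, h2, p', h3, h4⟩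
      obtain ⟨g, hg⟩ := exists_path lab h3
      rw [labC_eq hD.up ⟨p, p', h1, hg, h4⟩]
      refine ⟨c ∘ g, .comp hcL (hg.clo fun p q h => hL p q h.1), fun z => rfl⟩
    · have : ∀ f', Clo L' f' → ∃ g, Clo L g ∧ ∀ z, (f' z).1 = g z.1 := by
        intro f' hf'
        induction hf' with
        | one => exact ⟨id, .one, fun _ => rfl⟩
        | comp hl _ ih =>
          obtain ⟨g, hg, e⟩ := ih
          obtain ⟨g', hg', e'⟩ := hl
          exact ⟨g' ∘ g, hg'.mul hg, fun z => by simp [Function.comp, e, e']⟩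
      intro f' hf' n hn q hq
      obtain ⟨g, hg, e⟩ := this f' hf'
      have hit : ∀ n z, ((f'^[n]) z).1 = g^[n] z.1 := by
        intro n
        induction n with
        | zero => intro z; rfl
        | succ n ih => intro z; rw [Function.iterate_succ_apply, Function.iterate_succ_apply, ih, e]
      apply Subtype.ext
      rw [e]
      refine hcf g hg n hn _ ?_
      rw [← hit, hq]
theorem key_lemma {D : Set (Set X)} {Q : Type u} [Finite Q]
    {step : X → X → Prop} (hD : FC D step) (L : Set (Q → Q)) {lab : X → Q → Q}
    (hlab : ∀ f, {x | lab x = f} ∈ D)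
    (hL : ∀ p q, step p q → lab q ∈ L) (hcf : CFree L) (f : Q → Q) {ψ : Set X} (hψ : ψ ∈ D) :
    FutP step lab f ψ ∈ D ∧ PastP step lab f ψ ∈ D :=
  key_aux _ _ hD hlab hL hcf rfl rfl f ψ hψ
end Key
end OPLTheory
end
noncomputable section
namespace OPLTheory
section Parse
open Relation
variable (pr : ℕ → ℕ → Option Prec)
def Cmp : Prop := ∀ i j, Gap pr i j → (pr i j).isSome
def PLt (i j : ℕ) : Prop := Gap pr i j ∧ pr i j = some Prec.lt
def PEq (i j : ℕ) : Prop := Gap pr i j ∧ pr i j = some Prec.eq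
def Pop (i j : ℕ) : Prop := Gap pr i j ∧ pr i j = some Prec.gt
def Par (i j : ℕ) : Prop := Gap pr i j ∧ (pr i j = some Prec.lt ∨ pr i j = some Prec.eq)
def Desc : ℕ → ℕ → Prop := TransGen (Par pr)
def hasEq (i : ℕ) : Prop := ∃ k, PEq pr i k
def isE (j : ℕ) : Prop := ∃ i, PEq pr i j
def Ends (i j : ℕ) : Prop := i < j ∧ (∀ x, i < x → x < j → Desc pr i x) ∧ ¬ Desc pr i j
variable {pr}
mutual
theorem Chain.lt' {i j : ℕ} : Chain pr i j → i < j
  | .mk h _ _ hb => h.trans hb.lt'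
theorem Body.lt' {i j : ℕ} : Body pr i j → i < j
  | .last h _ _ => h
  | .step h _ _ hb => h.trans hb.lt'
end
theorem Gap.lt' {i j : ℕ} : Gap pr i j → i < j
  | .empty h => by omega
  | .chain h => h.lt'
theorem PLt.par {i j : ℕ} (h : PLt pr i j) : Par pr i j := ⟨h.1, Or.inl h.2⟩
theorem PEq.par {i j : ℕ} (h : PEq pr i j) : Par pr i j := ⟨h.1, Or.inr h.2⟩
theorem Par.cases {i j : ℕ} (h : Par pr i j) : PLt pr i j ∨ PEq pr i j :=
  h.2.imp (fun e => ⟨h.1, e⟩) (fun e => ⟨h.1, e⟩)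
theorem Par.lt' {i j : ℕ} (h : Par pr i j) : i < j := h.1.lt'
mutual
theorem Chain.desc {i j : ℕ} : Chain pr i j → ∀ x, i < x → x < j → Desc pr i x
  | .mk (k := k) _ hp hg hb => fun x hx hx' => by
    have hP : Par pr i k := ⟨hg, Or.inl hp⟩
    rcases lt_trichotomy x k with h | h | h
    · exact hg.desc x hx h
    · exact h ▸ .single hP
    · exact .head hP (hb.desc x h hx')
theorem Body.desc {i j : ℕ} : Body pr i j → ∀ x, i < x → x < j → Desc pr i x
  | .last _ _ hg => fun x hx hx' => hg.desc x hx hx'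
  | .step (k' := k) _ hp hg hb => fun x hx hx' => by
    have hP : Par pr i k := ⟨hg, Or.inr hp⟩
    rcases lt_trichotomy x k with h | h | h
    · exact hg.desc x hx h
    · exact h ▸ .single hP
    · exact .head hP (hb.desc x h hx')
theorem Gap.desc {i j : ℕ} : Gap pr i j → ∀ x, i < x → x < j → Desc pr i x
  | .empty h => fun x hx hx' => by omega
  | .chain h => h.desc
end
theorem Desc.lt' {i j : ℕ} (h : Desc pr i j) : i < j := by
  induction h with
  | single h => exact h.lt'
  | tail _ h ih => exact ih.trans h.lt'
theorem Desc.convex {i j x : ℕ} (h : Desc pr i j) (h1 : i < x) (h2 : x < j) : Desc pr i x := by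
  induction h with
  | single h => exact h.1.desc x h1 h2
  | @tail z y hz h ih =>
    rcases lt_trichotomy x z with h' | h' | h'
    · exact ih h'
    · rw [h']; exact hz
    · exact hz.trans (h.1.desc x h' h2)
def EqStar (pr : ℕ → ℕ → Option Prec) : ℕ → ℕ → Prop := ReflTransGen (PEq pr)
theorem EqStar.le {k t : ℕ} (h : EqStar pr k t) : k ≤ t := by
  induction h with
  | refl => exact le_rfl
  | tail _ h ih => exact ih.trans h.par.lt'.le
theorem body_of {k t j : ℕ} (h : EqStar pr k t) (hp : Pop pr t j) : Body pr k j := by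
  induction h using ReflTransGen.head_induction_on with
  | refl => exact .last hp.1.lt' hp.2 hp.1
  | head h _ ih => exact .step h.1.lt' h.2 h.1 ih
theorem of_body {k j : ℕ} : Body pr k j → ∃ t, EqStar pr k t ∧ Pop pr t j
  | .last _ h hg => ⟨k, .refl, hg, h⟩
  | .step _ h hg hb => by
    obtain ⟨t, h1, h2⟩ := of_body hb
    exact ⟨t, .head ⟨hg, h⟩ h1, h2⟩
def Nxt (pr : ℕ → ℕ → Option Prec) (j t i : ℕ) : Prop :=
  t < j ∧ pr t j = some Prec.gt ∧ ∃ k, EqStar pr k t ∧ PLt pr i k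
theorem Nxt.gap {j t i : ℕ} (h : Nxt pr j t i) (ht : Gap pr t j) : Gap pr i j := by
  obtain ⟨_, h2, k, h3, h4⟩ := h
  exact .chain (.mk h4.1.lt' h4.2 h4.1 (body_of h3 ⟨ht, h2⟩))
theorem Nxt.lt' {j t i : ℕ} (h : Nxt pr j t i) : i < t := by
  obtain ⟨_, h2, k, h3, h4⟩ := h
  exact lt_of_lt_of_le h4.1.lt' h3.le
mutual
theorem Chain.nxt {i j : ℕ} : Chain pr i j → ReflTransGen (Nxt pr j) (j - 1) i
  | .mk (k := k) _ hp hg hb => by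
    obtain ⟨t, h1, h2, h3, h4⟩ := hb.nxt
    exact h4.tail ⟨h3.1.lt', h3.2, k, h2, hg, hp⟩
theorem Body.nxt {i j : ℕ} : Body pr i j → ∃ t, i ≤ t ∧ EqStar pr i t ∧ Pop pr t j ∧
    ReflTransGen (Nxt pr j) (j - 1) t
  | .last _ h hg => ⟨i, le_rfl, .refl, ⟨hg, h⟩, hg.nxt⟩
  | .step h hp hg hb => by
    obtain ⟨t, h1, h2, h3, h4⟩ := hb.nxt
    exact ⟨t, h.le.trans h1, .head ⟨hg, hp⟩ h2, h3, h4⟩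
theorem Gap.nxt {i j : ℕ} : Gap pr i j → ReflTransGen (Nxt pr j) (j - 1) i
  | .empty h => by rw [h]; exact .refl
  | .chain h => h.nxt
end
theorem nxt_gap {i j : ℕ} (hj : 0 < j) (h : ReflTransGen (Nxt pr j) (j - 1) i) : Gap pr i j := by
  induction h with
  | refl => exact .empty (by omega)
  | tail _ h ih => exact h.gap ih
theorem nxt_le {a i j : ℕ} (h : ReflTransGen (Nxt pr j) a i) : i ≤ a := by
  induction h with
  | refl => exact le_rfl
  | tail _ h ih => exact h.lt'.le.trans ih
theorem eq_chain_unique {t k k' i i' : ℕ}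
    (ih : ∀ m ≤ t, ∀ i i', Par pr i m → Par pr i' m → i = i')
    (h1 : EqStar pr k t) (h2 : PLt pr i k) (h1' : EqStar pr k' t) (h2' : PLt pr i' k') :
    i = i' := by
  induction h1 with
  | refl =>
    rcases ReflTransGen.cases_tail h1' with e | ⟨z, hz, e⟩
    · subst e; exact ih _ le_rfl _ _ h2.par h2'.par
    · cases ih _ le_rfl _ _ h2.par e.par
      exact absurd (h2.2.symm.trans e.2) (by simp)
  | @tail a b _ hs ihh =>
    rcases ReflTransGen.cases_tail h1' with e | ⟨z, hz, e⟩
    · subst e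
      cases ih _ le_rfl _ _ h2'.par hs.par
      exact absurd (h2'.2.symm.trans hs.2) (by simp)
    · cases ih _ le_rfl _ _ hs.par e.par
      exact ihh (fun m hm => ih m (hm.trans hs.par.lt'.le)) hz
theorem par_term {i j z : ℕ} (h : Par pr i j) : ¬ Nxt pr j i z := by
  intro hn
  rcases h.2 with e | e <;> exact absurd (hn.2.1.symm.trans e) (by simp)
theorem nxt_unique {j : ℕ} (ih : ∀ m < j, ∀ i i', Par pr i m → Par pr i' m → i = i') :
    Relator.RightUnique (Nxt pr j) := by
  rintro t i i' ⟨h1, h2, k, h3, h4⟩ ⟨h1', h2', k', h3', h4'⟩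
  exact eq_chain_unique (fun m hm => ih m (by omega)) h3 h4 h3' h4'
theorem par_unique : ∀ j i i', Par pr i j → Par pr i' j → i = i' := by
  intro j
  induction j using Nat.strong_induction_on with
  | _ j ih =>
  intro i i' h h'
  rcases ReflTransGen.total_of_right_unique (nxt_unique ih) h.1.nxt h'.1.nxt with e | e
  · rcases ReflTransGen.cases_head e with e | ⟨_, e, _⟩
    · exact e
    · exact absurd e (par_term h)
  · rcases ReflTransGen.cases_head e with e | ⟨_, e, _⟩
    · exact e.symm
    · exact absurd e (par_term h')
theorem par_leftmost {p i j : ℕ} (h : Par pr p j) (hg : Gap pr i j) : p ≤ i := by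
  rcases ReflTransGen.total_of_right_unique (nxt_unique fun m _ => par_unique m)
    h.1.nxt hg.nxt with e | e
  · rcases ReflTransGen.cases_head e with e | ⟨_, e, _⟩
    · exact e.le
    · exact absurd e (par_term h)
  · exact nxt_le e
theorem Desc.le_par {a p k : ℕ} (h : Desc pr a k) (hp : Par pr p k) : a = p ∨ Desc pr a p := by
  cases h with
  | single h => exact Or.inl (par_unique _ _ _ h hp)
  | tail h h' => rw [← par_unique _ _ _ h' hp]; exact Or.inr h
theorem Desc.parent {a k : ℕ} (h : Desc pr a k) : ∃ p, Par pr p k ∧ (a = p ∨ Desc pr a p) := by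
  cases h with
  | single h => exact ⟨a, h, Or.inl rfl⟩
  | tail h h' => exact ⟨_, h', Or.inr h⟩
theorem eq_last {i k : ℕ} (hk : PEq pr i k) : ∀ j, Gap pr i j → j ≤ k := by
  intro j
  induction j using Nat.strong_induction_on with
  | _ j ih =>
  intro hg
  by_contra hlt
  push Not at hlt
  have hik := hk.par.lt'
  cases hg with
  | empty h => omega
  | chain h =>
    obtain ⟨h1, h2, h3, h4⟩ := h
    rename_i k'
    have hk' : k' ≤ k := ih k' h4.lt' h3
    rcases hk'.lt_or_eq with h | h
    · have := h4.desc k h hlt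
      rcases this.le_par hk.par with e | e
      · omega
      · have := e.lt'; omega
    · subst h
      exact absurd (h2.symm.trans hk.2) (by simp)
theorem Pop.not_desc {i j : ℕ} (h : Pop pr i j) : ¬ Desc pr i j := by
  intro hd
  obtain ⟨p, hp, e⟩ := hd.parent
  have := par_leftmost hp h.1
  have : i = p := by
    rcases e with e | e
    · exact e
    · have := e.lt'; omega
  subst this
  rcases hp.2 with e | e <;> exact absurd (h.2.symm.trans e) (by simp)
theorem Pop.not_hasEq {i j : ℕ} (h : Pop pr i j) : ¬ hasEq pr i := by
  rintro ⟨k, hk⟩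
  rcases (eq_last hk j h.1).lt_or_eq with e | e
  · exact h.not_desc (hk.1.desc j h.1.lt' e)
  · subst e; exact absurd (h.2.symm.trans hk.2) (by simp)
theorem Pop.ends {i j : ℕ} (h : Pop pr i j) : Ends pr i j :=
  ⟨h.1.lt', h.1.desc, h.not_desc⟩
theorem climb {i : ℕ} (hne : ¬ hasEq pr i) : ∀ z, Desc pr i z →
    ∃ k p, EqStar pr k z ∧ PLt pr p k ∧ (p = i ∨ Desc pr i p) := by
  intro z
  induction z using Nat.strong_induction_on with
  | _ z ih =>
  intro hz
  obtain ⟨p, hp, e⟩ := hz.parent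
  rcases hp.cases with h | h
  · exact ⟨z, p, .refl, h, e.imp Eq.symm id⟩
  · rcases e with e | e
    · subst e; exact absurd ⟨z, h⟩ hne
    · obtain ⟨k, p', h1, h2⟩ := ih p hp.lt' e
      exact ⟨k, p', h1.tail h, h2⟩
theorem gap_cases (hc : Cmp pr) {i j : ℕ} (h : Gap pr i j) : Par pr i j ∨ Pop pr i j := by
  obtain ⟨x, hx⟩ := Option.isSome_iff_exists.1 (hc i j h)
  cases x
  · exact Or.inl ⟨h, Or.inl hx⟩
  · exact Or.inl ⟨h, Or.inr hx⟩
  · exact Or.inr ⟨h, hx⟩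
theorem Ends.pop (hc : Cmp pr) {i j : ℕ} (h : Ends pr i j) (hne : ¬ hasEq pr i) : Pop pr i j := by
  classical
  obtain ⟨h1, h2, h3⟩ := h
  have hex : ∃ t, i ≤ t ∧ Gap pr t j := ⟨j - 1, by omega, .empty (by omega)⟩
  obtain ⟨ht1, ht2⟩ := Nat.find_spec hex
  have hmin := fun m (hm : m < Nat.find hex) => Nat.find_min hex hm
  generalize Nat.find hex = t at *
  rcases gap_cases hc ht2 with hp | hp
  · exfalso
    rcases ht1.eq_or_lt with e | e
    · subst e; exact h3 (.single hp)
    · exact h3 ((h2 t e hp.lt').tail hp)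
  · rcases ht1.eq_or_lt with e | e
    · rwa [e]
    · exfalso
      obtain ⟨k, p, e1, e2, e3⟩ := climb hne t (h2 t e hp.1.lt')
      have hn : Nxt pr j t p := ⟨hp.1.lt', hp.2, k, e1, e2⟩
      refine hmin p hn.lt' ⟨?_, hn.gap ht2⟩
      rcases e3 with e3 | e3
      · omega
      · exact e3.lt'.le
theorem pop_iff (hc : Cmp pr) {i j : ℕ} : Pop pr i j ↔ Ends pr i j ∧ ¬ hasEq pr i :=
  ⟨fun h => ⟨h.ends, h.not_hasEq⟩, fun h => h.1.pop hc h.2⟩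
theorem Ends.unique {i j j' : ℕ} (h : Ends pr i j) (h' : Ends pr i j') : j = j' := by
  rcases lt_trichotomy j j' with e | e | e
  · exact absurd (h'.2.1 j h.1 e) h.2.2
  · exact e
  · exact absurd (h.2.1 j' h'.1 e) h'.2.2
theorem peq_unique {i j j' : ℕ} (h : PEq pr i j) (h' : PEq pr i j') : j = j' :=
  le_antisymm (eq_last h' j h.1) (eq_last h j' h'.1)
theorem chain_iff {i j : ℕ} : (i + 1 < j ∧ Chain pr i j) ↔ i + 1 < j ∧ Gap pr i j := by
  constructor
  · exact fun h => ⟨h.1, .chain h.2⟩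
  · rintro ⟨h, hg⟩
    refine ⟨h, ?_⟩
    cases hg with
    | empty e => omega
    | chain h => exact h
end Parse
end OPLTheory
end
noncomputable section
namespace OPLTheory
structure Fst (Λ : Type) where
  D : ℕ → ℕ → Prop
  lam : ℕ → Λ
  lt : ∀ {i j}, D i j → i < j
  tr : ∀ {i j k}, D i j → D j k → D i k
  cx : ∀ {i j x}, D i j → i < x → x < j → D i x
namespace Fst
variable {Λ : Type} (W : Fst Λ)
open Classical in
def code (i j : ℕ) : Code :=
  if i = j then .eq else if W.D i j then .anc else if W.D j i then .dsc else
    if i < j then .lf else .rt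
def le (i j : ℕ) : Prop := i = j ∨ W.D i j
variable {W}
theorem le.nle {i j : ℕ} (h : W.le i j) : i ≤ j := by
  rcases h with rfl | h
  · exact le_rfl
  · exact (W.lt h).le
theorem le.trans {i j k : ℕ} (h : W.le i j) (h' : W.le j k) : W.le i k := by
  rcases h with rfl | h
  · exact h'
  · rcases h' with rfl | h'
    · exact Or.inr h
    · exact Or.inr (W.tr h h')
theorem code_anc {i j : ℕ} (h : W.D i j) : W.code i j = .anc := by
  have := W.lt h
  have h1 : i ≠ j := by omega
  simp [code, h, h1]
theorem code_lf {i j : ℕ} (h : i < j) (h' : ¬ W.D i j) : W.code i j = .lf := by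
  have h2 : ¬ W.D j i := fun h2 => by have := W.lt h2; omega
  have h1 : i ≠ j := by omega
  simp [code, h, h', h1, h2]
theorem code_rt {i j : ℕ} (h : j < i) (h' : ¬ W.D j i) : W.code i j = .rt := by
  have h2 : ¬ W.D i j := fun h2 => by have := W.lt h2; omega
  have h1 : i ≠ j := by omega
  have h3 : ¬ i < j := by omega
  simp [code, h', h1, h2, h3]
theorem code_conv (i j : ℕ) : W.code j i = (W.code i j).conv := by
  unfold code
  by_cases h : i = j
  · subst h; simp [Code.conv]
  have h' : ¬ j = i := fun e => h e.symm
  by_cases h1 : W.D i j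
  · have h2 : ¬ W.D j i := fun h2 => by have := W.lt h2; have := W.lt h1; omega
    simp [h, h', h1, h2, Code.conv]
  · by_cases h2 : W.D j i
    · simp [h, h', h1, h2, Code.conv]
    · by_cases h3 : i < j
      · have h4 : ¬ j < i := by omega
        simp [h, h', h1, h2, h3, h4, Code.conv]
      · have h4 : j < i := by omega
        simp [h, h', h1, h2, h3, h4, Code.conv]
theorem code_stable {s x y : ℕ} (h : ¬ W.le x s) (h' : W.le x y) : W.code s y = W.code s x := by
  by_cases h1 : W.D s x
  · rw [code_anc h1]
    rcases h' with rfl | h'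
    · exact code_anc h1
    · exact code_anc (W.tr h1 h')
  have hxs : x ≠ s := fun e => h (Or.inl e)
  have hD : ¬ W.D x s := fun e => h (Or.inr e)
  rcases h' with rfl | h'
  · rfl
  have hxy := W.lt h'
  rcases lt_or_gt_of_ne hxs with h2 | h2
  · rw [code_rt h2 hD]
    have : y < s := by
      by_contra hc
      rcases Nat.lt_or_ge s y with h3 | h3
      · exact hD (W.cx h' h2 h3)
      · have : s = y := by omega
        subst this; exact hD h'
    exact code_rt this fun h3 => hD (W.tr h' h3)
  · rw [code_lf h2 h1]
    exact code_lf (by omega) fun h3 => h1 (W.cx h3 h2 hxy)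
def Sub (W : Fst Λ) (S : Set ℕ) (f : ℕ → Code) : Str (Λ × Code) where
  D := S
  rel a b := W.code a b
  lab a := (W.lam a, f a)
def FF (W : Fst Λ) (S : Set ℕ) : Str (Λ × Code) := Sub W S fun _ => .lf
theorem sub_mul (k : ℕ) {S S1 S2 : Set ℕ} {f f1 f2 : ℕ → Code} (hS : S = S1 ∪ S2)
    (h1 : ∀ s ∈ S1, f s = f1 s) (h2 : ∀ s ∈ S2, f s = f2 s)
    (hc : ∀ s ∈ S1, ∀ t ∈ S2, W.code s t = f1 s) :
    ty k (Sub W S f) = ty k (Sub W S1 f1) * ty k (Sub W S2 f2) := by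
  rw [← ty_mul]
  symm
  rw [ty_eq]
  subst hS
  refine EF.of_map (A := (Sub W S1 f1).mul (Sub W S2 f2)) (B := Sub W (S1 ∪ S2) f)
    (fun a => match a with
      | .inl a => ⟨a.1, Or.inl a.2⟩
      | .inr a => ⟨a.1, Or.inr a.2⟩) ?_ ?_ ?_ k [] (by simp)
  · rintro ⟨a, ha | ha⟩
    · exact ⟨.inl ⟨a, ha⟩, rfl⟩
    · exact ⟨.inr ⟨a, ha⟩, rfl⟩
  · rintro (⟨a, ha⟩ | ⟨a, ha⟩)
    · simp [Str.mul, Sub, h1 a ha]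
    · simp [Str.mul, Sub, h2 a ha]
  · rintro (⟨a, ha⟩ | ⟨a, ha⟩) (⟨b, hb⟩ | ⟨b, hb⟩)
    · simp [Str.mul, Sub]
    · simp [Str.mul, Sub, hc a ha b hb]
    · simp only [Str.mul, Sub]
      rw [code_conv b a, hc b hb a ha]
    · simp [Str.mul, Sub]
theorem sub_empty (k : ℕ) {f : ℕ → Code} {S : Set ℕ} (hS : S = ∅) :
    ty k (Sub W S f) = 1 := by
  change _ = ty k Str.one
  rw [ty_eq]
  subst hS
  refine EF.of_map (A := Sub W ∅ f) (B := Str.one) (fun a => absurd a.2 (by simp)) ?_ ?_ ?_ k []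
    (by simp)
  · rintro ⟨⟩
  · rintro ⟨a, ha⟩; simp at ha
  · rintro ⟨a, ha⟩; simp at ha
def partsDec {n : ℕ} (W : Fst Λ) (S : Fin n → Set ℕ) (f : Fin n → ℕ → Code) (T : Set ℕ)
    (ft : ℕ → Code) (c : Fin n → Fin n → Code → Code)
    (g' : Fin n → Code → Code)
    (hT : ∀ s, s ∈ T ↔ ∃ i, s ∈ S i)
    (hg : ∀ i, ∀ s ∈ S i, ft s = g' i (f i s))
    (hc : ∀ i j, i < j → ∀ s ∈ S i, ∀ t ∈ S j, W.code s t = c i j (f i s)) :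
    Dec (Sub W T ft) (fun i => Sub W (S i) (f i)) (fun i γ => (γ.1, g' i γ.2))
      (fun i j γ γ' => if i < j then c i j γ.2 else (c j i γ'.2).conv) where
  emb i b := ⟨b.1, (hT _).2 ⟨i, b.2⟩⟩
  cov a := by
    obtain ⟨i, hi⟩ := (hT _).1 a.2
    exact ⟨i, ⟨a.1, hi⟩, rfl⟩
  lab i b := by simp [Sub, hg i b.1 b.2]
  same i b c := rfl
  cross i j b d hij := by
    by_cases h : i < j
    · simp only [h, if_true]; exact hc i j h _ b.2 _ d.2
    · simp only [h, if_false]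
      have h' : j < i := lt_of_le_of_ne (not_lt.1 h) (Ne.symm hij)
      simp only [Sub]
      rw [code_conv d.1 b.1, hc j i h' _ d.2 _ b.2]
theorem single_ef {W W' : Fst Λ} {x x' : ℕ} (h : W.lam x = W'.lam x') (c : Code) (k : ℕ)
    (l) : EF k (Sub W {x} fun _ => c) (Sub W' {x'} fun _ => c) l := by
  refine EF.of_map (A := Sub W {x} fun _ => c) (B := Sub W' {x'} fun _ => c)
    (fun _ => ⟨x', rfl⟩) ?_ ?_ ?_ k l ?_
  · rintro ⟨a, rfl⟩; exact ⟨⟨x, rfl⟩, rfl⟩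
  · rintro ⟨a, rfl⟩; simp [Sub, h]
  · rintro ⟨a, rfl⟩ ⟨b, rfl⟩; simp [Sub, code]
  · rintro ⟨p, ⟨q, rfl⟩⟩ _; rfl
variable (W)
def sub (z : ℕ) : Set ℕ := {s | W.le z s}
def below (z : ℕ) : Set ℕ := {s | W.D z s}
def ctx (r x : ℕ) : Set ℕ := {s | W.le r s ∧ ¬ W.le x s}
def lft (p : ℕ) : Set ℕ := {s | s < p ∧ ∀ h, W.D h p → h < s}
def rgt (p : ℕ) : Set ℕ := {s | p < s ∧ ¬ W.D p s ∧ ∀ h, W.D h p → W.D h s}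
def mid (z y : ℕ) : Set ℕ := {s | z < s ∧ ¬ W.D z s ∧ (s ≤ y ∨ W.D y s)}
def Cov (p q : ℕ) : Prop := W.D p q ∧ ∀ z, W.D p z → ¬ W.D z q
def En (i j : ℕ) : Prop := i < j ∧ (∀ x, i < x → x < j → W.D i x) ∧ ¬ W.D i j
def Same (i j : ℕ) : Prop := ∀ h, W.D h i ↔ W.D h j
def N (i j : ℕ) : Prop := W.En i j ∧ W.Same i j
def tyC (k r x : ℕ) : TyQ (Λ × Code) k := ty k (Sub W (W.ctx r x) fun s => W.code s x)
structure Five (S A : Set ℕ) (z : ℕ) (B : Set ℕ) : Prop where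
  cov : ∀ s, s ∈ S ↔ s ∈ A ∨ W.le z s ∨ s ∈ B
  az : ∀ s ∈ A, ∀ t, W.le z t → W.code s t = .lf
  ab : ∀ s ∈ A, ∀ t ∈ B, W.code s t = .lf
  zb : ∀ s, W.le z s → ∀ t ∈ B, W.code s t = .lf
def tup (k : ℕ) (A : Set ℕ) (z x : ℕ) (B : Set ℕ) :
    TyQ (Λ × Code) k × TyQ (Λ × Code) k × Λ × TyQ (Λ × Code) k × TyQ (Λ × Code) k :=
  (ty k (W.FF A), W.tyC k z x, W.lam x, ty k (W.FF (W.below x)), ty k (W.FF B))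
variable {W}
theorem Five.mem {S A z B} (h : W.Five S A z B) {x : ℕ} (hx : W.le z x) : x ∈ S :=
  (h.cov x).2 (Or.inr (Or.inl hx))
def fiveP (W : Fst Λ) (A : Set ℕ) (z x : ℕ) (B : Set ℕ) : Fin 5 → Set ℕ :=
  ![A, W.ctx z x, {x}, W.below x, B]
def fiveF (W : Fst Λ) (x : ℕ) : Fin 5 → ℕ → Code :=
  ![fun _ => .lf, fun s => W.code s x, fun _ => .anc, fun _ => .lf, fun _ => .lf]
def fiveC (_i j : Fin 5) (c : Code) : Code := if j = 4 then .lf else c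
def fiveDec {S A z B} (h : W.Five S A z B) {x : ℕ} (hx : W.le z x) :=
  partsDec W (fiveP W A z x B) (fiveF W x) S (fun _ => .lf) fiveC
    (fun _ _ => .lf) (by
      intro s
      rw [h.cov]
      constructor
      · rintro (h1 | h1 | h1)
        · exact ⟨0, h1⟩
        · by_cases h2 : W.le x s
          · rcases h2 with rfl | h2
            · exact ⟨2, rfl⟩
            · exact ⟨3, h2⟩
          · exact ⟨1, h1, h2⟩
        · exact ⟨4, h1⟩
      · rintro ⟨i, hi⟩
        fin_cases i
        · exact Or.inl hi
        · exact Or.inr (Or.inl hi.1)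
        · have : s = x := hi
          subst this; exact Or.inr (Or.inl hx)
        · exact Or.inr (Or.inl (hx.trans (Or.inr hi)))
        · exact Or.inr (Or.inr hi)) (by simp) (by
      have hxx : ∀ t, t = x ∨ W.D x t → W.le x t := fun t ht => ht.imp Eq.symm id
      intro i j hij s hs t ht
      have hzt : ∀ i : Fin 5, i = 1 ∨ i = 2 ∨ i = 3 → ∀ s, s ∈ fiveP W A z x B i → W.le z s := by
        rintro i (rfl | rfl | rfl) s hs
        · exact hs.1
        · have : s = x := hs
          subst this; exact hx
        · exact hx.trans (Or.inr hs)
      have hj : j ≠ 0 := by rintro rfl; simp at hij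
      have hi4 : i ≠ 4 := by rintro rfl; omega
      have hj' : j = 4 ∨ j = 1 ∨ j = 2 ∨ j = 3 := by omega
      have hi' : i = 0 ∨ i = 1 ∨ i = 2 ∨ i = 3 := by omega
      rcases hj' with rfl | hj'
      · simp only [fiveC, if_true]
        rcases hi' with rfl | hi'
        · exact h.ab s hs t ht
        · exact h.zb s (hzt i hi' s hs) t ht
      · have h4 : j ≠ 4 := by rintro rfl; simp at hj'
        simp only [fiveC, h4, if_false]
        rcases hi' with rfl | rfl | rfl | rfl
        · exact h.az s hs t (hzt j hj' t ht)
        · have hxt : W.le x t := by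
            have : j = 2 ∨ j = 3 := by omega
            rcases this with rfl | rfl
            · exact Or.inl (Eq.symm ht)
            · exact Or.inr ht
          exact code_stable hs.2 hxt
        · have : j = 3 := by omega
          subst this
          have : s = x := hs
          subst this
          exact code_anc ht
        · omega)
theorem five_ef {W W' : Fst Λ} {k : ℕ} {S A z B S' A' z' B'} (h : W.Five S A z B)
    (h' : W'.Five S' A' z' B') {x x' : ℕ} (hx : W.le z x) (hx' : W'.le z' x')
    (ht : W.tup k A z x B = W'.tup k A' z' x' B') :
    EF k (W.FF S) (W'.FF S') [(⟨x, h.mem hx⟩, ⟨x', h'.mem hx'⟩)] := by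
  simp only [tup, Prod.mk.injEq, tyC, ty_eq] at ht
  obtain ⟨e1, e2, e3, e4, e5⟩ := ht
  refine (fiveDec h hx).ef (fiveDec h' hx') k (fun i => match i with
    | 0 => []
    | 1 => []
    | 2 => [((⟨x, rfl⟩ : ({x} : Set ℕ)), (⟨x', rfl⟩ : ({x'} : Set ℕ)))]
    | 3 => []
    | 4 => []) _ (fun i => match i with
    | 0 => e1
    | 1 => e2
    | 2 => single_ef e3 _ _ _
    | 3 => e4
    | 4 => e5) ?_
  intro p hp
  obtain rfl := List.mem_singleton.1 hp
  exact ⟨2, _, List.mem_singleton.2 rfl, rfl⟩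
theorem five_set {W W' : Fst Λ} {k : ℕ} {S S' : Set ℕ}
    (h1 : ∀ x ∈ S, ∃ A z B A' z' B', W.Five S A z B ∧ W.le z x ∧ W'.Five S' A' z' B' ∧
      ∃ x', W'.le z' x' ∧ W.tup k A z x B = W'.tup k A' z' x' B')
    (h2 : ∀ x' ∈ S', ∃ A z B A' z' B', W.Five S A z B ∧ W'.le z' x' ∧ W'.Five S' A' z' B' ∧
      ∃ x, W.le z x ∧ W.tup k A z x B = W'.tup k A' z' x' B') :
    ty (k + 1) (W.FF S) = ty (k + 1) (W'.FF S') := by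
  rw [ty_eq]
  refine ⟨by intro p hp; simp at hp, ?_, ?_⟩
  · rintro ⟨x, hx⟩
    obtain ⟨A, z, B, A', z', B', h, hz, h', x', hz', ht⟩ := h1 x hx
    exact ⟨_, five_ef h h' hz hz' ht⟩
  · rintro ⟨x', hx⟩
    obtain ⟨A, z, B, A', z', B', h, hz, h', x, hz', ht⟩ := h2 x' hx
    exact ⟨_, five_ef h h' hz' hz ht⟩
theorem tyC_self (k x : ℕ) : W.tyC k x x = 1 :=
  sub_empty k (by ext s; simp [ctx])
theorem tyC_mul (k : ℕ) {r x y : ℕ} (h : W.le r x) (h' : W.le x y) :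
    W.tyC k r y = W.tyC k r x * W.tyC k x y := by
  refine sub_mul k ?_ (fun s hs => code_stable hs.2 h') (fun _ _ => rfl)
    (fun s hs t ht => code_stable hs.2 ht.1)
  ext s
  simp only [ctx, Set.mem_union, Set.mem_ofPred_eq]
  constructor
  · rintro ⟨h1, h2⟩
    by_cases h3 : W.le x s
    · exact Or.inr ⟨h3, h2⟩
    · exact Or.inl ⟨h1, h3⟩
  · rintro (⟨h1, h2⟩ | ⟨h1, h2⟩)
    · exact ⟨h1, fun h3 => h2 (h'.trans h3)⟩
    · exact ⟨h.trans h1, h2⟩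
theorem lft_code {p s t : ℕ} (hs : s ∈ W.lft p) (ht : p ≤ t) : W.code s t = .lf := by
  have h1 := hs.1
  refine code_lf (by omega) fun h => ?_
  have : W.D s p := by
    rcases Nat.lt_or_ge p t with h2 | h2
    · exact W.cx h h1 h2
    · have : p = t := by omega
      subst this; exact h
  exact absurd (hs.2 s this) (by simp)
theorem lft_rgt {p s t : ℕ} (hs : W.le p s) (ht : t ∈ W.rgt p) : W.code s t = .lf := by
  have hpt := ht.1
  have h1 : s < t := by
    by_contra hc
    rcases hs with rfl | hs
    · exact hc hpt
    · rcases Nat.lt_or_ge t s with h | h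
      · exact ht.2.1 (W.cx hs hpt h)
      · have : s = t := by omega
        subst this; exact ht.2.1 hs
  refine code_lf h1 fun h => ?_
  rcases hs with rfl | hs
  · exact ht.2.1 h
  · exact ht.2.1 (W.tr hs h)
theorem five_lr (p : ℕ) : W.Five (W.lft p ∪ W.sub p ∪ W.rgt p) (W.lft p) p (W.rgt p) where
  cov s := by simp [sub, or_assoc]
  az s hs t ht := lft_code hs ht.nle
  ab s hs t ht := lft_code hs ht.1.le
  zb s hs t ht := lft_rgt hs ht
theorem five_below {p q : ℕ} (h : W.Cov p q) : W.Five (W.below p) (W.lft q) q (W.rgt q) := by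
  have hpq := W.lt h.1
  have hle : ∀ h', W.D h' q → h' = p ∨ W.D h' p := by
    intro h' hh
    by_contra hc
    push Not at hc
    rcases lt_or_gt_of_ne hc.1 with h1 | h1
    · exact hc.2 (W.cx hh h1 hpq)
    · exact h.2 h' (W.cx h.1 h1 (W.lt hh)) hh
  have : W.below p = W.lft q ∪ W.sub q ∪ W.rgt q := by
    ext s
    simp only [below, lft, sub, rgt, Set.mem_union, Set.mem_ofPred_eq]
    constructor
    · intro hs
      rcases Nat.lt_or_ge s q with h1 | h1
      · refine Or.inl (Or.inl ⟨h1, fun h' hh => ?_⟩)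
        rcases hle h' hh with rfl | hh
        · exact W.lt hs
        · exact (W.lt hh).trans (W.lt hs)
      · by_cases h2 : W.le q s
        · exact Or.inl (Or.inr h2)
        · refine Or.inr ⟨lt_of_le_of_ne h1 fun e => h2 (Or.inl e), fun e => h2 (Or.inr e),
            fun h' hh => ?_⟩
          rcases hle h' hh with rfl | hh
          · exact hs
          · exact W.tr hh hs
    · rintro ((⟨h1, h2⟩ | h1) | ⟨h1, h2, h3⟩)
      · exact W.cx h.1 (h2 p h.1) h1
      · rcases h1 with rfl | h1
        · exact h.1
        · exact W.tr h.1 h1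
      · exact h3 p h.1
  rw [this]
  exact five_lr q
theorem five_univ {p : ℕ} (h : ∀ z, ¬ W.D z p) : W.Five Set.univ (W.lft p) p (W.rgt p) := by
  have : Set.univ = W.lft p ∪ W.sub p ∪ W.rgt p := by
    ext s
    simp only [lft, sub, rgt, Set.mem_union, Set.mem_ofPred_eq, Set.mem_univ, true_iff]
    rcases Nat.lt_or_ge s p with h1 | h1
    · exact Or.inl (Or.inl ⟨h1, fun h' hh => absurd hh (h h')⟩)
    · by_cases h2 : W.le p s
      · exact Or.inl (Or.inr h2)
      · exact Or.inr ⟨lt_of_le_of_ne h1 fun e => h2 (Or.inl e), fun e => h2 (Or.inr e),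
          fun h' hh => absurd hh (h h')⟩
  rw [this]
  exact five_lr p
theorem Same.nD {i j : ℕ} (h : W.Same i j) : ¬ W.D i j := fun e =>
  absurd (W.lt ((h i).2 e)) (by simp)
theorem Same.symm {i j : ℕ} (h : W.Same i j) : W.Same j i := fun x => (h x).symm
theorem Same.trans {i j k : ℕ} (h : W.Same i j) (h' : W.Same j k) : W.Same i k :=
  fun x => (h x).trans (h' x)
theorem five_lft {z y p : ℕ} (hzy : z ≤ y) (hs : W.Same z y) (hN : W.N y p) :
    W.Five (W.lft p) (W.lft z) z (W.mid z y) := by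
  have hyp := hN.1.1
  have hzp : z < p := by omega
  have hs' := hs.trans hN.2
  have hmid : ∀ t ∈ W.mid z y, t < p ∧ z < t := by
    rintro t ⟨h1, h2, h3⟩
    refine ⟨?_, h1⟩
    rcases h3 with h3 | h3
    · omega
    · by_contra hc
      rcases Nat.lt_or_ge p t with h4 | h4
      · exact hN.2.nD (W.cx h3 hyp h4)
      · have : t = p := by omega
        subst this; exact hN.2.nD h3
  have hzr : W.mid z y ⊆ W.rgt z := by
    rintro t ⟨h1, h2, h3⟩
    refine ⟨h1, h2, fun h hh => ?_⟩
    have hy := (hs h).1 hh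
    rcases h3 with h3 | h3
    · rcases Nat.lt_or_ge t y with h4 | h4
      · exact W.cx hy (by have := W.lt hh; omega) h4
      · have : t = y := by omega
        subst this; exact hy
    · exact W.tr hy h3
  refine ⟨fun s => ?_, fun s hs t ht => lft_code hs ht.nle, fun s hs t ht => lft_code hs ht.1.le,
    fun s hs t ht => lft_rgt hs (hzr ht)⟩
  constructor
  · rintro ⟨h1, h2⟩
    rcases Nat.lt_or_ge s z with h3 | h3
    · exact Or.inl ⟨h3, fun h hh => h2 h ((hs' h).1 hh)⟩
    · by_cases h4 : W.le z s
      · exact Or.inr (Or.inl h4)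
      · refine Or.inr (Or.inr ⟨lt_of_le_of_ne h3 fun e => h4 (Or.inl e), fun e => h4 (Or.inr e), ?_⟩)
        rcases Nat.lt_or_ge y s with h5 | h5
        · exact Or.inr (hN.1.2.1 s h5 h1)
        · exact Or.inl h5
  · rintro (⟨h1, h2⟩ | h1 | h1)
    · exact ⟨by omega, fun h hh => h2 h ((hs' h).2 hh)⟩
    · have h6 : s < p := by
        rcases h1 with rfl | h1
        · exact hzp
        · by_contra hc
          rcases Nat.lt_or_ge p s with h4 | h4
          · exact hs'.nD (W.cx h1 hzp h4)
          · have : s = p := by omega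
            subst this; exact hs'.nD h1
      exact ⟨h6, fun h hh => lt_of_lt_of_le (W.lt ((hs' h).2 hh)) h1.nle⟩
    · exact ⟨(hmid s h1).1, fun h hh => (W.lt ((hs' h).2 hh)).trans (hmid s h1).2⟩
theorem five_rgt {p y z : ℕ} (hpy : p ≤ y) (hs : W.Same p y) (hN : W.N y z) :
    W.Five (W.rgt p) (W.mid p y) z (W.rgt z) := by
  have hyz := hN.1.1
  have hpz : p < z := by omega
  have hs' := hs.trans hN.2
  have hmid : W.mid p y ⊆ W.lft z := by
    rintro t ⟨h1, h2, h3⟩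
    refine ⟨?_, fun h hh => (W.lt ((hs' h).2 hh)).trans h1⟩
    rcases h3 with h3 | h3
    · omega
    · by_contra hc
      rcases Nat.lt_or_ge z t with h4 | h4
      · exact hN.2.nD (W.cx h3 hyz h4)
      · have : t = z := by omega
        subst this; exact hN.2.nD h3
  refine ⟨fun s => ?_, fun s hs t ht => lft_code (hmid hs) ht.nle,
    fun s hs t ht => lft_code (hmid hs) ht.1.le, fun s hs t ht => lft_rgt hs ht⟩
  constructor
  · rintro ⟨h1, h2, h3⟩
    rcases Nat.lt_or_ge s z with h4 | h4
    · refine Or.inl ⟨h1, h2, ?_⟩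
      rcases Nat.lt_or_ge y s with h5 | h5
      · exact Or.inr (hN.1.2.1 s h5 h4)
      · exact Or.inl h5
    · by_cases h5 : W.le z s
      · exact Or.inr (Or.inl h5)
      · exact Or.inr (Or.inr ⟨lt_of_le_of_ne h4 fun e => h5 (Or.inl e), fun e => h5 (Or.inr e),
          fun h hh => h3 h ((hs' h).2 hh)⟩)
  · rintro (h1 | h1 | h1)
    · have h2 := hmid h1
      refine ⟨h1.1, h1.2.1, fun h hh => W.cx ((hs' h).1 hh) ((W.lt hh).trans h1.1) h2.1⟩
    · refine ⟨lt_of_lt_of_le hpz h1.nle, fun e => ?_, fun h hh => ?_⟩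
      · rcases h1 with rfl | h1
        · exact hs'.nD e
        · exact hs'.nD (W.cx e hpz (W.lt h1))
      · rcases h1 with rfl | h1
        · exact (hs' h).1 hh
        · exact W.tr ((hs' h).1 hh) h1
    · refine ⟨hpz.trans h1.1, fun e => hs'.nD (W.cx e hpz h1.1),
        fun h hh => h1.2.2 h ((hs' h).1 hh)⟩
theorem mid_self (k z : ℕ) : ty k (W.FF (W.mid z z)) = 1 :=
  sub_empty k (by
    ext s
    simp only [mid, Set.mem_ofPred_eq, Set.mem_empty_iff_false, iff_false]
    rintro ⟨h1, h2, h3 | h3⟩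
    · omega
    · exact h2 h3)
theorem mid_mul (k : ℕ) {z y p : ℕ} (hzy : z ≤ y) (hs : W.Same z y) (hN : W.N y p) :
    ty k (W.FF (W.mid z p)) = ty k (W.FF (W.mid z y)) * ty k (W.FF (W.sub p)) := by
  have hyp := hN.1.1
  have h5 := five_rgt hzy hs hN
  refine sub_mul k ?_ (fun _ _ => rfl) (fun _ _ => rfl) (fun s hs t ht => h5.az s hs t ht)
  ext s
  constructor
  · rintro ⟨h1, h2, h3⟩
    by_cases h4 : W.le p s
    · exact Or.inr h4
    · have h6 : s < p := by
        rcases h3 with h3 | h3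
        · exact lt_of_le_of_ne h3 fun e => h4 (Or.inl e.symm)
        · exact absurd (Or.inr h3) h4
      refine Or.inl ⟨h1, h2, ?_⟩
      rcases Nat.lt_or_ge y s with h5 | h5
      · exact Or.inr (hN.1.2.1 s h5 h6)
      · exact Or.inl h5
  · rintro (⟨h1, h2, h3⟩ | h1)
    · refine ⟨h1, h2, Or.inl ?_⟩
      rcases h3 with h3 | h3
      · omega
      · by_contra hc
        exact hN.2.nD (W.cx h3 hyp (by omega))
    · have h2 : s ∈ W.rgt z := h5.mem h1
      exact ⟨h2.1, h2.2.1, by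
        rcases h1 with rfl | h1
        · exact Or.inl le_rfl
        · exact Or.inr h1⟩
theorem sub_det {W W' : Fst Λ} {k z z' : ℕ} (hl : W.lam z = W'.lam z')
    (hb : ty k (W.FF (W.below z)) = ty k (W'.FF (W'.below z'))) :
    ty k (W.FF (W.sub z)) = ty k (W'.FF (W'.sub z')) := by
  have key : ∀ (W : Fst Λ) (z : ℕ), (∀ s, s ∈ W.sub z ↔
      ∃ i, s ∈ (![{z}, W.below z] : Fin 2 → Set ℕ) i) := by
    intro W z s
    constructor
    · rintro (rfl | h)
      · exact ⟨0, rfl⟩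
      · exact ⟨1, h⟩
    · rintro ⟨i, hi⟩
      fin_cases i
      · exact Or.inl (Eq.symm hi)
      · exact Or.inr hi
  have key2 : ∀ (W : Fst Λ) (z : ℕ), ∀ i j : Fin 2, i < j →
      ∀ s ∈ (![{z}, W.below z] : Fin 2 → Set ℕ) i, ∀ t ∈ (![{z}, W.below z] : Fin 2 → Set ℕ) j,
      W.code s t = .anc := by
    intro W z i j hij s hs t ht
    have h1 : i = 0 := by omega
    have h2 : j = 1 := by omega
    subst h1 h2
    have : s = z := hs
    subst this
    exact code_anc ht
  rw [ty_eq] at hb ⊢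
  refine (partsDec W (![{z}, W.below z] : Fin 2 → Set ℕ) (fun _ _ => .lf) _ (fun _ => .lf)
    (fun _ _ _ => .anc) (fun _ _ => .lf) (key W z) (by simp) (key2 W z)).ef
    (partsDec W' (![{z'}, W'.below z'] : Fin 2 → Set ℕ) (fun _ _ => .lf) _ (fun _ => .lf)
    (fun _ _ _ => .anc) (fun _ _ => .lf) (key W' z') (by simp) (key2 W' z'))
    k (fun _ => []) [] (fun i => match i with
      | 0 => single_ef hl _ _ _
      | 1 => hb) (by simp)
theorem ctx_det {W W' : Fst Λ} {k p q p' q' : ℕ} (hc : W.Cov p q) (hc' : W'.Cov p' q')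
    (hl : W.lam p = W'.lam p')
    (hL : ty k (W.FF (W.lft q)) = ty k (W'.FF (W'.lft q')))
    (hR : ty k (W.FF (W.rgt q)) = ty k (W'.FF (W'.rgt q'))) :
    W.tyC k p q = W'.tyC k p' q' := by
  have key : ∀ (W : Fst Λ) (p q : ℕ), W.Cov p q → ∀ s, s ∈ W.ctx p q ↔
      ∃ i, s ∈ (![{p}, W.lft q, W.rgt q] : Fin 3 → Set ℕ) i := by
    intro W p q hc s
    have h5 := five_below hc
    have hq : ∀ s, W.D p s → W.le q s → ¬ (s ∈ W.lft q ∨ s ∈ W.rgt q) := by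
      rintro s h1 h2 (h3 | h3)
      · have := h2.nle; have := h3.1; omega
      · rcases h2 with rfl | h2
        · exact absurd h3.1 (by simp)
        · exact h3.2.1 h2
    constructor
    · rintro ⟨rfl | h, h2⟩
      · exact ⟨0, rfl⟩
      · rcases (h5.cov s).1 h with h3 | h3 | h3
        · exact ⟨1, h3⟩
        · exact absurd h3 h2
        · exact ⟨2, h3⟩
    · rintro ⟨i, hi⟩
      fin_cases i
      · have : s = p := hi
        subst this
        exact ⟨Or.inl rfl, fun h => by have := h.nle; have := W.lt hc.1; omega⟩
      · have h6 : W.D p s := (h5.cov s).2 (Or.inl hi)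
        exact ⟨Or.inr h6, fun h => hq s h6 h (Or.inl hi)⟩
      · have h6 : W.D p s := (h5.cov s).2 (Or.inr (Or.inr hi))
        exact ⟨Or.inr h6, fun h => hq s h6 h (Or.inr hi)⟩
  have key2 : ∀ (W : Fst Λ) (p q : ℕ), W.Cov p q → ∀ i j : Fin 3, i < j →
      ∀ s ∈ (![{p}, W.lft q, W.rgt q] : Fin 3 → Set ℕ) i,
      ∀ t ∈ (![{p}, W.lft q, W.rgt q] : Fin 3 → Set ℕ) j,
      W.code s t = if i = 0 then .anc else .lf := by
    intro W p q hc i j hij s hs t ht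
    have h5 := five_below hc
    have hi : i = 0 ∨ i = 1 := by omega
    rcases hi with rfl | rfl
    · have : s = p := hs
      subst this
      refine code_anc ?_
      have hj : j = 1 ∨ j = 2 := by omega
      rcases hj with rfl | rfl
      · exact (h5.cov t).2 (Or.inl ht)
      · exact (h5.cov t).2 (Or.inr (Or.inr ht))
    · have : j = 2 := by omega
      subst this
      exact h5.ab s hs t ht
  have key3 : ∀ (W : Fst Λ) (p q : ℕ), W.Cov p q → ∀ i : Fin 3,
      ∀ s ∈ (![{p}, W.lft q, W.rgt q] : Fin 3 → Set ℕ) i,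
      W.code s q = if i = 0 then .anc else if i = 1 then .lf else .rt := by
    intro W p q hc i s hs
    fin_cases i
    · have : s = p := hs
      subst this
      simp [code_anc hc.1]
    · simp [lft_code hs le_rfl]
    · simp [code_rt hs.1 hs.2.1]
  unfold tyC
  rw [ty_eq] at hL hR ⊢
  refine (partsDec W (![{p}, W.lft q, W.rgt q] : Fin 3 → Set ℕ) (fun _ _ => .lf) _
    (fun s => W.code s q) (fun i _ _ => if i = 0 then .anc else .lf)
    (fun i _ => if i = 0 then .anc else if i = 1 then .lf else .rt)
    (key W p q hc) (key3 W p q hc) (key2 W p q hc)).ef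
    (partsDec W' (![{p'}, W'.lft q', W'.rgt q'] : Fin 3 → Set ℕ) (fun _ _ => .lf) _
    (fun s => W'.code s q') (fun i _ _ => if i = 0 then .anc else .lf)
    (fun i _ => if i = 0 then .anc else if i = 1 then .lf else .rt)
    (key W' p' q' hc') (key3 W' p' q' hc') (key2 W' p' q' hc'))
    k (fun _ => []) [] (fun i => match i with
      | 0 => single_ef hl _ _ _
      | 1 => hL
      | 2 => hR) (by simp)
end Fst
end OPLTheory
end
noncomputable section
namespace OPLTheory
set_option linter.unusedSectionVars false
section DMs
universe uu vv ww
variable {X : Type uu}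
def DM (D : Set (Set X)) {β : Type vv} (g : X → β) : Prop := ∀ b, {x | g x = b} ∈ D
theorem DM.pair {D : Set (Set X)} (hD : BCl D) {β : Type vv} {γ : Type ww} {g : X → β} {h : X → γ}
    (hg : DM D g) (hh : DM D h) : DM D fun x => (g x, h x) := by
  rintro ⟨b, c⟩
  have := hD.and (hg b) (hh c)
  convert this using 1
  ext x; simp
theorem DM.det {D : Set (Set X)} (hD : BCl D) {β : Type vv} {γ : Type ww} [Finite β] {g : X → β}
    {f : X → γ} (hg : DM D g) (h : ∀ x y, g x = g y → f x = f y) : DM D f := by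
  intro b
  have := hD.iUn (S := fun a => {x | (∃ y, g y = a ∧ f y = b) ∧ x ∈ {x | g x = a}})
    (fun a => hD.ifp (hg a))
  convert this using 1
  ext x
  simp only [Set.mem_ofPred_eq, Set.mem_iUnion]
  constructor
  · intro hx; exact ⟨g x, ⟨x, rfl, hx⟩, rfl⟩
  · rintro ⟨a, ⟨y, hy, hb⟩, hx⟩
    rw [← hb]; exact h _ _ (hx.trans hy.symm)
theorem DM.sets {D : Set (Set X)} (hD : BCl D) {β : Type vv} [Finite β] {P : β → X → Prop}
    (h : ∀ b, {x | P b x} ∈ D) : DM D fun x => {b | P b x} := by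
  intro B
  have h1 : ∀ b, {x | ¬ (P b x ↔ b ∈ B)} ∈ D := by
    intro b
    by_cases hb : b ∈ B
    · have := hD.neg (h b)
      simp only [hb, iff_true]; exact this
    · simpa [hb] using h b
  have := hD.neg (hD.iUn h1)
  convert this using 1
  ext x
  simp only [Set.mem_ofPred_eq, Set.mem_compl_iff, Set.mem_iUnion, not_exists, not_not]
  constructor
  · intro hx b; rw [← hx]; rfl
  · intro hx; ext b; exact hx b
end DMs
namespace Fst
variable {Λ : Type} {W : Fst Λ}
theorem min_exists (P : ℕ → Prop) {n : ℕ} (h : P n) : ∃ m, P m ∧ ∀ z, z < m → ¬ P z := by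
  classical
  exact ⟨Nat.find ⟨n, h⟩, Nat.find_spec ⟨n, h⟩, fun z hz => Nat.find_min ⟨n, h⟩ hz⟩
theorem ex_child {p x : ℕ} (h : W.D p x) : ∃ q, W.Cov p q ∧ W.le q x := by
  obtain ⟨q, ⟨h1, h2⟩, h3⟩ := min_exists (fun q => W.D p q ∧ W.le q x) ⟨h, Or.inl rfl⟩
  refine ⟨q, ⟨h1, fun z hz hzq => ?_⟩, h2⟩
  exact h3 z (W.lt hzq) ⟨hz, le.trans (Or.inr hzq) h2⟩
theorem ex_root (x : ℕ) : ∃ r, (∀ z, ¬ W.D z r) ∧ W.le r x := by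
  obtain ⟨q, h2, h3⟩ := min_exists (fun q => W.le q x) (Or.inl rfl : W.le x x)
  exact ⟨q, fun z hz => h3 z (W.lt hz) (le.trans (Or.inr hz) h2), h2⟩
theorem ex_prev {p x : ℕ} (h : x ∈ W.lft p) : ∃ y, W.N y p ∧ x ≤ p - 1 ∧ W.le y (p - 1) := by
  have hxp := h.1
  have h0 : p - 1 ∈ W.lft p := ⟨by omega, fun h' hh => by have := h.2 h' hh; omega⟩
  obtain ⟨y, ⟨h1, h2⟩, h3⟩ := min_exists (fun y => y ∈ W.lft p ∧ W.le y (p - 1)) ⟨h0, Or.inl rfl⟩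
  have hyp := h1.1
  have hn : ¬ W.D y p := fun h => absurd (h1.2 y h) (by simp)
  refine ⟨y, ⟨⟨hyp, fun x hx hx' => ?_, hn⟩, fun h' => ⟨fun hh => ?_, fun hh => ?_⟩⟩, by omega, h2⟩
  · rcases h2 with rfl | h2
    · omega
    · rcases Nat.lt_or_ge x (p - 1) with h4 | h4
      · exact W.cx h2 hx h4
      · have : x = p - 1 := by omega
        subst this; exact h2
  · by_contra hc
    refine h3 h' (W.lt hh) ⟨⟨(W.lt hh).trans hyp, fun a ha => ?_⟩, le.trans (Or.inr hh) h2⟩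
    have hay := h1.2 a ha
    by_contra hle
    rcases Nat.lt_or_ge h' a with h5 | h5
    · exact hc (W.tr (W.cx hh h5 hay) ha)
    · have : a = h' := by omega
      subst this; exact hc ha
  · exact W.cx hh (h1.2 h' hh) hyp
theorem ex_next {p x : ℕ} (h : x ∈ W.rgt p) : ∃ e, W.N p e ∧ e ≤ x := by
  obtain ⟨e, ⟨h1, h2⟩, h3⟩ := min_exists (fun e => p < e ∧ ¬ W.D p e) ⟨h.1, h.2.1⟩
  have hex : e ≤ x := by
    by_contra hc
    exact h3 x (by omega) ⟨h.1, h.2.1⟩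
  refine ⟨e, ⟨⟨h1, fun y hy hy' => ?_, h2⟩, fun h' => ⟨fun hh => ?_, fun hh => ?_⟩⟩, hex⟩
  · by_contra hc
    exact h3 y hy' ⟨hy, hc⟩
  · have := h.2.2 h' hh
    rcases Nat.lt_or_ge e x with h4 | h4
    · exact W.cx this ((W.lt hh).trans h1) h4
    · have : e = x := by omega
      subst this; assumption
  · rcases Nat.lt_trichotomy h' p with h4 | h4 | h4
    · exact W.cx hh h4 h1
    · subst h4; exact absurd hh h2
    · have : W.D p h' := by
        by_contra hc
        exact h3 h' (W.lt hh) ⟨h4, hc⟩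
      exact absurd (W.tr this hh) h2
def Sib (W : Fst Λ) : ℕ → ℕ → Prop := Relation.ReflTransGen W.N
theorem Sib.le {z y : ℕ} (h : W.Sib z y) : z ≤ y := by
  induction h with
  | refl => exact le_rfl
  | tail _ h ih => have := h.1.1; omega
theorem Sib.same {z y : ℕ} (h : W.Sib z y) : W.Same z y := by
  induction h with
  | refl => exact fun _ => Iff.rfl
  | tail _ h ih => exact ih.trans h.2
theorem ex_left : ∀ {p x : ℕ}, x ∈ W.lft p → ∃ z y, W.Sib z y ∧ W.N y p ∧ W.le z x := by
  intro p
  induction p using Nat.strong_induction_on with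
  | _ p ih =>
  intro x h
  obtain ⟨y, h1, h2, h3⟩ := ex_prev h
  rcases Nat.lt_or_ge x y with h4 | h4
  · obtain ⟨z, y', a, b, c⟩ := ih y h1.1.1 (x := x) ⟨h4, fun h' hh => h.2 h' ((h1.2 h').1 hh)⟩
    exact ⟨z, y, a.tail b, h1, c⟩
  · refine ⟨y, y, .refl, h1, ?_⟩
    rcases Nat.lt_or_ge y x with h5 | h5
    · exact Or.inr (h1.1.2.1 x h5 h.1)
    · exact Or.inl (by omega)
theorem ex_right {p x : ℕ} : x ∈ W.rgt p → ∃ y z, W.Sib p y ∧ W.N y z ∧ W.le z x := by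
  induction hn : x - p using Nat.strong_induction_on generalizing p with
  | _ n ih =>
  intro h
  obtain ⟨e, h1, h2⟩ := ex_next h
  by_cases h3 : W.le e x
  · exact ⟨p, e, .refl, h1, h3⟩
  · have hpe := h1.1.1
    obtain ⟨y, z, a, b, c⟩ := ih (x - e) (by omega) (p := e) rfl
      ⟨lt_of_le_of_ne h2 fun e => h3 (Or.inl e), fun e => h3 (Or.inr e),
        fun h' hh => h.2.2 h' ((h1.2 h').2 hh)⟩
    exact ⟨y, z, Relation.ReflTransGen.head h1 a, b, c⟩
theorem le.rtg {p x : ℕ} (h : W.le p x) : Relation.ReflTransGen W.Cov p x := by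
  induction hn : x - p using Nat.strong_induction_on generalizing p with
  | _ n ih =>
  rcases h with rfl | h
  · exact .refl
  · obtain ⟨q, h1, h2⟩ := ex_child h
    have := W.lt h1.1
    have := W.lt h
    exact Relation.ReflTransGen.head h1 (ih (x - q) (by omega) h2 rfl)
theorem le_of_rtg {p x : ℕ} (h : Relation.ReflTransGen W.Cov p x) : W.le p x := by
  induction h with
  | refl => exact Or.inl rfl
  | tail _ h ih => exact ih.trans (Or.inr h.1)
theorem cov_unique {p p' q : ℕ} (h : W.Cov p q) (h' : W.Cov p' q) : p = p' := by
  rcases Nat.lt_trichotomy p p' with h1 | h1 | h1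
  · exact absurd h'.1 (h.2 p' (W.cx h.1 h1 (W.lt h'.1)))
  · exact h1
  · exact absurd h.1 (h'.2 p (W.cx h'.1 h1 (W.lt h.1)))
end Fst
section Ind
variable {Ω Λ : Type} [Finite Λ] (F : Ω → Fst Λ)
def cstep (x y : Ω × ℕ) : Prop := x.1 = y.1 ∧ (F x.1).Cov x.2 y.2
def sstep (x y : Ω × ℕ) : Prop := x.1 = y.1 ∧ (F x.1).N x.2 y.2
def tB (k : ℕ) (x : Ω × ℕ) := ty k ((F x.1).FF ((F x.1).below x.2))
def tL (k : ℕ) (x : Ω × ℕ) := ty k ((F x.1).FF ((F x.1).lft x.2))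
def tR (k : ℕ) (x : Ω × ℕ) := ty k ((F x.1).FF ((F x.1).rgt x.2))
def tS (k : ℕ) (x : Ω × ℕ) := ty k ((F x.1).FF ((F x.1).sub x.2))
def lm (x : Ω × ℕ) := (F x.1).lam x.2
open Classical in
def tP (k : ℕ) (x : Ω × ℕ) : TyQ (Λ × Code) k :=
  if h : ∃ p, (F x.1).Cov p x.2 then (F x.1).tyC k h.choose x.2 else 1
theorem tP_eq (k : ℕ) {x : Ω × ℕ} {p : ℕ} (h : (F x.1).Cov p x.2) :
    tP F k x = (F x.1).tyC k p x.2 := by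
  have hex : ∃ p, (F x.1).Cov p x.2 := ⟨p, h⟩
  unfold tP
  rw [dif_pos hex, Fst.cov_unique hex.choose_spec h]
variable {F}
theorem path_c (k : ℕ) {x y : Ω × ℕ} {f}
    (h : PathF (cstep F) (fun q t => t * tP F k q) x y f) :
    x.1 = y.1 ∧ (F x.1).le x.2 y.2 ∧ f = fun t => t * (F x.1).tyC k x.2 y.2 := by
  induction h with
  | refl => exact ⟨rfl, Or.inl rfl, by ext t; simp [Fst.tyC_self]⟩
  | @snoc p q f h hs ih =>
    obtain ⟨w, r⟩ := x
    obtain ⟨w1, p⟩ := p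
    obtain ⟨w2, q⟩ := q
    obtain ⟨h1, h2, h3⟩ := ih
    obtain ⟨h4, h5⟩ := hs
    simp only at h1 h2 h3 h4 h5
    subst h1 h4
    refine ⟨rfl, h2.trans (Or.inr h5.1), ?_⟩
    ext t
    have : (F w).tyC k r q = _ := Fst.tyC_mul k h2 (Or.inr h5.1)
    simp only [Function.comp, h3, this, tP_eq F k (x := (w, q)) h5, mul_assoc]
theorem path_s (k : ℕ) {x y : Ω × ℕ} {f}
    (h : PathF (sstep F) (fun q t => t * tS F k q) x y f) :
    x.1 = y.1 ∧ (F x.1).Sib x.2 y.2 ∧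
      f = fun t => t * ty k ((F x.1).FF ((F x.1).mid x.2 y.2)) := by
  induction h with
  | refl => exact ⟨rfl, .refl, by ext t; simp [Fst.mid_self]⟩
  | @snoc p q f h hs ih =>
    obtain ⟨w, r⟩ := x
    obtain ⟨w1, p⟩ := p
    obtain ⟨w2, q⟩ := q
    obtain ⟨h1, h2, h3⟩ := ih
    obtain ⟨h4, h5⟩ := hs
    simp only at h1 h2 h3 h4 h5
    subst h1 h4
    refine ⟨rfl, h2.tail h5, ?_⟩
    ext t
    have := Fst.mid_mul k h2.le h2.same h5
    simp only [Function.comp, h3, this, tS, mul_assoc]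
theorem rmul_inj {k : ℕ} {a b : TyQ (Λ × Code) k} :
    ((fun t : TyQ (Λ × Code) k => t * a) = fun t => t * b) ↔ a = b := by
  constructor
  · intro h
    have := congrFun h 1
    simpa using this
  · rintro rfl; rfl
theorem cfree_rmul (k : ℕ) :
    CFree {f : TyQ (Λ × Code) k → TyQ (Λ × Code) k | ∃ a, f = fun t => t * a} := by
  have h : ∀ f, Clo {f : TyQ (Λ × Code) k → TyQ (Λ × Code) k | ∃ a, f = fun t => t * a} f →
      ∃ a, f = fun t => t * a := by
    intro f hf
    induction hf with
    | one => exact ⟨1, by ext t; simp⟩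
    | comp hg hf ih =>
      obtain ⟨a, rfl⟩ := ih
      obtain ⟨b, rfl⟩ := hg
      exact ⟨a * b, by ext t; simp [mul_assoc]⟩
  intro f hf n hn q hq
  obtain ⟨a, rfl⟩ := h f hf
  have : ∀ n q, (fun t : TyQ (Λ × Code) k => t * a)^[n] q = q * a ^ n := by
    intro n
    induction n with
    | zero => simp
    | succ n ih => intro q; rw [Function.iterate_succ_apply, ih, pow_succ', mul_assoc]
  rw [this] at hq
  exact ty_aper q a hn hq
variable {D : Set (Set (Ω × ℕ))}
theorem rmul_dm (hb : BCl D) {k : ℕ} {g : Ω × ℕ → TyQ (Λ × Code) k} (hg : DM D g) :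
    ∀ f, {x | (fun (q : Ω × ℕ) (t : TyQ (Λ × Code) k) => t * g q) x = f} ∈ D := by
  have : DM D fun (q : Ω × ℕ) (t : TyQ (Λ × Code) k) => t * g q :=
    DM.det hb hg (by intro x y h; ext t; simp only [h])
  exact this
theorem rtg_lift {α β : Type*} {r : α → α → Prop} {r' : β → β → Prop} (f : α → β)
    (h : ∀ a b, r a b → r' (f a) (f b)) {a b : α} (hr : Relation.ReflTransGen r a b) :
    Relation.ReflTransGen r' (f a) (f b) := by
  induction hr with
  | refl => exact .refl
  | tail _ h' ih => exact ih.tail (h _ _ h')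
theorem futC (hc : FC D (cstep F)) {k : ℕ} (hP : DM D (tP F k)) (v) {ψ} (hψ : ψ ∈ D) :
    {x : Ω × ℕ | ∃ y, (F x.1).le x.2 y ∧ (F x.1).tyC k x.2 y = v ∧ (x.1, y) ∈ ψ} ∈ D ∧
    {x : Ω × ℕ | ∃ y, (F x.1).le y x.2 ∧ (F x.1).tyC k y x.2 = v ∧ (x.1, y) ∈ ψ} ∈ D := by
  have key := key_lemma hc {f | ∃ a, f = fun t => t * a} (rmul_dm hc.toBCl hP) (fun p q _ => ⟨_, rfl⟩) (cfree_rmul k)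
    (fun t => t * v) hψ
  have ex : ∀ w r y, (F w).le r y → (F w).tyC k r y = v →
      PathF (cstep F) (fun q t => t * tP F k q) (w, r) (w, y) fun t => t * v := by
    intro w r y h1 h2
    have : Relation.ReflTransGen (cstep F) (w, r) (w, y) :=
      rtg_lift (fun n => (w, n)) (fun a b h => ⟨rfl, h⟩) h1.rtg
    obtain ⟨f, hf⟩ := exists_path (fun q t => t * tP F k q) this
    have h3 := (path_c k hf).2.2
    simp only at h3
    rw [← h2, ← h3]; exact hf
  constructor
  · convert key.1 using 1
    ext ⟨w, r⟩
    simp only [FutP, Set.mem_ofPred_eq]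
    constructor
    · rintro ⟨y, h1, h2, h3⟩
      exact ⟨(w, y), ex w r y h1 h2, h3⟩
    · rintro ⟨⟨w', y⟩, h1, h2⟩
      obtain ⟨h3, h4, h5⟩ := path_c k h1
      simp only at h3 h4 h5
      subst h3
      exact ⟨y, h4, (rmul_inj.1 h5).symm, h2⟩
  · convert key.2 using 1
    ext ⟨w, r⟩
    simp only [PastP, Set.mem_ofPred_eq]
    constructor
    · rintro ⟨y, h1, h2, h3⟩
      exact ⟨(w, y), ex w y r h1 h2, h3⟩
    · rintro ⟨⟨w', y⟩, h1, h2⟩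
      obtain ⟨h3, h4, h5⟩ := path_c k h1
      simp only at h3 h4 h5
      subst h3
      exact ⟨y, h4, (rmul_inj.1 h5).symm, h2⟩
theorem futS (hc : FC D (sstep F)) {k : ℕ} (hP : DM D (tS F k)) (v) {ψ} (hψ : ψ ∈ D) :
    {x : Ω × ℕ | ∃ y, (F x.1).Sib x.2 y ∧ ty k ((F x.1).FF ((F x.1).mid x.2 y)) = v ∧
      (x.1, y) ∈ ψ} ∈ D ∧
    {x : Ω × ℕ | ∃ y, (F x.1).Sib y x.2 ∧ ty k ((F x.1).FF ((F x.1).mid y x.2)) = v ∧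
      (x.1, y) ∈ ψ} ∈ D := by
  have key := key_lemma hc {f | ∃ a, f = fun t => t * a} (rmul_dm hc.toBCl hP) (fun p q _ => ⟨_, rfl⟩) (cfree_rmul k)
    (fun t => t * v) hψ
  have ex : ∀ w r y, (F w).Sib r y → ty k ((F w).FF ((F w).mid r y)) = v →
      PathF (sstep F) (fun q t => t * tS F k q) (w, r) (w, y) fun t => t * v := by
    intro w r y h1 h2
    have : Relation.ReflTransGen (sstep F) (w, r) (w, y) :=
      rtg_lift (fun n => (w, n)) (fun a b h => ⟨rfl, h⟩) h1
    obtain ⟨f, hf⟩ := exists_path (fun q t => t * tS F k q) this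
    have h3 := (path_s k hf).2.2
    simp only at h3
    rw [← h2, ← h3]; exact hf
  constructor
  · convert key.1 using 1
    ext ⟨w, r⟩
    simp only [FutP, Set.mem_ofPred_eq]
    constructor
    · rintro ⟨y, h1, h2, h3⟩
      exact ⟨(w, y), ex w r y h1 h2, h3⟩
    · rintro ⟨⟨w', y⟩, h1, h2⟩
      obtain ⟨h3, h4, h5⟩ := path_s k h1
      simp only at h3 h4 h5
      subst h3
      exact ⟨y, h4, (rmul_inj.1 h5).symm, h2⟩
  · convert key.2 using 1
    ext ⟨w, r⟩
    simp only [PastP, Set.mem_ofPred_eq]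
    constructor
    · rintro ⟨y, h1, h2, h3⟩
      exact ⟨(w, y), ex w y r h1 h2, h3⟩
    · rintro ⟨⟨w', y⟩, h1, h2⟩
      obtain ⟨h3, h4, h5⟩ := path_s k h1
      simp only at h3 h4 h5
      subst h3
      exact ⟨y, h4, (rmul_inj.1 h5).symm, h2⟩
structure Hyp (D : Set (Set (Ω × ℕ))) (F : Ω → Fst Λ) : Prop where
  c : FC D (cstep F)
  s : FC D (sstep F)
  l : DM D (lm F)
structure Lev (D : Set (Set (Ω × ℕ))) (F : Ω → Fst Λ) (k : ℕ) : Prop where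
  b : DM D (tB F k)
  l : DM D (tL F k)
  r : DM D (tR F k)
theorem Lev.s {k : ℕ} (H : Hyp D F) (h : Lev D F k) : DM D (tS F k) := by
  refine DM.det H.c.toBCl (DM.pair H.c.toBCl H.l h.b) ?_
  rintro x y hxy
  simp only [Prod.mk.injEq] at hxy
  exact Fst.sub_det hxy.1 hxy.2
theorem Lev.p {k : ℕ} (H : Hyp D F) (h : Lev D F k) : DM D (tP F k) := by
  have h0 : DM D fun x : Ω × ℕ => {b | x ∈ PXs (cstep F) {y | lm F y = b}} :=
    DM.sets H.c.toBCl fun b => H.c.px (H.l b)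
  refine DM.det H.c.toBCl (DM.pair H.c.toBCl h0 (DM.pair H.c.toBCl h.l h.r)) ?_
  rintro ⟨w, q⟩ ⟨w', q'⟩ hxy
  simp only [Prod.mk.injEq] at hxy
  obtain ⟨h1, h2, h3⟩ := hxy
  have h1' : ∀ b, (∃ p, (F w).Cov p q ∧ (F w).lam p = b) ↔
      ∃ p, (F w').Cov p q' ∧ (F w').lam p = b := by
    intro b
    have := Set.ext_iff.1 h1 b
    have e : ∀ w q, ((∃ p, (F w).Cov p q ∧ (F w).lam p = b) ↔
        (w, q) ∈ PXs (cstep F) {y | lm F y = b}) := by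
      intro w q
      constructor
      · rintro ⟨p, hp, hb⟩; exact ⟨(w, p), ⟨rfl, hp⟩, hb⟩
      · rintro ⟨⟨w1, p⟩, ⟨hw, hp⟩, hb⟩
        simp only at hw
        subst hw
        exact ⟨p, hp, hb⟩
    rw [e, e]; exact this
  by_cases hex : ∃ p, (F w).Cov p q
  · obtain ⟨p, hp⟩ := hex
    obtain ⟨p', hp', hb⟩ := (h1' _).1 ⟨p, hp, rfl⟩
    rw [tP_eq F k (x := (w, q)) hp, tP_eq F k (x := (w', q')) hp']
    exact Fst.ctx_det hp hp' hb.symm h2 h3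
  · have hex' : ¬ ∃ p, (F w').Cov p q' := by
      rintro ⟨p', hp'⟩
      obtain ⟨p, hp, _⟩ := (h1' _).2 ⟨p', hp', rfl⟩
      exact hex ⟨p, hp⟩
    unfold tP
    rw [dif_neg hex, dif_neg hex']
abbrev Tup (Λ : Type) (k : ℕ) :=
  TyQ (Λ × Code) k × TyQ (Λ × Code) k × Λ × TyQ (Λ × Code) k × TyQ (Λ × Code) k
theorem inner (H : Hyp D F) {k : ℕ} (h : Lev D F k) (v) (l : Λ) (b) :
    {x : Ω × ℕ | ∃ y, (F x.1).le x.2 y ∧ (F x.1).tyC k x.2 y = v ∧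
      (lm F (x.1, y) = l ∧ tB F k (x.1, y) = b)} ∈ D :=
  (futC H.c (h.p H) v (ψ := {y | lm F y = l ∧ tB F k y = b})
    (H.c.toBCl.and (H.l l) (h.b b))).1
def setB (F : Ω → Fst Λ) (k : ℕ) (x : Ω × ℕ) : Set (Tup Λ k) :=
  {t | ∃ z y, (F x.1).Cov x.2 z ∧ (F x.1).le z y ∧
    (F x.1).tup k ((F x.1).lft z) z y ((F x.1).rgt z) = t}
def setL (F : Ω → Fst Λ) (k : ℕ) (x : Ω × ℕ) : Set (Tup Λ k) :=
  {t | ∃ y, (F x.1).N y x.2 ∧ ∃ z, (F x.1).Sib z y ∧ ∃ u, (F x.1).le z u ∧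
    (F x.1).tup k ((F x.1).lft z) z u ((F x.1).mid z y) = t}
def setR (F : Ω → Fst Λ) (k : ℕ) (x : Ω × ℕ) : Set (Tup Λ k) :=
  {t | ∃ y, (F x.1).Sib x.2 y ∧ ∃ z, (F x.1).N y z ∧ ∃ u, (F x.1).le z u ∧
    (F x.1).tup k ((F x.1).mid x.2 y) z u ((F x.1).rgt z) = t}
theorem dm_setB (H : Hyp D F) {k : ℕ} (h : Lev D F k) : DM D (setB F k) := by
  refine DM.sets H.c.toBCl ?_
  rintro ⟨a, v, l, b, c⟩
  have h1 := H.c.ex (H.c.toBCl.and (H.c.toBCl.and (h.l a) (h.r c)) (inner H h v l b))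
  convert h1 using 1
  ext ⟨w, x⟩
  simp only [Set.mem_ofPred_eq, EXs, Fst.tup, Prod.mk.injEq]
  constructor
  · rintro ⟨z, y, h1, h2, h3, h4, h5, h6, h7⟩
    exact ⟨(w, z), ⟨rfl, h1⟩, ⟨h3, h7⟩, y, h2, h4, h5, h6⟩
  · rintro ⟨⟨w', z⟩, ⟨e, h1⟩, ⟨h3, h7⟩, y, h2, h4, h5, h6⟩
    simp only at e
    subst e
    exact ⟨z, y, h1, h2, h3, h4, h5, h6, h7⟩
theorem dm_setL (H : Hyp D F) {k : ℕ} (h : Lev D F k) : DM D (setL F k) := by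
  refine DM.sets H.c.toBCl ?_
  rintro ⟨a, v, l, b, c⟩
  have h1 := H.s.px (futS H.s (h.s H) c (H.c.toBCl.and (h.l a) (inner H h v l b))).2
  convert h1 using 1
  ext ⟨w, x⟩
  simp only [Set.mem_ofPred_eq, PXs, Fst.tup, Prod.mk.injEq]
  constructor
  · rintro ⟨y, hy, z, hz, u, h2, h3, h4, h5, h6, h7⟩
    exact ⟨(w, y), ⟨rfl, hy⟩, z, hz, h7, h3, u, h2, h4, h5, h6⟩
  · rintro ⟨⟨w', y⟩, ⟨e, hy⟩, z, hz, h7, h3, u, h2, h4, h5, h6⟩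
    simp only at e
    subst e
    exact ⟨y, hy, z, hz, u, h2, h3, h4, h5, h6, h7⟩
theorem dm_setR (H : Hyp D F) {k : ℕ} (h : Lev D F k) : DM D (setR F k) := by
  refine DM.sets H.c.toBCl ?_
  rintro ⟨a, v, l, b, c⟩
  have h1 := (futS H.s (h.s H) a
    (H.s.ex (H.c.toBCl.and (h.r c) (inner H h v l b)))).1
  convert h1 using 1
  ext ⟨w, x⟩
  simp only [Set.mem_ofPred_eq, EXs, Fst.tup, Prod.mk.injEq]
  constructor
  · rintro ⟨y, hy, z, hz, u, h2, h3, h4, h5, h6, h7⟩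
    exact ⟨y, hy, h3, (w, z), ⟨rfl, hz⟩, h7, u, h2, h4, h5, h6⟩
  · rintro ⟨y, hy, h3, ⟨w', z⟩, ⟨e, hz⟩, h7, u, h2, h4, h5, h6⟩
    simp only at e
    subst e
    exact ⟨y, hy, z, hz, u, h2, h3, h4, h5, h6, h7⟩
theorem lev (H : Hyp D F) : ∀ k, Lev D F k := by
  intro k
  have hb := H.c.toBCl
  induction k with
  | zero =>
    have : ∀ g : Ω × ℕ → TyQ (Λ × Code) 0, DM D g := by
      intro g b
      have : ∀ a b : TyQ (Λ × Code) 0, a = b := by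
        intro a b
        induction a using Quotient.inductionOn
        induction b using Quotient.inductionOn
        exact ty_eq.2 (by intro p hp; simp at hp)
      convert hb.tt using 1
      ext x
      simp [this (g x) b]
    exact ⟨this _, this _, this _⟩
  | succ k ih =>
    refine ⟨DM.det hb (dm_setB H ih) ?_, DM.det hb (dm_setL H ih) ?_, DM.det hb (dm_setR H ih) ?_⟩
    · rintro ⟨w, p⟩ ⟨w', p'⟩ he
      refine Fst.five_set ?_ ?_
      · intro x hx
        obtain ⟨z, hz, hzx⟩ := Fst.ex_child hx
        obtain ⟨z', y', h1, h2, h3⟩ := (Set.ext_iff.1 he _).1 ⟨z, x, hz, hzx, rfl⟩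
        exact ⟨_, z, _, _, z', _, Fst.five_below hz, hzx, Fst.five_below h1, y', h2, h3.symm⟩
      · intro x hx
        obtain ⟨z, hz, hzx⟩ := Fst.ex_child hx
        obtain ⟨z', y', h1, h2, h3⟩ := (Set.ext_iff.1 he _).2 ⟨z, x, hz, hzx, rfl⟩
        exact ⟨_, z', _, _, z, _, Fst.five_below h1, hzx, Fst.five_below hz, y', h2, h3⟩
    · rintro ⟨w, p⟩ ⟨w', p'⟩ he
      refine Fst.five_set ?_ ?_
      · intro x hx
        obtain ⟨z, y, hz, hy, hzx⟩ := Fst.ex_left hx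
        obtain ⟨y', hy', z', hz', x', hx', h3⟩ := (Set.ext_iff.1 he _).1 ⟨y, hy, z, hz, x, hzx, rfl⟩
        exact ⟨_, z, _, _, z', _, Fst.five_lft hz.le hz.same hy, hzx,
          Fst.five_lft hz'.le hz'.same hy', x', hx', h3.symm⟩
      · intro x hx
        obtain ⟨z, y, hz, hy, hzx⟩ := Fst.ex_left hx
        obtain ⟨y', hy', z', hz', x', hx', h3⟩ := (Set.ext_iff.1 he _).2 ⟨y, hy, z, hz, x, hzx, rfl⟩
        exact ⟨_, z', _, _, z, _, Fst.five_lft hz'.le hz'.same hy', hzx,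
          Fst.five_lft hz.le hz.same hy, x', hx', h3⟩
    · rintro ⟨w, p⟩ ⟨w', p'⟩ he
      refine Fst.five_set ?_ ?_
      · intro x hx
        obtain ⟨y, z, hz, hy, hzx⟩ := Fst.ex_right hx
        obtain ⟨y', hy', z', hz', x', hx', h3⟩ := (Set.ext_iff.1 he _).1 ⟨y, hz, z, hy, x, hzx, rfl⟩
        exact ⟨_, z, _, _, z', _, Fst.five_rgt hz.le hz.same hy, hzx,
          Fst.five_rgt hy'.le hy'.same hz', x', hx', h3.symm⟩
      · intro x hx
        obtain ⟨y, z, hz, hy, hzx⟩ := Fst.ex_right hx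
        obtain ⟨y', hy', z', hz', x', hx', h3⟩ := (Set.ext_iff.1 he _).2 ⟨y, hz, z, hy, x, hzx, rfl⟩
        exact ⟨_, z', _, _, z, _, Fst.five_rgt hy'.le hy'.same hz', hzx,
          Fst.five_rgt hz.le hz.same hy, x', hx', h3⟩
def isRoot (F : Ω → Fst Λ) (x : Ω × ℕ) : Prop := ∀ z, ¬ (F x.1).D z x.2
theorem root_mem (H : Hyp D F) : {x | isRoot F x} ∈ D := by
  have := H.c.neg (H.c.px H.c.tt)
  convert this using 1
  ext ⟨w, q⟩
  simp only [isRoot, PXs, Set.mem_ofPred_eq, Set.mem_compl_iff]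
  constructor
  · rintro h ⟨⟨w', p⟩, ⟨e, hp⟩, _⟩
    simp only at e
    subst e
    exact h _ hp.1
  · intro h z hz
    have : Relation.ReflTransGen (F w).Cov z q := Fst.le.rtg (Or.inr hz)
    rcases Relation.ReflTransGen.cases_tail this with e | ⟨p, _, hp⟩
    · have := (F w).lt hz; omega
    · exact h ⟨(w, p), ⟨rfl, hp⟩, trivial⟩
theorem invariant_mem (H : Hyp D F) (k : ℕ) (P : Ω × ℕ → Prop)
    (hP : ∀ x y : Ω × ℕ, EF k ((F x.1).FF Set.univ) ((F y.1).FF Set.univ)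
      [(⟨x.2, trivial⟩, ⟨y.2, trivial⟩)] → (P x ↔ P y)) : {x | P x} ∈ D := by
  have hb := H.c.toBCl
  have h := lev H k
  have h1 : DM D fun x : Ω × ℕ => {t : Tup Λ k | ∃ r, (F x.1).le r x.2 ∧
      (∀ z, ¬ (F x.1).D z r) ∧ (F x.1).tup k ((F x.1).lft r) r x.2 ((F x.1).rgt r) = t} := by
    refine DM.sets hb ?_
    rintro ⟨a, v, l, b, c⟩
    have h1 := hb.and (hb.and (H.l l) (h.b b)) (futC H.c (h.p H) v (hb.and (root_mem H)
      (hb.and (h.l a) (h.r c)))).2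
    convert h1 using 1
    ext ⟨w, x⟩
    simp only [Set.mem_ofPred_eq, Fst.tup, Prod.mk.injEq, Set.mem_inter_iff]
    constructor
    · rintro ⟨r, h1, h2, h3, h4, h5, h6, h7⟩
      exact ⟨⟨h5, h6⟩, r, h1, h4, h2, h3, h7⟩
    · rintro ⟨⟨h5, h6⟩, r, h1, h4, h2, h3, h7⟩
      exact ⟨r, h1, h2, h3, h4, h5, h6, h7⟩
  have h2 : DM D P := by
    refine DM.det hb h1 ?_
    intro x y he
    obtain ⟨r, hr, hrx⟩ := Fst.ex_root (W := F x.1) x.2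
    obtain ⟨r', hrx', hr', ht⟩ := (Set.ext_iff.1 he _).1 ⟨r, hrx, hr, rfl⟩
    exact propext (hP x y (Fst.five_ef (Fst.five_univ hr) (Fst.five_univ hr') hrx hrx' ht.symm))
  have := h2 True
  simpa using this
end Ind
end OPLTheory
end
noncomputable section
namespace OPLTheory
set_option linter.unusedSectionVars false
open Relation
theorem rtg_shift {α : Type*} {R : α → α → Prop} {φ : α → Prop} {q x : α} :
    (ReflTransGen (fun a b => R a b ∧ φ a) q x ∧ φ x) ↔
      (φ q ∧ ReflTransGen (fun a b => R a b ∧ φ b) q x) := by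
  constructor
  · rintro ⟨h, hx⟩
    induction h with
    | refl => exact ⟨hx, .refl⟩
    | tail _ h ih =>
      obtain ⟨a, b⟩ := ih h.2
      exact ⟨a, b.tail ⟨h.1, hx⟩⟩
  · rintro ⟨hq, h⟩
    induction h with
    | refl => exact ⟨.refl, hq⟩
    | tail _ h ih => exact ⟨ih.1.tail ⟨h.1, ih.2⟩, h.2⟩
theorem rtg_src {α : Type*} {R : α → α → Prop} {φ : α → Prop} {r x : α} :
    ReflTransGen (fun a b => R a b ∧ φ b) r x ↔
      r = x ∨ ∃ q, R r q ∧ ReflTransGen (fun a b => R a b ∧ φ a) q x ∧ φ x := by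
  constructor
  · intro h
    rcases ReflTransGen.cases_head h with h | ⟨q, h1, h2⟩
    · exact Or.inl h
    · exact Or.inr ⟨q, h1.1, rtg_shift.2 ⟨h1.2, h2⟩⟩
  · rintro (rfl | ⟨q, h1, h2⟩)
    · exact .refl
    · obtain ⟨a, b⟩ := rtg_shift.1 h2
      exact ReflTransGen.head ⟨h1, a⟩ b
theorem isPath_src {step : ℕ → ℕ → Prop} {φ : ℕ → Prop} {i j : ℕ} :
    (∃ l, IsPath step l i j ∧ ∀ p ∈ l.dropLast, φ p) ↔
      ReflTransGen (fun a b => step a b ∧ φ a) i j := by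
  constructor
  · rintro ⟨l, ⟨h1, h2, h3⟩, h4⟩
    induction l generalizing i with
    | nil => simp at h1
    | cons a l ih =>
      simp only [List.head?_cons, Option.some.injEq] at h1
      subst h1
      cases l with
      | nil =>
        simp only [List.getLast?_singleton, Option.some.injEq] at h2
        subst h2; exact .refl
      | cons b l =>
        have h3' := List.isChain_cons_cons.1 h3
        refine ReflTransGen.head ⟨h3'.1, h4 a (by simp)⟩ (ih ?_ rfl (by simpa using h2) h3'.2)
        intro p hp
        exact h4 p (by simp only [List.dropLast_cons_cons]; exact List.mem_cons_of_mem _ hp)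
  · intro h
    induction h using ReflTransGen.head_induction_on with
    | refl => exact ⟨[j], ⟨rfl, rfl, List.isChain_singleton _⟩, by simp⟩
    | head h1 _ ih =>
      rename_i a c h2
      obtain ⟨l, ⟨h3, h4, h5⟩, h6⟩ := ih
      cases l with
      | nil => simp at h3
      | cons b l =>
        simp only [List.head?_cons, Option.some.injEq] at h3
        subst h3
        refine ⟨a :: b :: l, ⟨rfl, by simpa using h4, List.isChain_cons_cons.2 ⟨h1.1, h5⟩⟩, ?_⟩
        intro p hp
        simp only [List.dropLast_cons_cons, List.mem_cons] at hp
        rcases hp with rfl | hp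
        · exact h1.2
        · exact h6 p hp
theorem isPath_tgt {step : ℕ → ℕ → Prop} {φ : ℕ → Prop} {i j : ℕ} :
    (∃ l, IsPath step l i j ∧ ∀ p ∈ l.tail, φ p) ↔
      ReflTransGen (fun a b => step a b ∧ φ b) i j := by
  constructor
  · rintro ⟨l, ⟨h1, h2, h3⟩, h4⟩
    induction l generalizing i with
    | nil => simp at h1
    | cons a l ih =>
      simp only [List.head?_cons, Option.some.injEq] at h1
      subst h1
      cases l with
      | nil =>
        simp only [List.getLast?_singleton, Option.some.injEq] at h2
        subst h2; exact .refl
      | cons b l =>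
        have h3' := List.isChain_cons_cons.1 h3
        refine ReflTransGen.head ⟨h3'.1, h4 b (by simp)⟩ (ih ?_ rfl (by simpa using h2) h3'.2)
        intro p hp
        exact h4 p (List.mem_cons_of_mem _ hp)
  · intro h
    induction h using ReflTransGen.head_induction_on with
    | refl => exact ⟨[j], ⟨rfl, rfl, List.isChain_singleton _⟩, by simp⟩
    | head h1 _ ih =>
      rename_i a c h2
      obtain ⟨l, ⟨h3, h4, h5⟩, h6⟩ := ih
      cases l with
      | nil => simp at h3
      | cons b l =>
        simp only [List.head?_cons, Option.some.injEq] at h3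
        subst h3
        refine ⟨a :: b :: l, ⟨rfl, by simpa using h4, List.isChain_cons_cons.2 ⟨h1.1, h5⟩⟩, ?_⟩
        intro p hp
        simp only [List.tail_cons, List.mem_cons] at hp
        rcases hp with rfl | hp
        · exact h1.2
        · exact h6 p hp
section Sem
variable {pr : ℕ → ℕ → Option Prec}
def Up (pr : ℕ → ℕ → Option Prec) (i j : ℕ) : Prop :=
  Gap pr i j ∧ (pr i j = some Prec.gt ∨ pr i j = some Prec.eq)
theorem Up.cases {i j : ℕ} (h : Up pr i j) : Pop pr i j ∨ PEq pr i j :=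
  h.2.elim (fun e => Or.inl ⟨h.1, e⟩) (fun e => Or.inr ⟨h.1, e⟩)
theorem PEq.up {i j : ℕ} (h : PEq pr i j) : Up pr i j := ⟨h.1, Or.inr h.2⟩
theorem Pop.up {i j : ℕ} (h : Pop pr i j) : Up pr i j := ⟨h.1, Or.inl h.2⟩
theorem Up.lt' {i j : ℕ} (h : Up pr i j) : i < j := h.1.lt'
theorem up_unique {i j j' : ℕ} (h : Up pr i j) (h' : Up pr i j') : j = j' := by
  rcases h.cases with h | h <;> rcases h'.cases with h' | h'
  · exact h.ends.unique h'.ends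
  · exact absurd ⟨_, h'⟩ h.not_hasEq
  · exact absurd ⟨_, h⟩ h'.not_hasEq
  · exact peq_unique h h'
theorem Desc.trans' {i j k : ℕ} (h : Desc pr i j) (h' : Desc pr j k) : Desc pr i k :=
  TransGen.trans h h'
theorem par_no_between {p q z : ℕ} (h : Par pr p q) (h1 : Desc pr p z) : ¬ Desc pr z q := by
  intro h2
  rcases h2.le_par h with e | e
  · subst e; exact absurd h1.lt' (by simp)
  · have := h1.lt'; have := e.lt'; omega
theorem ends_eq {i k j : ℕ} (h : PEq pr i k) : Ends pr i j ↔ Ends pr k j := by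
  have hik := h.par.lt'
  have hD : Desc pr i k := TransGen.single h.par
  constructor
  · rintro ⟨h1, h2, h3⟩
    have hkj : k < j := by
      by_contra hc
      rcases Nat.lt_or_ge j k with h4 | h4
      · exact h3 (hD.convex h1 h4)
      · have : j = k := by omega
        subst this; exact h3 hD
    refine ⟨hkj, fun x hx hx' => ?_, fun h4 => h3 (hD.trans' h4)⟩
    have h5 := h2 x (by omega) hx'
    obtain ⟨c, h6, h7⟩ := (TransGen.head'_iff.1 h5)
    have hck := eq_last h c h6.1
    have h7' : c = x ∨ Desc pr c x := by
      rcases Relation.reflTransGen_iff_eq_or_transGen.1 h7 with e | e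
      · exact Or.inl e.symm
      · exact Or.inr e
    rcases h7' with rfl | h7'
    · omega
    · rcases Nat.lt_or_ge c k with h8 | h8
      · exact absurd (h7'.convex h8 hx) (par_no_between h.par (TransGen.single h6))
      · have : c = k := by omega
        subst this; exact h7'
  · rintro ⟨h1, h2, h3⟩
    refine ⟨by omega, fun x hx hx' => ?_, fun h5 => ?_⟩
    · rcases Nat.lt_trichotomy x k with h4 | h4 | h4
      · exact hD.convex hx h4
      · subst h4; exact hD
      · exact hD.trans' (h2 x h4 hx')
    · obtain ⟨c, h6, h7⟩ := (TransGen.head'_iff.1 h5)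
      have hck := eq_last h c h6.1
      rcases Relation.reflTransGen_iff_eq_or_transGen.1 h7 with e | h7'
      · omega
      · rcases Nat.lt_or_ge c k with h8 | h8
        · exact absurd (Desc.convex h7' h8 h1) (par_no_between h.par (TransGen.single h6))
        · have : c = k := by omega
          subst this; exact h3 h7'
theorem ends_iff (hc : Cmp pr) {i j : ℕ} : Ends pr i j ↔ ∃ t, EqStar pr i t ∧ Pop pr t j := by
  constructor
  · intro h
    induction hn : j - i using Nat.strong_induction_on generalizing i with
    | _ n ih =>
    by_cases he : hasEq pr i
    · obtain ⟨k, hk⟩ := he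
      have h' := (ends_eq hk).1 h
      have := h'.1
      have := hk.par.lt'
      obtain ⟨t, h1, h2⟩ := ih (j - k) (by omega) h' rfl
      exact ⟨t, ReflTransGen.head hk h1, h2⟩
    · exact ⟨i, .refl, h.pop hc he⟩
  · rintro ⟨t, h1, h2⟩
    induction h1 using ReflTransGen.head_induction_on with
    | refl => exact h2.ends
    | head h _ ih => exact (ends_eq h).2 ih
def descF (pr : ℕ → ℕ → Option Prec) {Λ : Type} (lam : ℕ → Λ) : Fst Λ where
  D := Desc pr
  lam := lam
  lt h := h.lt'
  tr h h' := h.trans' h'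
  cx h h1 h2 := h.convex h1 h2
def Nx (pr : ℕ → ℕ → Option Prec) (i j : ℕ) : Prop := (descF pr fun _ => ()).N i j
theorem Nx.ends {i j : ℕ} (h : Nx pr i j) : Ends pr i j := h.1
theorem Nx.same {i j : ℕ} (h : Nx pr i j) (x : ℕ) : Desc pr x i ↔ Desc pr x j := h.2 x
theorem cov_iff {p q : ℕ} {Λ : Type} {lam : ℕ → Λ} : (descF pr lam).Cov p q ↔ Par pr p q := by
  constructor
  · rintro ⟨h1, h2⟩
    obtain ⟨p', h3, h4⟩ := Desc.parent h1
    rcases h4 with rfl | h4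
    · exact h3
    · exact absurd (TransGen.single h3) (h2 p' h4)
  · intro h
    exact ⟨TransGen.single h, fun z hz => par_no_between h hz⟩
theorem Nx.par {i j p : ℕ} (h : Nx pr i j) : Par pr p i ↔ Par pr p j := by
  rw [← cov_iff (lam := fun _ => ()), ← cov_iff (lam := fun _ => ())]
  unfold Fst.Cov
  constructor
  · rintro ⟨h1, h2⟩
    exact ⟨(h.2 p).1 h1, fun z hz hz' => h2 z hz ((h.2 z).2 hz')⟩
  · rintro ⟨h1, h2⟩
    exact ⟨(h.2 p).2 h1, fun z hz hz' => h2 z hz ((h.2 z).1 hz')⟩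
theorem Nx.not_isE {i j : ℕ} (h : Nx pr i j) : ¬ isE pr i := by
  rintro ⟨p, hp⟩
  have h1 := h.par.1 hp.par
  have := eq_last hp j h1.1
  have := h.ends.1
  omega
theorem nx_unique {p p' q : ℕ} (h : Nx pr p q) (h' : Nx pr p' q) : p = p' := by
  have key : ∀ p p', Nx pr p q → Nx pr p' q → ¬ p < p' := by
    intro p p' h h' hlt
    have h1 := h.ends.2.1 p' hlt h'.ends.1
    exact h.ends.2.2 ((h'.same p).1 h1)
  have := key p p' h h'
  have := key p' p h' h
  omega
theorem nx_exists {p i j : ℕ} (h : Par pr p i) (h' : Par pr p j) (hij : i < j) :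
    ∃ e, Nx pr i e := by
  obtain ⟨e, he, _⟩ := Fst.ex_next (W := descF pr fun _ => ()) (p := i) (x := j) ⟨hij, fun hd => by
    rcases Desc.le_par hd h' with e | e
    · have := h.lt'; omega
    · have := h.lt'; have := e.lt'; omega, fun x hx => by
    rcases Desc.le_par hx h with rfl | e
    · exact TransGen.single h'
    · exact TransGen.tail e h'⟩
  exact ⟨e, he⟩
theorem nx_root {i j : ℕ} (h : ∀ p, ¬ Par pr p i) (he : Ends pr i j) : Nx pr i j := by
  have hr : ∀ x, ¬ Desc pr x i := fun x hx => by
    obtain ⟨p, hp, _⟩ := hx.parent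
    exact h p hp
  refine ⟨he, fun x => ⟨fun hx => absurd hx (hr x), fun hx => ?_⟩⟩
  have hx : Desc pr x j := hx
  exfalso
  rcases Nat.lt_trichotomy x i with h1 | h1 | h1
  · exact hr x (hx.convex h1 he.1)
  · subst h1; exact he.2.2 hx
  · exact he.2.2 ((he.2.1 x h1 hx.lt').trans' hx)
def hasN (pr : ℕ → ℕ → Option Prec) (i : ℕ) : Prop := ∃ j, Nx pr i j
theorem nx_iff {i j : ℕ} : Nx pr i j ↔ hasN pr i ∧ Ends pr i j := by
  constructor
  · intro h; exact ⟨⟨j, h⟩, h.ends⟩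
  · rintro ⟨⟨k, h⟩, h'⟩
    rw [h'.unique h.ends]; exact h
theorem hasN_iff {i : ℕ} : hasN pr i ↔ ((∀ p, ¬ Par pr p i) ∧ ∃ j, Ends pr i j) ∨
    ∃ p, Par pr p i ∧ ∃ j, i < j ∧ Par pr p j := by
  constructor
  · rintro ⟨j, h⟩
    by_cases hp : ∃ p, Par pr p i
    · obtain ⟨p, hp⟩ := hp
      exact Or.inr ⟨p, hp, j, h.ends.1, h.par.1 hp⟩
    · push Not at hp
      exact Or.inl ⟨hp, j, h.ends⟩
  · rintro (⟨h, j, hj⟩ | ⟨p, h, j, h1, h2⟩)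
    · exact ⟨j, nx_root h hj⟩
    · exact nx_exists h h2 h1
def Nx' (pr : ℕ → ℕ → Option Prec) (i j : ℕ) : Prop := Nx pr i j ∧ ¬ isE pr j
def H2 (pr : ℕ → ℕ → Option Prec) (i : ℕ) : Prop := ∃ j, Nx' pr i j
theorem core (hc : Cmp pr) {α β : ℕ → Prop} {s y : ℕ} (hs : ¬ isE pr s) :
    (ReflTransGen (fun a b => Up pr a b ∧ (isE pr a ∨ (H2 pr a ∧ α a)) ∧ (isE pr b ∨ β b)) s y ∧
      ¬ isE pr y) ↔ ReflTransGen (fun a b => Nx' pr a b ∧ α a ∧ β b) s y := by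
  constructor
  · rintro ⟨h, hy⟩
    have key : ∃ s', ReflTransGen (fun a b => Nx' pr a b ∧ α a ∧ β b) s s' ∧ EqStar pr s' y ∧
        ¬ isE pr s' ∧ (y ≠ s' → H2 pr s' ∧ α s') := by
      clear hy
      induction h with
      | refl => exact ⟨s, .refl, .refl, hs, fun h => absurd rfl h⟩
      | @tail y b _ h ih =>
        obtain ⟨s', h1, h2, h3, h4⟩ := ih
        have h5 : H2 pr s' ∧ α s' := by
          by_cases e : y = s'
          · subst e; exact h.2.1.resolve_left h3
          · exact h4 e
        rcases h.1.cases with h6 | h6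
        · have h7 : Ends pr s' b := (ends_iff hc).2 ⟨y, h2, h6⟩
          obtain ⟨⟨j, hj⟩, h8⟩ := h5
          have := h7.unique hj.1.ends
          subst this
          exact ⟨b, h1.tail ⟨hj, h8, h.2.2.resolve_left hj.2⟩, .refl, hj.2, fun h => absurd rfl h⟩
        · exact ⟨s', h1, h2.tail h6, h3, fun _ => h5⟩
    obtain ⟨s', h1, h2, h3, _⟩ := key
    rcases ReflTransGen.cases_tail h2 with e | ⟨c, _, h5⟩
    · rw [e]; exact h1
    · exact absurd ⟨c, h5⟩ hy
  · intro h
    induction h with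
    | refl => exact ⟨.refl, hs⟩
    | @tail a b _ h ih =>
      refine ⟨ih.1.trans ?_, h.1.2⟩
      obtain ⟨t, h1, h2⟩ := (ends_iff hc).1 h.1.1.ends
      have ha : isE pr a ∨ (H2 pr a ∧ α a) := Or.inr ⟨⟨b, h.1⟩, h.2.1⟩
      have key : ReflTransGen (fun a b => Up pr a b ∧ (isE pr a ∨ (H2 pr a ∧ α a)) ∧
          (isE pr b ∨ β b)) a t ∧ (isE pr t ∨ (H2 pr t ∧ α t)) := by
        clear h2
        induction h1 with
        | refl => exact ⟨.refl, ha⟩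
        | @tail c d _ hcd ih =>
          have hd : isE pr d := ⟨c, hcd⟩
          exact ⟨ih.1.tail ⟨hcd.up, ih.2, Or.inl hd⟩, Or.inl hd⟩
      exact key.1.tail ⟨h2.up, key.2, Or.inr h.2.2⟩
theorem eqStar_iff {i t : ℕ} : EqStar pr i t ↔
    ReflTransGen (fun a b => Par pr a b ∧ isE pr b) i t := by
  constructor
  · exact fun h => ReflTransGen.mono (fun a b h => ⟨h.par, a, h⟩) _ _ h
  · refine fun h => ReflTransGen.mono (fun a b h => ?_) _ _ h
    obtain ⟨h1, c, h2⟩ := h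
    rw [par_unique _ _ _ h1 h2.par]; exact h2
end Sem
end OPLTheory
end
noncomputable section
namespace OPLTheory
set_option linter.unusedSectionVars false
section Words
open Relation
theorem rtg_to_end {R R' Q : ℕ → ℕ → Prop} {i j : ℕ} (h1 : ∀ a b, R' a b → R a b)
    (h2 : ∀ a b, R a b → ReflTransGen R b j → R' a b) :
    ReflTransGen (fun a b => R' a b ∧ Q a b) i j ↔ ReflTransGen (fun a b => R a b ∧ Q a b) i j := by
  constructor
  · exact fun h => ReflTransGen.mono (fun a b h => ⟨h1 a b h.1, h.2⟩) _ _ h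
  · intro h
    induction h using ReflTransGen.head_induction_on with
    | refl => exact .refl
    | head h h' ih =>
      exact ReflTransGen.head ⟨h2 _ _ h.1 (ReflTransGen.mono (fun a b h => h.1) _ _ h'), h.2⟩ ih
theorem gap_iff {pr : ℕ → ℕ → Option Prec} {i j : ℕ} :
    Gap pr i j ↔ j = i + 1 ∨ (i + 1 < j ∧ Chain pr i j) := by
  constructor
  · intro h
    by_cases e : j = i + 1
    · exact Or.inl e
    · have := h.lt'
      exact Or.inr (chain_iff.2 ⟨by omega, h⟩)
  · rintro (rfl | h)
    · exact .empty rfl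
    · exact (chain_iff.1 h).2
variable {AP : Type} {M : OPM (Set AP)} {w : OPWordW AP}
theorem cmp_of (hw : w.Compatible M) : Cmp (w.prec M) := by
  intro i j h
  rcases gap_iff.1 h with rfl | h
  · exact hw.1 i
  · exact hw.2 i j h.2
theorem dsp_par {bnd a b : ℕ} (h : (w.frame M).dspStep bnd a b) : Par (w.prec M) a b := by
  rcases h with ⟨h1, rfl⟩ | ⟨_, rfl, h⟩
  · have := Nat.sSup_mem h1 ⟨bnd, fun x hx => hx.1⟩
    exact ⟨gap_iff.2 (Or.inr this.2.1), this.2.2⟩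
  · exact ⟨.empty rfl, h⟩
theorem par_dsp {bnd a b : ℕ} (h : Par (w.prec M) a b) (hb : ReflTransGen (Par (w.prec M)) b bnd) :
    (w.frame M).dspStep bnd a b := by
  have hle : b ≤ bnd := by
    rcases reflTransGen_iff_eq_or_transGen.1 hb with e | e
    · omega
    · exact (Desc.lt' e).le
  have hmax : ∀ c ∈ (w.frame M).dspSet bnd a, c ≤ b := by
    intro c hc
    have hP : Par (w.prec M) a c := ⟨gap_iff.2 (Or.inr hc.2.1), hc.2.2⟩
    by_contra hcb
    have hcb : b < c := by omega
    have hcl := hc.1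
    rcases reflTransGen_iff_eq_or_transGen.1 hb with e | e
    · omega
    · have : Desc (w.prec M) b c := by
        rcases Nat.lt_or_ge c bnd with h3 | h3
        · exact Desc.convex e hcb h3
        · have : c = bnd := by omega
          rw [this]; exact e
      exact par_no_between hP (TransGen.single h) this
  rcases gap_iff.1 h.1 with e | hc
  · refine Or.inr ⟨?_, e, h.2⟩
    rintro ⟨c, hc⟩
    have := hmax c hc
    have : a + 1 < c := hc.2.1.1
    omega
  · have hm : b ∈ (w.frame M).dspSet bnd a := ⟨hle, hc, h.2⟩
    refine Or.inl ⟨⟨b, hm⟩, ?_⟩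
    have h1 := Nat.sSup_mem ⟨b, hm⟩ ⟨bnd, fun x hx => hx.1⟩
    exact le_antisymm (le_csSup ⟨bnd, fun x hx => hx.1⟩ hm) (hmax _ h1)
theorem usp_up {bnd a b : ℕ} (h : (w.frame M).uspStep bnd a b) : Up (w.prec M) a b := by
  rcases h with ⟨h1, rfl⟩ | ⟨_, rfl, h⟩
  · have := Nat.sSup_mem h1 ⟨bnd, fun x hx => hx.1⟩
    exact ⟨gap_iff.2 (Or.inr this.2.1), this.2.2⟩
  · exact ⟨.empty rfl, h⟩
theorem up_le {pr : ℕ → ℕ → Option Prec} {a b : ℕ} (h : ReflTransGen (Up pr) a b) : a ≤ b := by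
  induction h with
  | refl => exact le_rfl
  | tail _ h ih => exact ih.trans h.lt'.le
theorem par_le {pr : ℕ → ℕ → Option Prec} {a b : ℕ} (h : ReflTransGen (Par pr) a b) : a ≤ b := by
  induction h with
  | refl => exact le_rfl
  | tail _ h ih => exact ih.trans h.lt'.le
theorem up_usp {bnd a b : ℕ} (h : Up (w.prec M) a b) (hb : ReflTransGen (Up (w.prec M)) b bnd) :
    (w.frame M).uspStep bnd a b := by
  have hle := up_le hb
  have hmax : ∀ c ∈ (w.frame M).uspSet bnd a, c = b := by
    intro c hc
    have hP : Up (w.prec M) a c := ⟨gap_iff.2 (Or.inr hc.2.1), hc.2.2⟩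
    exact up_unique hP h
  rcases gap_iff.1 h.1 with e | hc
  · refine Or.inr ⟨?_, e, h.2⟩
    rintro ⟨c, hc⟩
    have := hmax c hc
    have : a + 1 < c := hc.2.1.1
    omega
  · have hm : b ∈ (w.frame M).uspSet bnd a := ⟨hle, hc, h.2⟩
    refine Or.inl ⟨⟨b, hm⟩, ?_⟩
    have h1 := Nat.sSup_mem ⟨b, hm⟩ ⟨bnd, fun x hx => hx.1⟩
    exact (hmax _ h1).symm
open POTL in
theorem sat_untilD {φ ψ : POTL AP} {i : ℕ} : Sat (w.frame M) (.untilD φ ψ) i ↔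
    ∃ j, ReflTransGen (fun a b => Par (w.prec M) a b ∧ Sat (w.frame M) φ a) i j ∧
      Sat (w.frame M) ψ j := by
  simp only [Sat]
  refine exists_congr fun j => ?_
  have h := isPath_src (step := (w.frame M).dspStep j) (φ := Sat (w.frame M) φ) (i := i) (j := j)
  rw [rtg_to_end (fun a b => dsp_par) (fun a b => par_dsp)] at h
  rw [← h]
  constructor
  · rintro ⟨_, _, l, h1, h2, h3⟩; exact ⟨⟨l, h1, h3⟩, h2⟩
  · rintro ⟨⟨l, h1, h3⟩, h2⟩
    refine ⟨?_, trivial, l, h1, h2, h3⟩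
    exact par_le (ReflTransGen.mono (fun a b h => h.1) _ _ (h.1 ⟨l, h1, h3⟩))
open POTL in
theorem sat_untilU {φ ψ : POTL AP} {i : ℕ} : Sat (w.frame M) (.untilU φ ψ) i ↔
    ∃ j, ReflTransGen (fun a b => Up (w.prec M) a b ∧ Sat (w.frame M) φ a) i j ∧
      Sat (w.frame M) ψ j := by
  simp only [Sat]
  refine exists_congr fun j => ?_
  have h := isPath_src (step := (w.frame M).uspStep j) (φ := Sat (w.frame M) φ) (i := i) (j := j)
  rw [rtg_to_end (fun a b => usp_up) (fun a b => up_usp)] at h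
  rw [← h]
  constructor
  · rintro ⟨_, _, l, h1, h2, h3⟩; exact ⟨⟨l, h1, h3⟩, h2⟩
  · rintro ⟨⟨l, h1, h3⟩, h2⟩
    refine ⟨?_, trivial, l, h1, h2, h3⟩
    exact up_le (ReflTransGen.mono (fun a b h => h.1) _ _ (h.1 ⟨l, h1, h3⟩))
open POTL in
theorem sat_sinceD {φ ψ : POTL AP} {i : ℕ} : Sat (w.frame M) (.sinceD φ ψ) i ↔
    ∃ j, ReflTransGen (fun a b => Par (w.prec M) a b ∧ Sat (w.frame M) φ b) j i ∧
      Sat (w.frame M) ψ j := by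
  simp only [Sat]
  refine exists_congr fun j => ?_
  have h := isPath_tgt (step := (w.frame M).dspStep i) (φ := Sat (w.frame M) φ) (i := j) (j := i)
  rw [rtg_to_end (fun a b => dsp_par) (fun a b => par_dsp)] at h
  rw [← h]
  constructor
  · rintro ⟨_, l, h1, h2, h3⟩; exact ⟨⟨l, h1, h3⟩, h2⟩
  · rintro ⟨⟨l, h1, h3⟩, h2⟩
    refine ⟨?_, l, h1, h2, h3⟩
    exact par_le (ReflTransGen.mono (fun a b h => h.1) _ _ (h.1 ⟨l, h1, h3⟩))
open POTL in
theorem sat_sinceU {φ ψ : POTL AP} {i : ℕ} : Sat (w.frame M) (.sinceU φ ψ) i ↔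
    ∃ j, ReflTransGen (fun a b => Up (w.prec M) a b ∧ Sat (w.frame M) φ b) j i ∧
      Sat (w.frame M) ψ j := by
  simp only [Sat]
  refine exists_congr fun j => ?_
  have h := isPath_tgt (step := (w.frame M).uspStep i) (φ := Sat (w.frame M) φ) (i := j) (j := i)
  rw [rtg_to_end (fun a b => usp_up) (fun a b => up_usp)] at h
  rw [← h]
  constructor
  · rintro ⟨_, l, h1, h2, h3⟩; exact ⟨⟨l, h1, h3⟩, h2⟩
  · rintro ⟨⟨l, h1, h3⟩, h2⟩
    refine ⟨?_, l, h1, h2, h3⟩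
    exact up_le (ReflTransGen.mono (fun a b h => h.1) _ _ (h.1 ⟨l, h1, h3⟩))
variable (M) in
abbrev Wd : Type := {w : OPWordW AP // w.Compatible M}
def Dw : Set (Set (Wd M × ℕ)) :=
  {S | ∃ φ : POTL AP, ∀ (w : Wd M) (i : ℕ), (w, i) ∈ S ↔ POTL.Sat (w.1.frame M) φ i}
abbrev pq (w : Wd M) : ℕ → ℕ → Option Prec := w.1.prec M
theorem dw_bcl : BCl (Dw (M := M)) where
  tt := ⟨.tt, fun w i => by simp [POTL.Sat]⟩
  neg := by
    rintro S ⟨φ, h⟩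
    exact ⟨.neg φ, fun w i => by rw [Set.mem_compl_iff, h]; rfl⟩
  or := by
    rintro S S' ⟨φ, h⟩ ⟨ψ, h'⟩
    exact ⟨.orf φ ψ, fun w i => by rw [Set.mem_union, h, h']; rfl⟩
theorem dw_ex {S : Set (Wd M × ℕ)} (hS : S ∈ Dw) :
    {x : Wd M × ℕ | ∃ j, Par (pq x.1) x.2 j ∧ (x.1, j) ∈ S} ∈ Dw := by
  obtain ⟨φ, h⟩ := hS
  refine ⟨.orf (.nextD φ) (.chiFD φ), fun w i => ?_⟩
  simp only [Set.mem_ofPred_eq, POTL.Sat, h]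
  constructor
  · rintro ⟨j, ⟨h1, h2⟩, h3⟩
    rcases gap_iff.1 h1 with rfl | h1
    · exact Or.inl ⟨trivial, h2, h3⟩
    · exact Or.inr ⟨j, h1, h2, h3⟩
  · rintro (⟨_, h2, h3⟩ | ⟨j, h1, h2, h3⟩)
    · exact ⟨i + 1, ⟨.empty rfl, h2⟩, h3⟩
    · exact ⟨j, ⟨gap_iff.2 (Or.inr h1), h2⟩, h3⟩
theorem dw_ux {S : Set (Wd M × ℕ)} (hS : S ∈ Dw) :
    {x : Wd M × ℕ | ∃ j, Up (pq x.1) x.2 j ∧ (x.1, j) ∈ S} ∈ Dw := by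
  obtain ⟨φ, h⟩ := hS
  refine ⟨.orf (.nextU φ) (.chiFU φ), fun w i => ?_⟩
  simp only [Set.mem_ofPred_eq, POTL.Sat, h]
  constructor
  · rintro ⟨j, ⟨h1, h2⟩, h3⟩
    rcases gap_iff.1 h1 with rfl | h1
    · exact Or.inl ⟨trivial, h2, h3⟩
    · exact Or.inr ⟨j, h1, h2, h3⟩
  · rintro (⟨_, h2, h3⟩ | ⟨j, h1, h2, h3⟩)
    · exact ⟨i + 1, ⟨.empty rfl, h2⟩, h3⟩
    · exact ⟨j, ⟨gap_iff.2 (Or.inr h1), h2⟩, h3⟩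
theorem dw_px {S : Set (Wd M × ℕ)} (hS : S ∈ Dw) :
    {x : Wd M × ℕ | ∃ j, Par (pq x.1) j x.2 ∧ (x.1, j) ∈ S} ∈ Dw := by
  obtain ⟨φ, h⟩ := hS
  refine ⟨.orf (.backD φ) (.chiPD φ), fun w i => ?_⟩
  simp only [Set.mem_ofPred_eq, POTL.Sat, h]
  constructor
  · rintro ⟨j, ⟨h1, h2⟩, h3⟩
    rcases gap_iff.1 h1 with rfl | h1
    · exact Or.inl ⟨by omega, h2, h3⟩
    · exact Or.inr ⟨j, h1, h2, h3⟩
  · rintro (⟨h1, h2, h3⟩ | ⟨j, h1, h2, h3⟩)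
    · exact ⟨i - 1, ⟨.empty (by omega), h2⟩, h3⟩
    · exact ⟨j, ⟨gap_iff.2 (Or.inr h1), h2⟩, h3⟩
theorem dw_upx {S : Set (Wd M × ℕ)} (hS : S ∈ Dw) :
    {x : Wd M × ℕ | ∃ j, Up (pq x.1) j x.2 ∧ (x.1, j) ∈ S} ∈ Dw := by
  obtain ⟨φ, h⟩ := hS
  refine ⟨.orf (.backU φ) (.chiPU φ), fun w i => ?_⟩
  simp only [Set.mem_ofPred_eq, POTL.Sat, h]
  constructor
  · rintro ⟨j, ⟨h1, h2⟩, h3⟩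
    rcases gap_iff.1 h1 with rfl | h1
    · exact Or.inl ⟨by omega, h2, h3⟩
    · exact Or.inr ⟨j, h1, h2, h3⟩
  · rintro (⟨h1, h2, h3⟩ | ⟨j, h1, h2, h3⟩)
    · exact ⟨i - 1, ⟨.empty (by omega), h2⟩, h3⟩
    · exact ⟨j, ⟨gap_iff.2 (Or.inr h1), h2⟩, h3⟩
theorem dw_gx {S : Set (Wd M × ℕ)} (hS : S ∈ Dw) :
    {x : Wd M × ℕ | ∃ j, Gap (pq x.1) x.2 j ∧ (x.1, j) ∈ S} ∈ Dw := by
  convert dw_bcl.or (dw_ex hS) (dw_ux hS) using 1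
  ext ⟨w, i⟩
  simp only [Set.mem_union, Set.mem_ofPred_eq]
  constructor
  · rintro ⟨j, h1, h2⟩
    rcases gap_cases (cmp_of w.2) h1 with h | h
    · exact Or.inl ⟨j, h, h2⟩
    · exact Or.inr ⟨j, h.up, h2⟩
  · rintro (⟨j, h1, h2⟩ | ⟨j, h1, h2⟩) <;> exact ⟨j, h1.1, h2⟩
theorem dw_gpx {S : Set (Wd M × ℕ)} (hS : S ∈ Dw) :
    {x : Wd M × ℕ | ∃ j, Gap (pq x.1) j x.2 ∧ (x.1, j) ∈ S} ∈ Dw := by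
  convert dw_bcl.or (dw_px hS) (dw_upx hS) using 1
  ext ⟨w, i⟩
  simp only [Set.mem_union, Set.mem_ofPred_eq]
  constructor
  · rintro ⟨j, h1, h2⟩
    rcases gap_cases (cmp_of w.2) h1 with h | h
    · exact Or.inl ⟨j, h, h2⟩
    · exact Or.inr ⟨j, h.up, h2⟩
  · rintro (⟨j, h1, h2⟩ | ⟨j, h1, h2⟩) <;> exact ⟨j, h1.1, h2⟩
theorem dw_zero : {x : Wd M × ℕ | x.2 = 0} ∈ Dw := by
  convert dw_bcl.neg (dw_gpx dw_bcl.tt) using 1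
  ext ⟨w, i⟩
  simp only [Set.mem_compl_iff, Set.mem_ofPred_eq, Set.mem_univ, and_true]
  constructor
  · rintro rfl ⟨j, h⟩
    exact absurd h.lt' (by omega)
  · intro h
    by_contra h0
    exact h ⟨i - 1, .empty (by omega)⟩
def ats (x : Wd M × ℕ) : Set AP := {a | x.2 ∈ x.1.1.P a}
variable [Fintype AP]
theorem dm_ats : DM (Dw (M := M)) ats := by
  classical
  intro A
  have h1 : ∀ a : AP, {x : Wd M × ℕ | x.2 ∈ x.1.1.P a} ∈ Dw := fun a =>
    ⟨.atom a, fun w i => Iff.rfl⟩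
  have h2 : ∀ a : AP, {x : Wd M × ℕ | ¬ (x.2 ∈ x.1.1.P a ↔ a ∈ A)} ∈ Dw := by
    intro a
    by_cases ha : a ∈ A
    · convert dw_bcl.neg (h1 a) using 1
      ext x; simp [ha]
    · convert h1 a using 1
      ext x; simp [ha]
  convert dw_bcl.neg (dw_bcl.iUn h2) using 1
  ext x
  simp only [ats, Set.mem_ofPred_eq, Set.mem_compl_iff, Set.mem_iUnion, not_exists, not_not]
  exact Set.ext_iff
theorem dm_lab : DM (Dw (M := M)) fun x => x.1.1.lab x.2 := by
  intro b
  cases b with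
  | none =>
    convert dw_zero (M := M) using 1
    ext ⟨w, i⟩
    simp [OPWordW.lab]
  | some A =>
    convert dw_bcl.and (dw_bcl.neg dw_zero) (dm_ats (M := M) A) using 1
    ext ⟨w, i⟩
    simp [OPWordW.lab, ats]
theorem dw_fx (π : Prec) {S : Set (Wd M × ℕ)} (hS : S ∈ Dw) :
    {x : Wd M × ℕ | ∃ j, (Gap (pq x.1) x.2 j ∧ pq x.1 x.2 j = some π) ∧ (x.1, j) ∈ S} ∈ Dw := by
  have h : ∀ p : {p : Option (Set AP) × Option (Set AP) // M p.1 p.2 = some π},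
      {x : Wd M × ℕ | x.1.1.lab x.2 = p.1.1} ∩ {x : Wd M × ℕ | ∃ j, Gap (pq x.1) x.2 j ∧ (x.1, j) ∈
        {x : Wd M × ℕ | x.1.1.lab x.2 = p.1.2} ∩ S} ∈ Dw := fun p =>
    dw_bcl.and (dm_lab p.1.1) (dw_gx (dw_bcl.and (dm_lab p.1.2) hS))
  convert dw_bcl.iUn h using 1
  ext ⟨w, i⟩
  simp only [Set.mem_ofPred_eq, Set.mem_iUnion, Set.mem_inter_iff]
  constructor
  · rintro ⟨j, ⟨h1, h2⟩, h3⟩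
    exact ⟨⟨(w.1.lab i, w.1.lab j), h2⟩, rfl, j, h1, rfl, h3⟩
  · rintro ⟨⟨⟨p, q⟩, hp⟩, h1, j, h2, h3, h4⟩
    refine ⟨j, ⟨h2, ?_⟩, h4⟩
    show M (w.1.lab i) (w.1.lab j) = _
    rw [h1, h3]; exact hp
theorem dw_bx (π : Prec) {S : Set (Wd M × ℕ)} (hS : S ∈ Dw) :
    {x : Wd M × ℕ | ∃ j, (Gap (pq x.1) j x.2 ∧ pq x.1 j x.2 = some π) ∧ (x.1, j) ∈ S} ∈ Dw := by
  have h : ∀ p : {p : Option (Set AP) × Option (Set AP) // M p.1 p.2 = some π},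
      {x : Wd M × ℕ | x.1.1.lab x.2 = p.1.2} ∩ {x : Wd M × ℕ | ∃ j, Gap (pq x.1) j x.2 ∧ (x.1, j) ∈
        {x : Wd M × ℕ | x.1.1.lab x.2 = p.1.1} ∩ S} ∈ Dw := fun p =>
    dw_bcl.and (dm_lab p.1.2) (dw_gpx (dw_bcl.and (dm_lab p.1.1) hS))
  convert dw_bcl.iUn h using 1
  ext ⟨w, i⟩
  simp only [Set.mem_ofPred_eq, Set.mem_iUnion, Set.mem_inter_iff]
  constructor
  · rintro ⟨j, ⟨h1, h2⟩, h3⟩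
    exact ⟨⟨(w.1.lab j, w.1.lab i), h2⟩, rfl, j, h1, rfl, h3⟩
  · rintro ⟨⟨⟨p, q⟩, hp⟩, h1, j, h2, h3, h4⟩
    refine ⟨j, ⟨h2, ?_⟩, h4⟩
    show M (w.1.lab j) (w.1.lab i) = _
    rw [h1, h3]; exact hp
theorem dw_hasEq : {x : Wd M × ℕ | hasEq (pq x.1) x.2} ∈ Dw := by
  convert dw_fx (M := M) Prec.eq dw_bcl.tt using 1
  ext ⟨w, i⟩
  simp [hasEq, PEq]
theorem dw_isE : {x : Wd M × ℕ | isE (pq x.1) x.2} ∈ Dw := by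
  convert dw_bx (M := M) Prec.eq dw_bcl.tt using 1
  ext ⟨w, i⟩
  simp [isE, PEq]
theorem dw_cps {S T : Set (Wd M × ℕ)} (hS : S ∈ Dw) (hT : T ∈ Dw) :
    {x : Wd M × ℕ | ∃ j, ReflTransGen (fun a b => Par (pq x.1) a b ∧ (x.1, b) ∈ S) j x.2 ∧
      (x.1, j) ∈ T} ∈ Dw := by
  obtain ⟨φ, h⟩ := hS
  obtain ⟨ψ, h'⟩ := hT
  exact ⟨.sinceD φ ψ, fun w i => by simp only [Set.mem_ofPred_eq, sat_sinceD, h, h']⟩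
theorem dw_cus {S T : Set (Wd M × ℕ)} (hS : S ∈ Dw) (hT : T ∈ Dw) :
    {x : Wd M × ℕ | ∃ j, ReflTransGen (fun a b => Par (pq x.1) a b ∧ (x.1, a) ∈ S) x.2 j ∧
      (x.1, j) ∈ T} ∈ Dw := by
  obtain ⟨φ, h⟩ := hS
  obtain ⟨ψ, h'⟩ := hT
  exact ⟨.untilD φ ψ, fun w i => by simp only [Set.mem_ofPred_eq, sat_untilD, h, h']⟩
theorem dw_ups {S T : Set (Wd M × ℕ)} (hS : S ∈ Dw) (hT : T ∈ Dw) :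
    {x : Wd M × ℕ | ∃ j, ReflTransGen (fun a b => Up (pq x.1) a b ∧ (x.1, b) ∈ S) j x.2 ∧
      (x.1, j) ∈ T} ∈ Dw := by
  obtain ⟨φ, h⟩ := hS
  obtain ⟨ψ, h'⟩ := hT
  exact ⟨.sinceU φ ψ, fun w i => by simp only [Set.mem_ofPred_eq, sat_sinceU, h, h']⟩
theorem dw_uus {S T : Set (Wd M × ℕ)} (hS : S ∈ Dw) (hT : T ∈ Dw) :
    {x : Wd M × ℕ | ∃ j, ReflTransGen (fun a b => Up (pq x.1) a b ∧ (x.1, a) ∈ S) x.2 j ∧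
      (x.1, j) ∈ T} ∈ Dw := by
  obtain ⟨φ, h⟩ := hS
  obtain ⟨ψ, h'⟩ := hT
  exact ⟨.untilU φ ψ, fun w i => by simp only [Set.mem_ofPred_eq, sat_untilU, h, h']⟩
theorem src_tgt (R : Wd M → ℕ → ℕ → Prop)
    (hex : ∀ {S : Set (Wd M × ℕ)}, S ∈ Dw → {x : Wd M × ℕ | ∃ j, R x.1 x.2 j ∧ (x.1, j) ∈ S} ∈ Dw)
    (hus : ∀ {S T : Set (Wd M × ℕ)}, S ∈ Dw → T ∈ Dw →
      {x : Wd M × ℕ | ∃ j, ReflTransGen (fun a b => R x.1 a b ∧ (x.1, a) ∈ S) x.2 j ∧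
      (x.1, j) ∈ T} ∈ Dw) {S T : Set (Wd M × ℕ)} (hS : S ∈ Dw) (hT : T ∈ Dw) :
    {x : Wd M × ℕ | ∃ j, ReflTransGen (fun a b => R x.1 a b ∧ (x.1, b) ∈ S) x.2 j ∧
      (x.1, j) ∈ T} ∈ Dw := by
  convert dw_bcl.or hT (hex (hus hS (dw_bcl.and hS hT))) using 1
  ext ⟨w, i⟩
  simp only [Set.mem_ofPred_eq, Set.mem_union, Set.mem_inter_iff]
  constructor
  · rintro ⟨j, h, h'⟩
    rcases (rtg_src (R := R w) (φ := fun a => (w, a) ∈ S)).1 h with rfl | ⟨q, h1, h2, h3⟩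
    · exact Or.inl h'
    · exact Or.inr ⟨q, h1, j, h2, h3, h'⟩
  · rintro (h | ⟨q, h1, j, h2, h3, h'⟩)
    · exact ⟨i, .refl, h⟩
    · exact ⟨j, (rtg_src (R := R w) (φ := fun a => (w, a) ∈ S)).2 (Or.inr ⟨q, h1, h2, h3⟩), h'⟩
theorem dw_ceu {S T : Set (Wd M × ℕ)} (hS : S ∈ Dw) (hT : T ∈ Dw) :
    {x : Wd M × ℕ | ∃ j, ReflTransGen (fun a b => Par (pq x.1) a b ∧ (x.1, b) ∈ S) x.2 j ∧
      (x.1, j) ∈ T} ∈ Dw :=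
  src_tgt (fun w => Par (pq w)) dw_ex dw_cus hS hT
theorem dw_endsEX {S : Set (Wd M × ℕ)} (hS : S ∈ Dw) :
    {x : Wd M × ℕ | ∃ j, Ends (pq x.1) x.2 j ∧ (x.1, j) ∈ S} ∈ Dw := by
  convert dw_ceu dw_isE (dw_fx Prec.gt hS) using 1
  ext ⟨w, i⟩
  simp only [Set.mem_ofPred_eq, ends_iff (cmp_of w.2), ← eqStar_iff]
  constructor
  · rintro ⟨j, ⟨t, h1, h2⟩, h3⟩; exact ⟨t, h1, j, h2, h3⟩
  · rintro ⟨t, h1, j, h2, h3⟩; exact ⟨j, ⟨t, h1, h2⟩, h3⟩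
theorem dw_endsPX {S : Set (Wd M × ℕ)} (hS : S ∈ Dw) :
    {x : Wd M × ℕ | ∃ j, Ends (pq x.1) j x.2 ∧ (x.1, j) ∈ S} ∈ Dw := by
  convert dw_bx Prec.gt (dw_cps dw_isE hS) using 1
  ext ⟨w, i⟩
  simp only [Set.mem_ofPred_eq, ends_iff (cmp_of w.2), ← eqStar_iff]
  constructor
  · rintro ⟨j, ⟨t, h1, h2⟩, h3⟩; exact ⟨t, h2, j, h1, h3⟩
  · rintro ⟨t, h1, j, h2, h3⟩; exact ⟨j, ⟨t, h2, h1⟩, h3⟩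
theorem dw_cX {S : Set (Wd M × ℕ)} (hS : S ∈ Dw) :
    {x : Wd M × ℕ | ∃ j, x.2 + 1 < j ∧ Par (pq x.1) x.2 j ∧ (x.1, j) ∈ S} ∈ Dw := by
  obtain ⟨φ, h⟩ := hS
  refine ⟨.chiFD φ, fun w i => ?_⟩
  simp only [Set.mem_ofPred_eq, POTL.Sat, h]
  refine exists_congr fun j => ?_
  constructor
  · rintro ⟨h1, h2, h3⟩
    exact ⟨chain_iff.2 ⟨h1, h2.1⟩, h2.2, h3⟩
  · rintro ⟨h1, h2, h3⟩
    have := chain_iff.1 h1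
    exact ⟨this.1, ⟨this.2, h2⟩, h3⟩
theorem dw_cP {S : Set (Wd M × ℕ)} (hS : S ∈ Dw) :
    {x : Wd M × ℕ | ∃ j, j + 1 < x.2 ∧ Par (pq x.1) j x.2 ∧ (x.1, j) ∈ S} ∈ Dw := by
  obtain ⟨φ, h⟩ := hS
  refine ⟨.chiPD φ, fun w i => ?_⟩
  simp only [Set.mem_ofPred_eq, POTL.Sat, h]
  refine exists_congr fun j => ?_
  constructor
  · rintro ⟨h1, h2, h3⟩
    exact ⟨chain_iff.2 ⟨h1, h2.1⟩, h2.2, h3⟩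
  · rintro ⟨h1, h2, h3⟩
    have := chain_iff.1 h1
    exact ⟨this.1, ⟨this.2, h2⟩, h3⟩
theorem dw_bD {S : Set (Wd M × ℕ)} (hS : S ∈ Dw) :
    {x : Wd M × ℕ | ∃ j, j + 1 = x.2 ∧ Par (pq x.1) j x.2 ∧ (x.1, j) ∈ S} ∈ Dw := by
  obtain ⟨φ, h⟩ := hS
  refine ⟨.backD φ, fun w i => ?_⟩
  simp only [Set.mem_ofPred_eq, POTL.Sat, h]
  constructor
  · rintro ⟨j, rfl, h2, h3⟩
    exact ⟨by omega, h2.2, h3⟩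
  · rintro ⟨h1, h2, h3⟩
    exact ⟨i - 1, by omega, ⟨.empty (by omega), h2⟩, h3⟩
theorem dw_hN : {x : Wd M × ℕ | ∃ p, p + 1 < x.2 ∧ PLt (pq x.1) p x.2 ∧
    ∃ j, x.2 < j ∧ PLt (pq x.1) p j} ∈ Dw := by
  refine ⟨.hnextU .tt, fun w i => ?_⟩
  simp only [Set.mem_ofPred_eq, POTL.Sat, and_true]
  refine exists_congr fun p => ?_
  constructor
  · rintro ⟨h1, h2, j, h3, h4⟩
    exact ⟨by omega, chain_iff.2 ⟨h1, h2.1⟩, h2.2, j, h3, chain_iff.2 ⟨by omega, h4.1⟩, h4.2⟩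
  · rintro ⟨_, h1, h2, j, h3, h4, h5⟩
    have := chain_iff.1 h1
    exact ⟨this.1, ⟨this.2, h2⟩, j, h3, (chain_iff.1 h4).2, h5⟩
theorem dw_hasN : {x : Wd M × ℕ | hasN (pq x.1) x.2} ∈ Dw := by
  have hr := dw_bcl.and (dw_bcl.neg (dw_px (M := M) dw_bcl.tt)) (dw_endsEX (M := M) dw_bcl.tt)
  have he := dw_bcl.and (dw_bcl.neg (dw_isE (M := M))) (dw_cP (dw_cX (M := M) dw_isE))
  have hb := dw_bD (dw_cX (M := M) dw_bcl.tt)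
  convert dw_bcl.or hr (dw_bcl.or (dw_hN (M := M)) (dw_bcl.or he hb)) using 1
  ext ⟨w, i⟩
  simp only [Set.mem_ofPred_eq, Set.mem_union, Set.mem_inter_iff, Set.mem_compl_iff, Set.mem_univ,
    and_true, hasN_iff, not_exists]
  refine or_congr Iff.rfl ?_
  constructor
  · rintro ⟨p, h1, j, h2, h3⟩
    have hlt := h1.lt'
    by_cases e : p + 1 = i
    · exact Or.inr (Or.inr ⟨p, e, h1, j, by omega, h3⟩)
    · rcases h1.cases with h4 | h4
      · rcases h3.cases with h5 | h5
        · exact Or.inl ⟨p, by omega, h4, j, h2, h5⟩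
        · refine Or.inr (Or.inl ⟨?_, p, by omega, h1, j, by omega, h3, p, h5⟩)
          rintro ⟨p', h6⟩
          have := par_unique _ _ _ h1 h6.par
          subst this
          have := peq_unique h5 h6
          omega
      · have := eq_last h4 j h3.1
        omega
  · rintro (⟨p, h1, h2, j, h3, h4⟩ | ⟨h0, p, h1, h2, j, h3, h4, q, h5⟩ | ⟨p, h1, h2, j, h3, h4⟩)
    · exact ⟨p, h2.par, j, h3, h4.par⟩
    · have := par_unique _ _ _ h4 h5.par
      subst this
      have h6 := eq_last h5 i h2.1
      have : i ≠ j := by rintro rfl; exact h0 ⟨p, h5⟩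
      exact ⟨p, h2, j, by omega, h4⟩
    · exact ⟨p, h2, j, by omega, h4⟩
theorem dw_nX {S : Set (Wd M × ℕ)} (hS : S ∈ Dw) :
    {x : Wd M × ℕ | ∃ j, Nx (pq x.1) x.2 j ∧ (x.1, j) ∈ S} ∈ Dw := by
  convert dw_bcl.and (dw_hasN (M := M)) (dw_endsEX hS) using 1
  ext ⟨w, i⟩
  simp only [Set.mem_ofPred_eq, Set.mem_inter_iff, nx_iff]
  constructor
  · rintro ⟨j, ⟨h1, h2⟩, h3⟩; exact ⟨h1, j, h2, h3⟩
  · rintro ⟨h1, j, h2, h3⟩; exact ⟨j, ⟨h1, h2⟩, h3⟩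
theorem dw_nP {S : Set (Wd M × ℕ)} (hS : S ∈ Dw) :
    {x : Wd M × ℕ | ∃ j, Nx (pq x.1) j x.2 ∧ (x.1, j) ∈ S} ∈ Dw := by
  convert dw_endsPX (dw_bcl.and (dw_hasN (M := M)) hS) using 1
  ext ⟨w, i⟩
  simp only [Set.mem_ofPred_eq, Set.mem_inter_iff, nx_iff]
  refine exists_congr fun j => ?_
  tauto
theorem dw_H2 : {x : Wd M × ℕ | H2 (pq x.1) x.2} ∈ Dw := by
  exact dw_nX (dw_bcl.neg (dw_isE (M := M)))
theorem dw_n'X {S : Set (Wd M × ℕ)} (hS : S ∈ Dw) :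
    {x : Wd M × ℕ | ∃ j, Nx' (pq x.1) x.2 j ∧ (x.1, j) ∈ S} ∈ Dw := by
  convert dw_nX (dw_bcl.and (dw_bcl.neg (dw_isE (M := M))) hS) using 1
  ext ⟨w, i⟩
  simp only [Set.mem_ofPred_eq, Set.mem_inter_iff, Set.mem_compl_iff, Nx', and_assoc]
theorem nx'_E {pr : ℕ → ℕ → Option Prec} {Q : ℕ → ℕ → Prop} {s y : ℕ} (hs : isE pr s)
    (h : ReflTransGen (fun a b => Nx' pr a b ∧ Q a b) s y) : s = y := by
  rcases ReflTransGen.cases_head h with h | ⟨q, h1, h2⟩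
  · exact h
  · exact absurd hs h1.1.1.not_isE
theorem dw_n'us {S T : Set (Wd M × ℕ)} (hS : S ∈ Dw) (hT : T ∈ Dw) :
    {x : Wd M × ℕ | ∃ j, ReflTransGen (fun a b => Nx' (pq x.1) a b ∧ (x.1, a) ∈ S) x.2 j ∧
      (x.1, j) ∈ T} ∈ Dw := by
  have hE := dw_isE (M := M)
  have hnE := dw_bcl.neg hE
  convert dw_bcl.or (dw_bcl.and hE hT) (dw_bcl.and hnE
    (dw_uus (dw_bcl.or hE (dw_bcl.and dw_H2 hS)) (dw_bcl.and hnE hT))) using 1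
  ext ⟨w, i⟩
  simp only [Set.mem_ofPred_eq, Set.mem_inter_iff, Set.mem_compl_iff, Set.mem_union]
  by_cases hi : isE (pq w) i
  · simp only [hi, true_and, not_true_eq_false, false_and, or_false]
    constructor
    · rintro ⟨j, h1, h2⟩
      rw [nx'_E hi h1]; exact h2
    · intro h; exact ⟨i, .refl, h⟩
  · simp only [hi, false_and, false_or, not_false_eq_true, true_and]
    refine exists_congr fun j => ?_
    have := core (cmp_of w.2) (α := fun a => (w, a) ∈ S) (β := fun _ => True) (y := j) hi
    simp only [or_true, and_true] at this
    rw [← this]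
    tauto
theorem dw_n'eu {S T : Set (Wd M × ℕ)} (hS : S ∈ Dw) (hT : T ∈ Dw) :
    {x : Wd M × ℕ | ∃ j, ReflTransGen (fun a b => Nx' (pq x.1) a b ∧ (x.1, b) ∈ S) x.2 j ∧
      (x.1, j) ∈ T} ∈ Dw :=
  src_tgt (fun w => Nx' (pq w)) dw_n'X dw_n'us hS hT
theorem nx_rtg {pr : ℕ → ℕ → Option Prec} {Q : ℕ → Prop} {s y : ℕ} :
    ReflTransGen (fun a b => Nx pr a b ∧ Q b) s y ↔
      s = y ∨ ∃ c, ReflTransGen (fun a b => Nx' pr a b ∧ Q b) s c ∧ Nx pr c y ∧ Q y := by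
  constructor
  · intro h
    induction h with
    | refl => exact Or.inl rfl
    | @tail b c _ h ih =>
      refine Or.inr ⟨b, ?_, h⟩
      rcases ih with rfl | ⟨d, h1, h2, h3⟩
      · exact .refl
      · exact h1.tail ⟨⟨h2, h.1.not_isE⟩, h3⟩
  · rintro (rfl | ⟨c, h1, h2⟩)
    · exact .refl
    · exact (ReflTransGen.mono (fun a b h => ⟨h.1.1, h.2⟩) _ _ h1).tail h2
theorem dw_neu {S T : Set (Wd M × ℕ)} (hS : S ∈ Dw) (hT : T ∈ Dw) :
    {x : Wd M × ℕ | ∃ j, ReflTransGen (fun a b => Nx (pq x.1) a b ∧ (x.1, b) ∈ S) x.2 j ∧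
      (x.1, j) ∈ T} ∈ Dw := by
  convert dw_bcl.or hT (dw_n'eu hS (dw_nX (dw_bcl.and hS hT))) using 1
  ext ⟨w, i⟩
  simp only [Set.mem_ofPred_eq, Set.mem_inter_iff, Set.mem_union]
  constructor
  · rintro ⟨j, h1, h2⟩
    rcases (nx_rtg (Q := fun b => (w, b) ∈ S)).1 h1 with rfl | ⟨c, h3, h4, h5⟩
    · exact Or.inl h2
    · exact Or.inr ⟨c, h3, j, h4, h5, h2⟩
  · rintro (h | ⟨c, h3, j, h4, h5, h2⟩)
    · exact ⟨i, .refl, h⟩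
    · exact ⟨j, (nx_rtg (Q := fun b => (w, b) ∈ S)).2 (Or.inr ⟨c, h3, h4, h5⟩), h2⟩
theorem since_core {pr : ℕ → ℕ → Option Prec} (hc : Cmp pr) {Q : ℕ → Prop} {r c : ℕ}
    (hE : ¬ isE pr c) (hH : H2 pr c) :
    ReflTransGen (fun a b => Nx' pr a b ∧ Q b) r c ↔
      ReflTransGen (fun a b => Up pr a b ∧ (isE pr b ∨ (Q b ∧ H2 pr b))) r c ∧
        H2 pr r ∧ ¬ isE pr r := by
  have step1 : ReflTransGen (fun a b => Nx' pr a b ∧ Q b) r c ↔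
      ReflTransGen (fun a b => Nx' pr a b ∧ True ∧ Q b ∧ H2 pr b) r c := by
    constructor
    · intro h
      clear hE
      induction h with
      | refl => exact .refl
      | tail _ h ih => exact (ih ⟨_, h.1⟩).tail ⟨h.1, trivial, h.2, hH⟩
    · exact fun h => ReflTransGen.mono (fun a b h => ⟨h.1, h.2.2.1⟩) _ _ h
  constructor
  · intro h
    have hr : H2 pr r ∧ ¬ isE pr r := by
      rcases ReflTransGen.cases_head h with rfl | ⟨q, h1, _⟩
      · exact ⟨hH, hE⟩
      · exact ⟨⟨q, h1.1⟩, h1.1.1.not_isE⟩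
    have := ((core hc (α := fun _ => True) (β := fun b => Q b ∧ H2 pr b) hr.2).2 (step1.1 h)).1
    exact ⟨ReflTransGen.mono (fun a b h => ⟨h.1, h.2.2⟩) _ _ this, hr⟩
  · rintro ⟨h, h1, h2⟩
    refine step1.2 ((core hc (α := fun _ => True) (β := fun b => Q b ∧ H2 pr b) h2).1 ⟨?_, hE⟩)
    clear hE hH step1
    have key : ReflTransGen (fun a b => Up pr a b ∧ (isE pr a ∨ (H2 pr a ∧ True)) ∧
        (isE pr b ∨ (Q b ∧ H2 pr b))) r c ∧ (isE pr c ∨ H2 pr c) := by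
      induction h with
      | refl => exact ⟨.refl, Or.inr h1⟩
      | tail _ h ih =>
        exact ⟨ih.1.tail ⟨h.1, ih.2.imp id fun x => ⟨x, trivial⟩, h.2⟩, h.2.imp id And.right⟩
    exact key.1
theorem dw_n'ps {S T : Set (Wd M × ℕ)} (hS : S ∈ Dw) (hT : T ∈ Dw) :
    {x : Wd M × ℕ | ∃ j, ReflTransGen (fun a b => Nx' (pq x.1) a b ∧ (x.1, b) ∈ S) j x.2 ∧
      (x.1, j) ∈ T} ∈ Dw := by
  have hE := dw_isE (M := M)
  have hnE := dw_bcl.neg hE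
  have hH := dw_H2 (M := M)
  convert dw_bcl.or hT (dw_bcl.and hnE (dw_bcl.and hS (dw_nP
    (dw_ups (dw_bcl.or hE (dw_bcl.and hS hH)) (dw_bcl.and hT (dw_bcl.and hH hnE)))))) using 1
  ext ⟨w, i⟩
  simp only [Set.mem_ofPred_eq, Set.mem_inter_iff, Set.mem_compl_iff, Set.mem_union]
  constructor
  · rintro ⟨j, h1, h2⟩
    rcases ReflTransGen.cases_tail h1 with rfl | ⟨c, h3, h4, h5⟩
    · exact Or.inl h2
    · have := (since_core (Q := fun b => (w, b) ∈ S) (cmp_of w.2) h4.1.not_isE ⟨i, h4⟩).1 h3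
      exact Or.inr ⟨h4.2, h5, c, h4.1, j, this.1, h2, this.2⟩
  · rintro (h | ⟨h4, h5, c, h6, j, h7, h8, h9⟩)
    · exact ⟨i, .refl, h⟩
    · have := (since_core (Q := fun b => (w, b) ∈ S) (cmp_of w.2) h6.not_isE ⟨i, h6, h4⟩).2 ⟨h7, h9⟩
      exact ⟨j, this.tail ⟨⟨h6, h4⟩, h5⟩, h8⟩
theorem dw_nps {S T : Set (Wd M × ℕ)} (hS : S ∈ Dw) (hT : T ∈ Dw) :
    {x : Wd M × ℕ | ∃ j, ReflTransGen (fun a b => Nx (pq x.1) a b ∧ (x.1, b) ∈ S) j x.2 ∧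
      (x.1, j) ∈ T} ∈ Dw := by
  convert dw_bcl.or hT (dw_bcl.and hS (dw_nP (dw_n'ps hS hT))) using 1
  ext ⟨w, i⟩
  simp only [Set.mem_ofPred_eq, Set.mem_inter_iff, Set.mem_union]
  constructor
  · rintro ⟨j, h1, h2⟩
    rcases (nx_rtg (Q := fun b => (w, b) ∈ S)).1 h1 with rfl | ⟨c, h3, h4, h5⟩
    · exact Or.inl h2
    · exact Or.inr ⟨h5, c, h4, j, h3, h2⟩
  · rintro (h | ⟨h5, c, h4, j, h3, h2⟩)
    · exact ⟨i, .refl, h⟩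
    · exact ⟨j, (nx_rtg (Q := fun b => (w, b) ∈ S)).2 (Or.inr ⟨c, h3, h4, h5⟩), h2⟩
theorem rtg_pair {Ω : Type} {R : Ω → ℕ → ℕ → Prop} {φ : Set (Ω × ℕ)} {x y : Ω × ℕ} :
    ReflTransGen (fun p q => (p.1 = q.1 ∧ R p.1 p.2 q.2) ∧ q ∈ φ) x y ↔
      x.1 = y.1 ∧ ReflTransGen (fun a b => R x.1 a b ∧ (x.1, b) ∈ φ) x.2 y.2 := by
  constructor
  · intro h
    induction h with
    | refl => exact ⟨rfl, .refl⟩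
    | @tail b c _ h ih =>
      obtain ⟨w, i⟩ := x
      obtain ⟨w', b⟩ := b
      obtain ⟨w'', c⟩ := c
      obtain ⟨h1, h2⟩ := ih
      obtain ⟨⟨h3, h4⟩, h5⟩ := h
      simp only at h1 h3
      subst h1 h3
      exact ⟨rfl, h2.tail ⟨h4, h5⟩⟩
  · obtain ⟨w, i⟩ := x
    obtain ⟨w', j⟩ := y
    rintro ⟨h1, h⟩
    simp only at h1 h
    subst h1
    induction h with
    | refl => exact .refl
    | tail _ h ih => exact ih.tail ⟨⟨rfl, h.1⟩, h.2⟩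
theorem FC.of (R : Wd M → ℕ → ℕ → Prop)
    (h1 : ∀ {S : Set (Wd M × ℕ)}, S ∈ Dw → {x : Wd M × ℕ | ∃ j, R x.1 x.2 j ∧ (x.1, j) ∈ S} ∈ Dw)
    (h2 : ∀ {S : Set (Wd M × ℕ)}, S ∈ Dw → {x : Wd M × ℕ | ∃ j, R x.1 j x.2 ∧ (x.1, j) ∈ S} ∈ Dw)
    (h3 : ∀ {S T : Set (Wd M × ℕ)}, S ∈ Dw → T ∈ Dw →
      {x : Wd M × ℕ | ∃ j, ReflTransGen (fun a b => R x.1 a b ∧ (x.1, b) ∈ S) x.2 j ∧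
      (x.1, j) ∈ T} ∈ Dw)
    (h4 : ∀ {S T : Set (Wd M × ℕ)}, S ∈ Dw → T ∈ Dw →
      {x : Wd M × ℕ | ∃ j, ReflTransGen (fun a b => R x.1 a b ∧ (x.1, b) ∈ S) j x.2 ∧
      (x.1, j) ∈ T} ∈ Dw)
    (h5 : ∀ w p p' q, R w p q → R w p' q → p = p') :
    FC (Dw (M := M)) (fun x y => x.1 = y.1 ∧ R x.1 x.2 y.2) where
  toBCl := dw_bcl
  ex := by
    intro ψ h
    convert h1 h using 1
    ext ⟨w, i⟩
    constructor
    · rintro ⟨⟨w', j⟩, ⟨e, h⟩, h'⟩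
      simp only at e; subst e
      exact ⟨j, h, h'⟩
    · rintro ⟨j, h, h'⟩
      exact ⟨(w, j), ⟨rfl, h⟩, h'⟩
  px := by
    intro ψ h
    convert h2 h using 1
    ext ⟨w, i⟩
    constructor
    · rintro ⟨⟨w', j⟩, ⟨e, h⟩, h'⟩
      simp only at e; subst e
      exact ⟨j, h, h'⟩
    · rintro ⟨j, h, h'⟩
      exact ⟨(w, j), ⟨rfl, h⟩, h'⟩
  eu := by
    intro φ ψ h h'
    convert h3 h h' using 1
    ext ⟨w, i⟩
    constructor
    · rintro ⟨⟨w', j⟩, h, h'⟩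
      obtain ⟨e, h⟩ := rtg_pair.1 h
      simp only at e; subst e
      exact ⟨j, h, h'⟩
    · rintro ⟨j, h, h'⟩
      exact ⟨(w, j), rtg_pair.2 ⟨rfl, h⟩, h'⟩
  ps := by
    intro φ ψ h h'
    convert h4 h h' using 1
    ext ⟨w, i⟩
    constructor
    · rintro ⟨⟨w', j⟩, h, h'⟩
      obtain ⟨e, h⟩ := rtg_pair.1 h
      simp only at e; subst e
      exact ⟨j, h, h'⟩
    · rintro ⟨j, h, h'⟩
      exact ⟨(w, j), rtg_pair.2 ⟨rfl, h⟩, h'⟩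
  up := by
    rintro ⟨w, p⟩ ⟨w', p'⟩ ⟨w'', q⟩ ⟨e, h⟩ ⟨e', h'⟩
    simp only at e e'; subst e; subst e'
    exact Prod.ext rfl (h5 _ _ _ _ h h')
def wF (w : Wd M) : Fst (Set AP × Prop) := descF (pq w) fun i => (ats (w, i), hasEq (pq w) i)
theorem hyp_words : Hyp (Dw (M := M)) wF where
  c := by
    have := FC.of (M := M) (fun w => Par (pq w)) dw_ex dw_px dw_ceu dw_cps
      (fun w p p' q h h' => par_unique _ _ _ h h')
    convert this using 1
    ext x y
    exact and_congr Iff.rfl cov_iff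
  s := FC.of (M := M) (fun w => Nx (pq w)) dw_nX dw_nP dw_neu dw_nps
      (fun w p p' q h h' => nx_unique h h')
  l := by
    refine DM.pair dw_bcl dm_ats ?_
    intro b
    by_cases hb : b
    · convert dw_hasEq (M := M) using 1
      ext x; simp [hb]
    · convert dw_bcl.neg (dw_hasEq (M := M)) using 1
      ext x; simp [hb]
end Words
end OPLTheory
end
noncomputable section
namespace OPLTheory
set_option linter.unusedSectionVars false
section FoToPotl
open Relation
theorem code_inv {Λ : Type} {W W' : Fst Λ} {i j i' j' : ℕ} (h : W.code i j = W'.code i' j') :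
    (i = j ↔ i' = j') ∧ (W.D i j ↔ W'.D i' j') ∧ (i < j ↔ i' < j') := by
  have key : ∀ (V : Fst Λ) (a b : ℕ), (a = b ↔ V.code a b = .eq) ∧ (V.D a b ↔ V.code a b = .anc) ∧
      (a < b ↔ V.code a b = .anc ∨ V.code a b = .lf) := by
    intro V a b
    rcases Nat.lt_trichotomy a b with h | h | h
    · have h1 : ¬ a = b := by omega
      by_cases h2 : V.D a b
      · rw [Fst.code_anc h2]; simp [h, h1, h2]
      · rw [Fst.code_lf h h2]; simp [h, h1, h2]
    · subst h
      have h2 : ¬ V.D a a := fun h => absurd (V.lt h) (by omega)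
      simp [Fst.code, h2]
    · have h1 : ¬ a = b := by omega
      have h3 : ¬ a < b := by omega
      have h4 : ¬ V.D a b := fun h => absurd (V.lt h) (by omega)
      by_cases h2 : V.D b a
      · have : V.code a b = .dsc := by simp [Fst.code, h1, h2, h4]
        rw [this]; simp [h1, h3, h4]
      · rw [Fst.code_rt h h2]; simp [h1, h3, h4]
  obtain ⟨a1, a2, a3⟩ := key W i j
  obtain ⟨b1, b2, b3⟩ := key W' i' j'
  rw [a1, a2, a3, b1, b2, b3, h]
  exact ⟨Iff.rfl, Iff.rfl, Iff.rfl⟩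
variable {AP : Type} {M : OPM (Set AP)}
theorem chi_char (w : Wd M) {i j : ℕ} : w.1.chi M i j ↔
    (∃ z, i < z ∧ z < j) ∧ ((Desc (pq w) i j ∧ ∀ z, Desc (pq w) i z → ¬ Desc (pq w) z j) ∨
      (i < j ∧ ¬ Desc (pq w) i j ∧ ¬ hasEq (pq w) i ∧ ∀ z, i < z → z < j → Desc (pq w) i z)) := by
  have h0 : w.1.chi M i j ↔ i + 1 < j ∧ Gap (pq w) i j := chain_iff
  have hz : (∃ z, i < z ∧ z < j) ↔ i + 1 < j :=
    ⟨fun ⟨z, h1, h2⟩ => by omega, fun h => ⟨i + 1, by omega, h⟩⟩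
  rw [h0, hz]
  refine and_congr Iff.rfl ?_
  constructor
  · intro h
    rcases gap_cases (cmp_of w.2) h with h | h
    · exact Or.inl ((cov_iff (lam := fun _ => ())).2 h)
    · have := h.ends
      exact Or.inr ⟨this.1, this.2.2, h.not_hasEq, this.2.1⟩
  · rintro (h | ⟨h1, h2, h3, h4⟩)
    · exact ((cov_iff (lam := fun _ => ())).1 h).1
    · exact ((pop_iff (cmp_of w.2)).2 ⟨⟨h1, h4, h2⟩, h3⟩).1
theorem chi_mono (w w' : Wd M) {i j i' j' : ℕ} (hij : (wF w).code i j = (wF w').code i' j')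
    (hE : hasEq (pq w) i ↔ hasEq (pq w') i')
    (hf : ∀ z, ∃ z', (wF w).code i z = (wF w').code i' z' ∧ (wF w).code z j = (wF w').code z' j')
    (hb : ∀ z', ∃ z, (wF w).code i z = (wF w').code i' z' ∧ (wF w).code z j = (wF w').code z' j')
    (h : w.1.chi M i j) : w'.1.chi M i' j' := by
  rw [chi_char] at h ⊢
  obtain ⟨⟨z, h1, h2⟩, h⟩ := h
  obtain ⟨_, hd, hl⟩ := code_inv hij
  have hd : Desc (pq w) i j ↔ Desc (pq w') i' j' := hd
  refine ⟨?_, ?_⟩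
  · obtain ⟨z', e1, e2⟩ := hf z
    exact ⟨z', (code_inv e1).2.2.1 h1, (code_inv e2).2.2.1 h2⟩
  · rcases h with ⟨h3, h4⟩ | ⟨h3, h4, h5, h6⟩
    · refine Or.inl ⟨hd.1 h3, fun z' h5 h6 => ?_⟩
      obtain ⟨z, e1, e2⟩ := hb z'
      exact h4 z ((code_inv e1).2.1.2 h5) ((code_inv e2).2.1.2 h6)
    · refine Or.inr ⟨hl.1 h3, fun h => h4 (hd.2 h), fun h => h5 (hE.2 h), fun z' h7 h8 => ?_⟩
      obtain ⟨z, e1, e2⟩ := hb z'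
      exact (code_inv e1).2.1.1 (h6 z ((code_inv e1).2.2.2 h7) ((code_inv e2).2.2.2 h8))
abbrev wS (w : Wd M) := (wF w).FF Set.univ
def el (w : Wd M) (i : ℕ) : (wS w).D := ⟨i, trivial⟩
theorem EF0.code {w w' : Wd M} {l : List ((wS w).D × (wS w').D)} (h : EF0 (wS w) (wS w') l)
    {i j i' j' : ℕ} (hi : (el w i, el w' i') ∈ l) (hj : (el w j, el w' j') ∈ l) :
    (wF w).code i j = (wF w').code i' j' := (h _ hi).2 _ hj
theorem EF0.lam {w w' : Wd M} {l : List ((wS w).D × (wS w').D)} (h : EF0 (wS w) (wS w') l)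
    {i i' : ℕ} (hi : (el w i, el w' i') ∈ l) :
    ats (w, i) = ats (w', i') ∧ (hasEq (pq w) i ↔ hasEq (pq w') i') := by
  have := (h _ hi).1
  have h1 : ((ats (w, i), hasEq (pq w) i), Code.lf) = ((ats (w', i'), hasEq (pq w') i'), Code.lf) :=
    this
  simp only [Prod.mk.injEq, and_true] at h1
  exact ⟨h1.1, by rw [h1.2]⟩
theorem chi_inv {w w' : Wd M} {l : List ((wS w).D × (wS w').D)} {k : ℕ}
    (h : EF (k + 1) (wS w) (wS w') l)
    {i j i' j' : ℕ} (hi : (el w i, el w' i') ∈ l) (hj : (el w j, el w' j') ∈ l) :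
    w.1.chi M i j ↔ w'.1.chi M i' j' := by
  have h0 := h.zero
  have hf : ∀ z, ∃ z', (wF w).code i z = (wF w').code i' z' ∧
      (wF w).code z j = (wF w').code z' j' := by
    intro z
    obtain ⟨⟨z', hz'⟩, h1⟩ := h.2.1 (el w z)
    have h2 := h1.zero
    exact ⟨z', h2.code (List.mem_cons_of_mem _ hi) List.mem_cons_self,
      h2.code List.mem_cons_self (List.mem_cons_of_mem _ hj)⟩
  have hb : ∀ z', ∃ z, (wF w).code i z = (wF w').code i' z' ∧
      (wF w).code z j = (wF w').code z' j' := by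
    intro z'
    obtain ⟨⟨z, hz⟩, h1⟩ := h.2.2 (el w' z')
    have h2 := h1.zero
    exact ⟨z, h2.code (List.mem_cons_of_mem _ hi) List.mem_cons_self,
      h2.code List.mem_cons_self (List.mem_cons_of_mem _ hj)⟩
  constructor
  · exact chi_mono w w' (h0.code hi hj) (h0.lam hi).2 hf hb
  · refine chi_mono w' w (h0.code hi hj).symm (h0.lam hi).2.symm (fun z => ?_) (fun z => ?_)
    · obtain ⟨z', a, b⟩ := hb z
      exact ⟨z', a.symm, b.symm⟩
    · obtain ⟨z', a, b⟩ := hf z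
      exact ⟨z', a.symm, b.symm⟩
theorem realize_inv (ν : FOV OPRel AP ℕ) : ∀ (k : ℕ), ν.qr ≤ k → ∀ (w w' : Wd M)
    (l : List ((wS w).D × (wS w').D)) (v v' : ℕ → ℕ),
    (∀ x ∈ ν.free, (el w (v x), el w' (v' x)) ∈ l) → EF (k + 1) (wS w) (wS w') l →
    (ν.Realize (wordRelIW M w.1) (wordUnIW w.1) v ↔
      ν.Realize (wordRelIW M w'.1) (wordUnIW w'.1) v') := by
  induction ν with
  | fal => intros; exact Iff.rfl
  | rel r x y =>
    intro k _ w w' l v v' hv h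
    have hx := hv x (by simp [FOV.free])
    have hy := hv y (by simp [FOV.free])
    cases r with
    | ord => exact (code_inv (h.zero.code hx hy)).2.2
    | chain => exact chi_inv h hx hy
  | un u x =>
    intro k _ w w' l v v' hv h
    have hx := hv x (by simp [FOV.free])
    exact Set.ext_iff.1 (h.zero.lam hx).1 u
  | eqv x y =>
    intro k _ w w' l v v' hv h
    have hx := hv x (by simp [FOV.free])
    have hy := hv y (by simp [FOV.free])
    exact (code_inv (h.zero.code hx hy)).1
  | imp f g ihf ihg =>
    intro k hk w w' l v v' hv h
    simp only [FOV.qr, max_le_iff] at hk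
    exact imp_congr (ihf k hk.1 w w' l v v' (fun x hx => hv x (Or.inl hx)) h)
      (ihg k hk.2 w w' l v v' (fun x hx => hv x (Or.inr hx)) h)
  | all x f ih =>
    intro k hk w w' l v v' hv h
    cases k with
    | zero => simp [FOV.qr] at hk
    | succ k =>
    have hk : f.qr ≤ k := by simpa [FOV.qr] using hk
    have key : ∀ d d', EF (k + 1) (wS w) (wS w') ((el w d, el w' d') :: l) →
        (f.Realize (wordRelIW M w.1) (wordUnIW w.1) (Function.update v x d) ↔
        f.Realize (wordRelIW M w'.1) (wordUnIW w'.1) (Function.update v' x d')) := by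
      intro d d' h1
      refine ih k hk w w' _ _ _ (fun y hy => ?_) h1
      by_cases e : y = x
      · subst e; simp
      · simp only [Function.update_of_ne e]
        exact List.mem_cons_of_mem _ (hv y ⟨hy, e⟩)
    constructor
    · intro hr d'
      obtain ⟨⟨d, _⟩, h1⟩ := h.2.2 (el w' d')
      exact (key d d' h1).1 (hr d)
    · intro hr d
      obtain ⟨⟨d', _⟩, h1⟩ := h.2.1 (el w d)
      exact (key d d' h1).2 (hr d')
theorem fo_to_potl [Fintype AP] (M : OPM (Set AP)) (ν : FOV OPRel AP ℕ)
    (hν : ν.free ⊆ {0}) : ∃ φ : POTL AP, ∀ w : OPWordW AP, w.Compatible M → ∀ i : ℕ,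
      (ν.Realize (wordRelIW M w) (wordUnIW w) (fun _ => i) ↔ POTL.Sat (w.frame M) φ i) := by
  obtain ⟨φ, h⟩ := invariant_mem (hyp_words (M := M)) (ν.qr + 1)
    (fun x => ν.Realize (wordRelIW M x.1.1) (wordUnIW x.1.1) (fun _ => x.2))
    (fun x y h => realize_inv ν ν.qr le_rfl x.1 y.1 _ _ _ (fun z hz => List.mem_singleton.2 rfl) h)
  exact ⟨φ, fun w hw i => h ⟨w, hw⟩ i⟩
end FoToPotl
end OPLTheory
end
noncomputable section
namespace OPLTheory
set_option linter.unusedSectionVars false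
section Lin
open Relation
theorem fwd_src {R : ℕ → ℕ → Prop} (hd : ∀ x y y', R x y → R x y' → y = y')
    (hl : ∀ x y, R x y → x < y) {φ : ℕ → Prop} {x y : ℕ} :
    ReflTransGen (fun a b => R a b ∧ φ a) x y ↔ ReflTransGen R x y ∧
      ∀ z, ReflTransGen R x z → ReflTransGen R z y → z ≠ y → φ z := by
  constructor
  · intro h
    induction h using ReflTransGen.head_induction_on with
    | refl =>
      refine ⟨.refl, fun z h1 h2 h3 => ?_⟩
      rcases ReflTransGen.cases_head h1 with e | ⟨q, hq, h4⟩
      · exact absurd e.symm h3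
      · have key : ∀ {a b : ℕ}, ReflTransGen R a b → a ≤ b := by
          intro a b h
          induction h with
          | refl => exact le_rfl
          | tail _ h ih => exact ih.trans (hl _ _ h).le
        have := key h2; have := key h4; have := hl _ _ hq
        omega
    | head h _ ih =>
      refine ⟨ReflTransGen.head h.1 ih.1, fun z h1 h2 h3 => ?_⟩
      rcases ReflTransGen.cases_head h1 with e | ⟨q, hq, h4⟩
      · rw [← e]; exact h.2
      · rw [hd _ _ _ hq h.1] at h4
        exact ih.2 z h4 h2 h3
  · rintro ⟨h, h'⟩
    induction h using ReflTransGen.head_induction_on with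
    | refl => exact .refl
    | @head a c h h1 ih =>
      have key : ∀ {a b : ℕ}, ReflTransGen R a b → a ≤ b := by
        intro a b h
        induction h with
        | refl => exact le_rfl
        | tail _ h ih => exact ih.trans (hl _ _ h).le
      refine ReflTransGen.head ⟨h, h' a .refl (ReflTransGen.head h h1) ?_⟩
        (ih fun z h2 h3 h4 => h' z (ReflTransGen.head h h2) h3 h4)
      have := hl _ _ h; have := key h1
      omega
theorem fwd_tgt {R : ℕ → ℕ → Prop} (hd : ∀ x y y', R x y → R x y' → y = y')
    (hl : ∀ x y, R x y → x < y) {φ : ℕ → Prop} {x y : ℕ} :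
    ReflTransGen (fun a b => R a b ∧ φ b) x y ↔ ReflTransGen R x y ∧
      ∀ z, ReflTransGen R x z → ReflTransGen R z y → z ≠ x → φ z := by
  have key : ∀ {a b : ℕ}, ReflTransGen R a b → a ≤ b := by
    intro a b h
    induction h with
    | refl => exact le_rfl
    | tail _ h ih => exact ih.trans (hl _ _ h).le
  constructor
  · intro h
    induction h using ReflTransGen.head_induction_on with
    | refl =>
      refine ⟨.refl, fun z h1 h2 h3 => ?_⟩
      have := key h1; have := key h2
      omega
    | @head a c h h0 ih =>
      refine ⟨ReflTransGen.head h.1 ih.1, fun z h1 h2 h3 => ?_⟩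
      rcases ReflTransGen.cases_head h1 with e | ⟨q, hq, h4⟩
      · exact absurd e.symm h3
      · rw [hd _ _ _ hq h.1] at h4
        by_cases e : z = c
        · rw [e]; exact h.2
        · exact ih.2 z h4 h2 e
  · rintro ⟨h, h'⟩
    induction h using ReflTransGen.head_induction_on with
    | refl => exact .refl
    | @head a c h h1 ih =>
      have hac := hl _ _ h
      refine ReflTransGen.head ⟨h, h' c (.single h) h1 (by omega)⟩
        (ih fun z h2 h3 h4 => h' z (ReflTransGen.head h h2) h3 ?_)
      have := key h2
      omega
theorem bwd_src {R : ℕ → ℕ → Prop} (hd : ∀ x x' y, R x y → R x' y → x = x')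
    (hl : ∀ x y, R x y → x < y) {φ : ℕ → Prop} {x y : ℕ} :
    ReflTransGen (fun a b => R a b ∧ φ a) x y ↔ ReflTransGen R x y ∧
      ∀ z, ReflTransGen R x z → ReflTransGen R z y → z ≠ y → φ z := by
  have key : ∀ {a b : ℕ}, ReflTransGen R a b → a ≤ b := by
    intro a b h
    induction h with
    | refl => exact le_rfl
    | tail _ h ih => exact ih.trans (hl _ _ h).le
  constructor
  · intro h
    induction h with
    | refl =>
      refine ⟨.refl, fun z h1 h2 h3 => ?_⟩
      have := key h1; have := key h2
      omega
    | @tail b c h0 h ih =>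
      refine ⟨ih.1.tail h.1, fun z h1 h2 h3 => ?_⟩
      rcases ReflTransGen.cases_tail h2 with e | ⟨q, h4, hq⟩
      · exact absurd e.symm h3
      · rw [hd _ _ _ hq h.1] at h4
        by_cases e : z = b
        · rw [e]; exact h.2
        · exact ih.2 z h1 h4 e
  · rintro ⟨h, h'⟩
    induction h with
    | refl => exact .refl
    | @tail b c h1 h ih =>
      have hac := hl _ _ h
      refine (ih fun z h2 h3 h4 => h' z h2 (h3.tail h) ?_).tail
        ⟨h, h' b h1 (.single h) (by omega)⟩
      have := key h3
      omega
theorem bwd_tgt {R : ℕ → ℕ → Prop} (hd : ∀ x x' y, R x y → R x' y → x = x')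
    (hl : ∀ x y, R x y → x < y) {φ : ℕ → Prop} {x y : ℕ} :
    ReflTransGen (fun a b => R a b ∧ φ b) x y ↔ ReflTransGen R x y ∧
      ∀ z, ReflTransGen R x z → ReflTransGen R z y → z ≠ x → φ z := by
  have key : ∀ {a b : ℕ}, ReflTransGen R a b → a ≤ b := by
    intro a b h
    induction h with
    | refl => exact le_rfl
    | tail _ h ih => exact ih.trans (hl _ _ h).le
  constructor
  · intro h
    induction h with
    | refl =>
      refine ⟨.refl, fun z h1 h2 h3 => ?_⟩
      have := key h1; have := key h2
      omega
    | @tail b c h0 h ih =>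
      refine ⟨ih.1.tail h.1, fun z h1 h2 h3 => ?_⟩
      rcases ReflTransGen.cases_tail h2 with e | ⟨q, h4, hq⟩
      · rw [← e]; exact h.2
      · rw [hd _ _ _ hq h.1] at h4
        exact ih.2 z h1 h4 h3
  · rintro ⟨h, h'⟩
    induction h with
    | refl => exact .refl
    | @tail b c h1 h ih =>
      have hac := hl _ _ h
      have := key h1
      exact (ih fun z h2 h3 h4 => h' z h2 (h3.tail h) h4).tail
        ⟨h, h' c (h1.tail h) .refl (by omega)⟩
variable {pr : ℕ → ℕ → Option Prec}
theorem desc_char {x y : ℕ} : ReflTransGen (Par pr) x y ↔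
    x = y ∨ (x < y ∧ ∀ z, x < z → ¬ y < z → ∃ p, ¬ p < x ∧ Par pr p z) := by
  constructor
  · intro h
    rcases reflTransGen_iff_eq_or_transGen.1 h with e | h
    · exact Or.inl e.symm
    · have h : Desc pr x y := h
      refine Or.inr ⟨h.lt', fun z h1 h2 => ?_⟩
      have hz : Desc pr x z := by
        rcases Nat.lt_or_ge z y with h3 | h3
        · exact h.convex h1 h3
        · have : z = y := by omega
          rw [this]; exact h
      obtain ⟨p, hp, e⟩ := hz.parent
      refine ⟨p, ?_, hp⟩
      rcases e with rfl | e
      · omega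
      · have := e.lt'; omega
  · rintro (rfl | ⟨h1, h2⟩)
    · exact .refl
    · have key : ∀ z, x ≤ z → z ≤ y → ReflTransGen (Par pr) x z := by
        intro z
        induction z using Nat.strong_induction_on with
        | _ z ih =>
          intro h3 h4
          rcases Nat.lt_or_ge x z with h5 | h5
          · obtain ⟨p, hp, hp'⟩ := h2 z h5 (by omega)
            have := hp'.lt'
            exact (ih p this (by omega) (by omega)).tail hp'
          · have : x = z := by omega
            rw [this]
      exact key y h1.le le_rfl
theorem up_char (hc : Cmp pr) {x y : ℕ} : ReflTransGen (Up pr) x y ↔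
    ¬ y < x ∧ ∀ b, ReflTransGen (Par pr) b y → ∀ a, PLt pr a b → a < x := by
  constructor
  · intro h
    refine ⟨by have := up_le h; omega, ?_⟩
    induction h using ReflTransGen.head_induction_on with
    | refl =>
      intro b hb a ha
      have := par_le hb; have := ha.par.lt'; omega
    | @head x q h h' ih =>
      intro b hb a ha
      by_contra hax
      have haq := ih b hb a ha
      have hqy := up_le h'
      have hab := ha.par.lt'
      have hxq := h.lt'
      have hbq : b < q → Desc pr b q := by
        intro hlt
        rcases reflTransGen_iff_eq_or_transGen.1 hb with e | e
        · omega
        · rcases Nat.lt_or_ge q y with h3 | h3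
          · exact Desc.convex e hlt h3
          · have : q = y := by omega
            rw [this]; exact e
      have hxa : x = a ∨ Desc pr x a := by
        rcases Nat.lt_or_ge x a with h1 | h1
        · exact Or.inr (h.1.desc a h1 haq)
        · exact Or.inl (by omega)
      have hxb : Desc pr x b := by
        rcases hxa with rfl | h1
        · exact TransGen.single ha.par
        · exact TransGen.tail h1 ha.par
      rcases h.cases with h1 | h1
      · have hn := h1.not_desc
        rcases Nat.lt_trichotomy b q with h2 | h2 | h2
        · exact hn (hxb.trans' (hbq h2))
        · rw [h2] at hxb; exact hn hxb
        · exact hn (hxb.convex hxq h2)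
      · rcases Nat.lt_trichotomy b q with h2 | h2 | h2
        · exact par_no_between h1.par hxb (hbq h2)
        · subst h2
          have := par_unique _ _ _ h1.par ha.par
          subst this
          have h3 := h1.2; rw [ha.2] at h3; simp at h3
        · rcases hxa with rfl | h3
          · have := eq_last h1 b ha.1
            omega
          · exact par_no_between h1.par h3 (Desc.convex (TransGen.single ha.par) haq h2)
  · rintro ⟨h0, h⟩
    induction hn : y - x using Nat.strong_induction_on generalizing x with
    | _ n ih =>
    rcases Nat.lt_or_ge x y with hxy | hxy
    · have key : ∃ q, Up pr x q ∧ q ≤ y := by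
        by_cases hD : Desc pr x y
        · obtain ⟨c, h1, h2⟩ := TransGen.head'_iff.1 hD
          rcases h1.cases with h3 | h3
          · exact absurd (h c h2 x h3) (by omega)
          · exact ⟨c, h3.up, par_le h2⟩
        · classical
          have hex : ∃ e, x < e ∧ ¬ Desc pr x e := ⟨y, hxy, hD⟩
          obtain ⟨h1, h2⟩ := Nat.find_spec hex
          have h3 : Nat.find hex ≤ y := Nat.find_min' hex ⟨hxy, hD⟩
          have h4 : ∀ z, x < z → z < Nat.find hex → Desc pr x z := by
            intro z hz hz'
            by_contra hcon
            exact Nat.find_min hex hz' ⟨hz, hcon⟩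
          by_cases he : hasEq pr x
          · obtain ⟨k, hk⟩ := he
            refine ⟨k, hk.up, ?_⟩
            by_contra hky
            exact h2 (Desc.convex (TransGen.single hk.par) h1 (by omega))
          · exact ⟨_, (Ends.pop hc ⟨h1, h4, h2⟩ he).up, h3⟩
      obtain ⟨q, h1, h2⟩ := key
      have := h1.lt'
      exact ReflTransGen.head h1 (ih (y - q) (by omega) (by omega)
        (fun b hb a ha => (h b hb a ha).trans this) rfl)
    · have : x = y := by omega
      rw [this]
variable {E C : ℕ → ℕ → Prop}
def SH (E : ℕ → ℕ → Prop) (x y : ℕ) : Prop := ∃ h, E h x ∧ E h y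
theorem hnext_char (hu : ∀ h h' x, E h x → E h' x → h = h') {φ : ℕ → Prop} {i : ℕ} :
    (∃ h, E h i ∧ (∃ k, i < k ∧ E h k) ∧ φ (sInf {k | i < k ∧ E h k})) ↔
      ∃ j, i < j ∧ SH E i j ∧ (∀ z, i < z → z < j → ¬ SH E i z) ∧ φ j := by
  constructor
  · rintro ⟨h, h1, h2, h3⟩
    have hm := Nat.sInf_mem (s := {k | i < k ∧ E h k}) h2
    refine ⟨_, hm.1, ⟨h, h1, hm.2⟩, ?_, h3⟩
    rintro z hz hz' ⟨h', h4, h5⟩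
    rw [hu _ _ _ h4 h1] at h5
    exact Nat.notMem_of_lt_sInf hz' ⟨hz, h5⟩
  · rintro ⟨j, h1, ⟨h, h2, h3⟩, h4, h5⟩
    refine ⟨h, h2, ⟨j, h1, h3⟩, ?_⟩
    have hm := Nat.sInf_mem (s := {k | i < k ∧ E h k}) ⟨j, h1, h3⟩
    have hle : sInf {k | i < k ∧ E h k} ≤ j := Nat.sInf_le ⟨h1, h3⟩
    rcases Nat.lt_or_ge (sInf {k | i < k ∧ E h k}) j with h6 | h6
    · exact absurd ⟨h, h2, hm.2⟩ (h4 _ hm.1 h6)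
    · rw [le_antisymm hle h6]; exact h5
theorem hback_char (hu : ∀ h h' x, E h x → E h' x → h = h') {φ : ℕ → Prop} {i : ℕ} :
    (∃ h, E h i ∧ (∃ k, k < i ∧ E h k) ∧ φ (sSup {k | k < i ∧ E h k})) ↔
      ∃ j, j < i ∧ SH E i j ∧ (∀ z, z < i → j < z → ¬ SH E i z) ∧ φ j := by
  have hb : ∀ h, BddAbove {k | k < i ∧ E h k} := fun h => ⟨i, fun k hk => hk.1.le⟩
  constructor
  · rintro ⟨h, h1, h2, h3⟩
    have hm := Nat.sSup_mem (s := {k | k < i ∧ E h k}) h2 (hb h)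
    refine ⟨_, hm.1, ⟨h, h1, hm.2⟩, ?_, h3⟩
    rintro z hz hz' ⟨h', h4, h5⟩
    rw [hu _ _ _ h4 h1] at h5
    exact absurd (le_csSup (hb h) ⟨hz, h5⟩) (by omega)
  · rintro ⟨j, h1, ⟨h, h2, h3⟩, h4, h5⟩
    refine ⟨h, h2, ⟨j, h1, h3⟩, ?_⟩
    have hm := Nat.sSup_mem (s := {k | k < i ∧ E h k}) ⟨j, h1, h3⟩ (hb h)
    have hle : j ≤ sSup {k | k < i ∧ E h k} := le_csSup (hb h) ⟨h1, h3⟩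
    rcases Nat.lt_or_ge j (sSup {k | k < i ∧ E h k}) with h6 | h6
    · exact absurd ⟨h, h2, hm.2⟩ (h4 _ hm.1 h6)
    · rw [le_antisymm h6 hle]; exact h5
def HP (E C : ℕ → ℕ → Prop) (h : ℕ) (l : List ℕ) : Prop :=
  l ≠ [] ∧ l.Chain' (· < ·) ∧ (∀ p ∈ l, E h p) ∧
  l.Chain' (fun a b => ¬ ∃ k, a < k ∧ k < b ∧ C h k)
def hst (E C : ℕ → ℕ → Prop) (h a b : ℕ) : Prop :=
  E h a ∧ E h b ∧ a < b ∧ ¬ ∃ k, a < k ∧ k < b ∧ C h k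
theorem hp_path {h i j : ℕ} {l : List ℕ} : (HP E C h l ∧ l.head? = some i ∧ l.getLast? = some j) ↔
    E h i ∧ IsPath (hst E C h) l i j := by
  unfold IsPath HP
  induction l generalizing i with
  | nil => simp
  | cons a l ih =>
    cases l with
    | nil =>
      simp only [List.head?_cons, List.getLast?_singleton, Option.some.injEq, List.mem_singleton,
        forall_eq]
      constructor
      · rintro ⟨⟨_, _, h1, _⟩, rfl, h2⟩
        exact ⟨h1, rfl, h2, List.isChain_singleton _⟩
      · rintro ⟨h1, rfl, h2, _⟩
        exact ⟨⟨by simp, List.isChain_singleton _, h1, List.isChain_singleton _⟩, rfl, h2⟩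
    | cons b l =>
      have ih := @ih b
      simp only [List.head?_cons, List.getLast?_cons_cons, Option.some.injEq, ne_eq, reduceCtorEq,
        not_false_eq_true, true_and] at ih ⊢
      constructor
      · rintro ⟨⟨h1, h2, h3⟩, rfl, h4⟩
        have h1 := List.isChain_cons_cons.1 h1
        have h3 := List.isChain_cons_cons.1 h3
        have := ih.1 ⟨⟨h1.2, fun p hp => h2 p (List.mem_cons_of_mem _ hp), h3.2⟩, h4⟩
        have ha := h2 a (by simp)
        exact ⟨ha, rfl, this.2.1, List.isChain_cons_cons.2 ⟨⟨ha, this.1, h1.1, h3.1⟩, this.2.2⟩⟩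
      · rintro ⟨h1, rfl, h2, h3⟩
        have h3 := List.isChain_cons_cons.1 h3
        have := ih.2 ⟨h3.1.2.1, h2, h3.2⟩
        refine ⟨⟨List.isChain_cons_cons.2 ⟨h3.1.2.2.1, this.1.1⟩, ?_,
          List.isChain_cons_cons.2 ⟨h3.1.2.2.2, this.1.2.2⟩⟩, rfl, h2⟩
        intro p hp
        rcases List.mem_cons.1 hp with rfl | hp
        · exact h1
        · exact this.1.2.1 p hp
theorem hst_le {Q : ℕ → ℕ → Prop} {h i j : ℕ}
    (hr : ReflTransGen (fun a b => hst E C h a b ∧ Q a b) i j) :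
    i ≤ j := by
  induction hr with
  | refl => exact le_rfl
  | tail _ h ih => exact ih.trans h.1.2.2.1.le
theorem hst_rtg (hEC : ∀ h a b k, E h a → E h b → a < k → k < b → (C h k ↔ E h k))
    {Q : ℕ → ℕ → Prop} {h i j : ℕ} (hi : E h i) :
    ReflTransGen (fun a b => hst E C h a b ∧ Q a b) i j ↔
      i ≤ j ∧ E h j ∧ ∀ z z', i ≤ z → z < z' → z' ≤ j → E h z → E h z' →
        (∀ k, z < k → k < z' → ¬ E h k) → Q z z' := by
  constructor
  · intro hr
    refine ⟨hst_le hr, ?_⟩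
    induction hr with
    | refl => exact ⟨hi, fun z z' _ _ _ => by omega⟩
    | @tail b c h0 hbc ih =>
      refine ⟨hbc.1.2.1, fun z z' h1 h2 h3 h4 h5 h6 => ?_⟩
      rcases Nat.lt_or_ge b z' with h7 | h7
      · have e : z' = c := by
          by_contra hne
          exact hbc.1.2.2.2 ⟨z', h7, by omega, (hEC h b c z' hbc.1.1 hbc.1.2.1 h7 (by omega)).2 h5⟩
        subst e
        have e : z = b := by
          rcases Nat.lt_trichotomy z b with h8 | h8 | h8
          · exact absurd hbc.1.1 (h6 b h8 h7)
          · exact h8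
          · exact absurd ⟨z, h8, h2, (hEC h b z' z hbc.1.1 hbc.1.2.1 h8 h2).2 h4⟩ hbc.1.2.2.2
        subst e
        exact hbc.2
      · exact ih.2 z z' h1 h2 h7 h4 h5 h6
  · rintro ⟨h1, h2, h3⟩
    induction hn : j - i using Nat.strong_induction_on generalizing i with
    | _ n ih =>
    rcases Nat.lt_or_ge i j with hij | hij
    · classical
      have hex : ∃ q, i < q ∧ E h q := ⟨j, hij, h2⟩
      obtain ⟨h4, h5⟩ := Nat.find_spec hex
      have h6 : Nat.find hex ≤ j := Nat.find_min' hex ⟨hij, h2⟩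
      have h7 : ∀ k, i < k → k < Nat.find hex → ¬ E h k := fun k hk hk' hE =>
        Nat.find_min hex hk' ⟨hk, hE⟩
      refine ReflTransGen.head (b := Nat.find hex) ⟨⟨hi, h5, h4, ?_⟩, h3 i _ le_rfl h4 h6 hi h5 h7⟩
        (ih (j - Nat.find hex) (by omega) h5 h6 (fun z z' hz => h3 z z' (by omega)) rfl)
      rintro ⟨k, h8, h9, h10⟩
      exact h7 k h8 h9 ((hEC h i _ k hi h5 h8 h9).1 h10)
    · have : i = j := by omega
      rw [this]
theorem huntil_char (hu : ∀ h h' x, E h x → E h' x → h = h')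
    (hEC : ∀ h a b k, E h a → E h b → a < k → k < b → (C h k ↔ E h k))
    {φ ψ : ℕ → Prop} {i : ℕ} :
    (∃ h l j, HP E C h l ∧ l.head? = some i ∧ l.getLast? = some j ∧ ψ j ∧ ∀ p ∈ l.dropLast, φ p) ↔
      ∃ j, ¬ j < i ∧ SH E i j ∧ ψ j ∧ ∀ z, ¬ z < i → z < j → SH E i z → φ z := by
  constructor
  · rintro ⟨h, l, j, h1, h2, h3, h4, h5⟩
    obtain ⟨h6, h7⟩ := hp_path.1 ⟨h1, h2, h3⟩
    have h8 := (hst_rtg hEC (Q := fun a _ => φ a) h6).1 (isPath_src.1 ⟨l, h7, h5⟩)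
    refine ⟨j, by omega, ⟨h, h6, h8.2.1⟩, h4, fun z hz hz' ⟨h', h9, h10⟩ => ?_⟩
    rw [hu _ _ _ h9 h6] at h10
    classical
    have hex : ∃ q, z < q ∧ E h q := ⟨j, hz', h8.2.1⟩
    obtain ⟨h11, h12⟩ := Nat.find_spec hex
    exact h8.2.2 z _ (by omega) h11 (Nat.find_min' hex ⟨hz', h8.2.1⟩) h10 h12
      (fun k hk hk' hE => Nat.find_min hex hk' ⟨hk, hE⟩)
  · rintro ⟨j, h1, ⟨h, h2, h3⟩, h4, h5⟩
    have := (hst_rtg hEC (Q := fun a _ => φ a) h2 (j := j)).2 ⟨by omega, h3,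
      fun z z' a b c d e f => h5 z (by omega) (by omega) ⟨h, h2, d⟩⟩
    obtain ⟨l, h6, h7⟩ := isPath_src.2 this
    obtain ⟨h8, h9⟩ := hp_path.2 ⟨h2, h6⟩
    exact ⟨h, l, j, h8, h9.1, h9.2, h4, h7⟩
theorem hsince_char (hu : ∀ h h' x, E h x → E h' x → h = h')
    (hEC : ∀ h a b k, E h a → E h b → a < k → k < b → (C h k ↔ E h k))
    {φ ψ : ℕ → Prop} {i : ℕ} :
    (∃ h l j, HP E C h l ∧ l.getLast? = some i ∧ l.head? = some j ∧ ψ j ∧ ∀ p ∈ l.tail, φ p) ↔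
      ∃ j, ¬ i < j ∧ SH E i j ∧ ψ j ∧ ∀ z, ¬ i < z → j < z → SH E i z → φ z := by
  constructor
  · rintro ⟨h, l, j, h1, h2, h3, h4, h5⟩
    obtain ⟨h6, h7⟩ := hp_path.1 ⟨h1, h3, h2⟩
    have h8 := (hst_rtg hEC (Q := fun _ b => φ b) h6).1 (isPath_tgt.1 ⟨l, h7, h5⟩)
    refine ⟨j, by omega, ⟨h, h8.2.1, h6⟩, h4, fun z hz hz' ⟨h', h9, h10⟩ => ?_⟩
    rw [hu _ _ _ h9 h8.2.1] at h10
    have hb : BddAbove {k | k < z ∧ E h k} := ⟨z, fun k hk => hk.1.le⟩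
    have hm := Nat.sSup_mem (s := {k | k < z ∧ E h k}) ⟨j, hz', h6⟩ hb
    exact h8.2.2 _ z (le_csSup hb ⟨hz', h6⟩) hm.1 (by omega) hm.2 h10
      (fun k hk hk' hE => absurd (le_csSup hb ⟨hk', hE⟩) (by omega))
  · rintro ⟨j, h1, ⟨h, h2, h3⟩, h4, h5⟩
    have := (hst_rtg hEC (Q := fun _ b => φ b) h3 (j := i)).2 ⟨by omega, h2,
      fun z z' a b c d e f => h5 z' (by omega) (by omega) ⟨h, h2, e⟩⟩
    obtain ⟨l, h6, h7⟩ := isPath_tgt.2 this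
    obtain ⟨h8, h9⟩ := hp_path.2 ⟨h3, h6⟩
    exact ⟨h, l, j, h8, h9.2, h9.1, h4, h7⟩
end Lin
end OPLTheory
end
noncomputable section
namespace OPLTheory
set_option linter.unusedSectionVars false
section FO3
open Relation
variable {AP : Type} {M : OPM (Set AP)}
def Df (P : Wd M → (Fin 3 → ℕ) → Prop) : Prop :=
  ∃ f : FOV OPRel AP (Fin 3), ∀ w v, f.Realize (wordRelIW M w.1) (wordUnIW w.1) v ↔ P w v
theorem Df.congr {P Q : Wd M → (Fin 3 → ℕ) → Prop} (h : Df P) (e : ∀ w v, Q w v ↔ P w v) : Df Q :=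
  h.imp fun _ hf w v => (hf w v).trans (e w v).symm
theorem Df.imp {P Q : Wd M → (Fin 3 → ℕ) → Prop} (h : Df P) (h' : Df Q) :
    Df fun w v => P w v → Q w v := by
  obtain ⟨f, hf⟩ := h
  obtain ⟨g, hg⟩ := h'
  exact ⟨.imp f g, fun w v => by simp only [FOV.Realize, hf, hg]⟩
theorem Df.fal : Df fun (_ : Wd M) _ => False := ⟨.fal, fun _ _ => Iff.rfl⟩
theorem Df.neg {P : Wd M → (Fin 3 → ℕ) → Prop} (h : Df P) : Df fun w v => ¬ P w v := h.imp Df.fal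
theorem Df.and {P Q : Wd M → (Fin 3 → ℕ) → Prop} (h : Df P) (h' : Df Q) :
    Df fun w v => P w v ∧ Q w v :=
  (h.imp h'.neg).neg.congr fun w v => by tauto
theorem Df.or {P Q : Wd M → (Fin 3 → ℕ) → Prop} (h : Df P) (h' : Df Q) :
    Df fun w v => P w v ∨ Q w v :=
  (h.neg.imp h').congr fun w v => by tauto
theorem Df.all {P : Wd M → (Fin 3 → ℕ) → Prop} (c : Fin 3) (h : Df P) :
    Df fun w v => ∀ d, P w (Function.update v c d) := by
  obtain ⟨f, hf⟩ := h
  exact ⟨.all c f, fun w v => by simp only [FOV.Realize, hf]⟩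
theorem Df.iEx {ι : Type*} [Finite ι] {P : ι → Wd M → (Fin 3 → ℕ) → Prop} (h : ∀ i, Df (P i)) :
    Df fun w v => ∃ i, P i w v := by
  have hB : BCl {S : Set (Wd M × (Fin 3 → ℕ)) | Df fun w v => (w, v) ∈ S} :=
    { tt := Df.fal.neg.congr fun w v => by simp
      neg := fun h => Df.neg h
      or := fun h h' => Df.or h h' }
  have := hB.iUn (S := fun i => {x | P i x.1 x.2}) fun i => (h i).congr fun w v => Iff.rfl
  exact Df.congr this fun w v => by simp
def D1 (P : Wd M → ℕ → Prop) : Prop := ∀ a, Df fun w v => P w (v a)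
def D2 (P : Wd M → ℕ → ℕ → Prop) : Prop := ∀ a b, a ≠ b → Df fun w v => P w (v a) (v b)
def D3 (P : Wd M → ℕ → ℕ → ℕ → Prop) : Prop :=
  ∀ a b c, a ≠ b → a ≠ c → b ≠ c → Df fun w v => P w (v a) (v b) (v c)
section
variable {P Q : Wd M → ℕ → Prop}
theorem D1.congr (h : D1 P) (e : ∀ w x, Q w x ↔ P w x) : D1 Q := fun a => (h a).congr fun _ _ => e _ _
theorem D1.neg (h : D1 P) : D1 fun w x => ¬ P w x := fun a => (h a).neg
theorem D1.and (h : D1 P) (h' : D1 Q) : D1 fun w x => P w x ∧ Q w x := fun a => (h a).and (h' a)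
theorem D1.or (h : D1 P) (h' : D1 Q) : D1 fun w x => P w x ∨ Q w x := fun a => (h a).or (h' a)
theorem D1.iEx {ι : Type*} [Finite ι] {P : ι → Wd M → ℕ → Prop} (h : ∀ i, D1 (P i)) :
    D1 fun w x => ∃ i, P i w x := fun a => Df.iEx fun i => h i a
theorem D1.fst (h : D1 P) : D2 fun w x _ => P w x := fun a _ _ => h a
theorem D1.snd (h : D1 P) : D2 fun w _ y => P w y := fun _ b _ => h b
theorem D1.thd (h : D1 P) : D3 fun w _ _ z => P w z := fun _ _ c _ _ _ => h c
end
section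
variable {P Q : Wd M → ℕ → ℕ → Prop}
theorem D2.congr (h : D2 P) (e : ∀ w x y, Q w x y ↔ P w x y) : D2 Q :=
  fun a b n => (h a b n).congr fun _ _ => e _ _ _
theorem D2.neg (h : D2 P) : D2 fun w x y => ¬ P w x y := fun a b n => (h a b n).neg
theorem D2.and (h : D2 P) (h' : D2 Q) : D2 fun w x y => P w x y ∧ Q w x y :=
  fun a b n => (h a b n).and (h' a b n)
theorem D2.or (h : D2 P) (h' : D2 Q) : D2 fun w x y => P w x y ∨ Q w x y :=
  fun a b n => (h a b n).or (h' a b n)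
theorem D2.iEx {ι : Type*} [Finite ι] {P : ι → Wd M → ℕ → ℕ → Prop} (h : ∀ i, D2 (P i)) :
    D2 fun w x y => ∃ i, P i w x y := fun a b n => Df.iEx fun i => h i a b n
theorem D2.swap (h : D2 P) : D2 fun w x y => P w y x := fun a b n => h b a n.symm
theorem D2.xy (h : D2 P) : D3 fun w x y _ => P w x y := fun a b _ n _ _ => h a b n
theorem D2.xz (h : D2 P) : D3 fun w x _ z => P w x z := fun a _ c _ n _ => h a c n
theorem D2.yz (h : D2 P) : D3 fun w _ y z => P w y z := fun _ b c _ _ n => h b c n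
theorem D2.zx (h : D2 P) : D3 fun w x _ z => P w z x := fun a _ c _ n _ => h c a n.symm
theorem D2.zy (h : D2 P) : D3 fun w _ y z => P w z y := fun _ b c _ _ n => h c b n.symm
theorem D2.all (h : D2 P) : D1 fun w x => ∀ y, P w x y := by
  intro a
  obtain ⟨b, hb⟩ : ∃ b : Fin 3, a ≠ b := by revert a; decide
  refine ((h a b hb).all b).congr fun w v => ?_
  simp [Function.update_of_ne hb]
theorem D2.ex (h : D2 P) : D1 fun w x => ∃ y, P w x y :=
  h.neg.all.neg.congr fun w x => by simp
end
section
variable {P Q : Wd M → ℕ → ℕ → ℕ → Prop}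
theorem D3.imp (h : D3 P) (h' : D3 Q) : D3 fun w x y z => P w x y z → Q w x y z :=
  fun a b c n m k => (h a b c n m k).imp (h' a b c n m k)
theorem D3.neg (h : D3 P) : D3 fun w x y z => ¬ P w x y z := fun a b c n m k => (h a b c n m k).neg
theorem D3.and (h : D3 P) (h' : D3 Q) : D3 fun w x y z => P w x y z ∧ Q w x y z :=
  fun a b c n m k => (h a b c n m k).and (h' a b c n m k)
theorem D3.all (h : D3 P) : D2 fun w x y => ∀ z, P w x y z := by
  intro a b n
  obtain ⟨c, hc, hc'⟩ : ∃ c : Fin 3, a ≠ c ∧ b ≠ c := by revert a b; decide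
  refine ((h a b c n hc hc').all c).congr fun w v => ?_
  simp [Function.update_of_ne hc, Function.update_of_ne hc']
theorem D3.ex (h : D3 P) : D2 fun w x y => ∃ z, P w x y z :=
  h.neg.all.neg.congr fun w x y => by simp
end
theorem d_lt : D2 fun (_ : Wd M) x y => x < y := fun a b _ => ⟨.rel .ord a b, fun _ _ => Iff.rfl⟩
theorem d_eq : D2 fun (_ : Wd M) x y => x = y := fun a b _ => ⟨.eqv a b, fun _ _ => Iff.rfl⟩
theorem d_chi : D2 fun (w : Wd M) x y => w.1.chi M x y :=
  fun a b _ => ⟨.rel .chain a b, fun _ _ => Iff.rfl⟩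
theorem d_atom (p : AP) : D1 fun (w : Wd M) x => x ∈ w.1.P p :=
  fun a => ⟨.un p a, fun _ _ => Iff.rfl⟩
theorem d_succ : D2 fun (_ : Wd M) x y => y = x + 1 := by
  refine (d_lt.and (d_lt.xz.and d_lt.zy).ex.neg).congr fun w x y => ?_
  constructor
  · rintro rfl
    refine ⟨by omega, ?_⟩
    rintro ⟨z, h1, h2⟩
    omega
  · rintro ⟨h1, h2⟩
    by_contra h
    exact h2 ⟨x + 1, by omega, by omega⟩
theorem d_gap : D2 fun (w : Wd M) x y => Gap (pq w) x y :=
  (d_succ.or d_chi).congr fun _ _ _ => gap_iff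
variable [Fintype AP]
theorem d_lab (b : Option (Set AP)) : D1 fun (w : Wd M) x => w.1.lab x = b := by
  classical
  have h0 : D1 fun (_ : Wd M) x => x = 0 := by
    refine d_lt.swap.ex.neg.congr fun w x => ?_
    constructor
    · rintro rfl ⟨y, h⟩
      omega
    · intro h
      by_contra h'
      exact h ⟨0, by omega⟩
  cases b with
  | none => exact h0.congr fun w x => by simp [OPWordW.lab]
  | some A =>
    have h2 : ∀ a : AP, D1 fun (w : Wd M) x => ¬ (x ∈ w.1.P a ↔ a ∈ A) := by
      intro a
      by_cases ha : a ∈ A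
      · exact (d_atom a).neg.congr fun w x => by simp [ha]
      · exact (d_atom a).congr fun w x => by simp [ha]
    refine (h0.neg.and (D1.iEx h2).neg).congr fun w x => ?_
    simp only [OPWordW.lab, not_exists, not_not]
    by_cases hx : x = 0
    · simp [hx]
    · simp only [hx, if_false, Option.some.injEq, not_false_eq_true, true_and]
      exact Set.ext_iff
theorem d_pr (π : Prec) : D2 fun (w : Wd M) x y => pq w x y = some π := by
  have h : ∀ p : {p : Option (Set AP) × Option (Set AP) // M p.1 p.2 = some π},
      D2 fun (w : Wd M) x y => w.1.lab x = p.1.1 ∧ w.1.lab y = p.1.2 := fun p =>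
    (d_lab p.1.1).fst.and (d_lab p.1.2).snd
  refine (D2.iEx h).congr fun w x y => ?_
  constructor
  · intro h
    exact ⟨⟨(_, _), h⟩, rfl, rfl⟩
  · rintro ⟨⟨⟨a, b⟩, h⟩, h1, h2⟩
    simp only at h1 h2 h
    simp only [OPWordW.prec, h1, h2, h]
theorem d_par : D2 fun (w : Wd M) x y => Par (pq w) x y := d_gap.and ((d_pr _).or (d_pr _))
theorem d_up : D2 fun (w : Wd M) x y => Up (pq w) x y := d_gap.and ((d_pr _).or (d_pr _))
theorem d_plt : D2 fun (w : Wd M) x y => PLt (pq w) x y := d_gap.and (d_pr _)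
theorem d_deq : D2 fun (w : Wd M) x y => (w.1.frame M).deq x y := (d_pr .lt).or (d_pr .eq)
theorem d_ueq : D2 fun (w : Wd M) x y => (w.1.frame M).ueq x y := (d_pr .gt).or (d_pr .eq)
theorem d_desc : D2 fun (w : Wd M) x y => ReflTransGen (Par (pq w)) x y := by
  have h1 : D2 fun (w : Wd M) x z => ∃ p, ¬ p < x ∧ Par (pq w) p z := (d_lt.zx.neg.and d_par.zy).ex
  exact (d_eq.or (d_lt.and (d_lt.xz.imp (d_lt.yz.neg.imp h1.xz)).all)).congr
    fun w x y => desc_char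
theorem d_ups : D2 fun (w : Wd M) x y => ReflTransGen (Up (pq w)) x y := by
  have h1 : D2 fun (w : Wd M) x b => ∀ a, PLt (pq w) a b → a < x := (d_plt.zy.imp d_lt.zx).all
  exact (d_lt.swap.neg.and (d_desc.zy.imp h1.xz).all).congr fun w x y => up_char (cmp_of w.2)
theorem d_src {R : Wd M → ℕ → ℕ → Prop} (hR : D2 fun w x y => ReflTransGen (R w) x y)
    {P : Wd M → ℕ → Prop} (hP : D1 P) : D2 fun w x y => ReflTransGen (R w) x y ∧
      ∀ z, ReflTransGen (R w) x z → ReflTransGen (R w) z y → z ≠ y → P w z :=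
  hR.and (hR.xz.imp (hR.zy.imp (d_eq.zy.neg.imp hP.thd))).all
theorem d_tgt {R : Wd M → ℕ → ℕ → Prop} (hR : D2 fun w x y => ReflTransGen (R w) x y)
    {P : Wd M → ℕ → Prop} (hP : D1 P) : D2 fun w x y => ReflTransGen (R w) x y ∧
      ∀ z, ReflTransGen (R w) x z → ReflTransGen (R w) z y → z ≠ x → P w z :=
  hR.and (hR.xz.imp (hR.zy.imp (d_eq.zx.neg.imp hP.thd))).all
def EU (w : Wd M) (h p : ℕ) : Prop := w.1.chi M h p ∧ pq w h p = some Prec.lt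
def ED (w : Wd M) (h p : ℕ) : Prop := w.1.chi M p h ∧ pq w p h = some Prec.gt
theorem EU.plt {w : Wd M} {h p : ℕ} (e : EU w h p) : PLt (pq w) h p := ⟨gap_iff.2 (Or.inr e.1), e.2⟩
theorem ED.pop {w : Wd M} {h p : ℕ} (e : ED w h p) : Pop (pq w) p h := ⟨gap_iff.2 (Or.inr e.1), e.2⟩
theorem eu_u (w : Wd M) (h h' x : ℕ) (e : EU w h x) (e' : EU w h' x) : h = h' :=
  par_unique _ _ _ e.plt.par e'.plt.par
theorem ed_u (w : Wd M) (h h' x : ℕ) (e : ED w h x) (e' : ED w h' x) : h = h' :=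
  up_unique e.pop.up e'.pop.up
theorem eu_c (w : Wd M) (h a b k : ℕ) (_ : EU w h a) (eb : EU w h b) (h1 : a < k) (h2 : k < b) :
    w.1.chi M h k ↔ EU w h k := by
  refine ⟨fun hk => ⟨hk, ?_⟩, fun e => e.1⟩
  have hg : Gap (pq w) h k := gap_iff.2 (Or.inr hk)
  rcases gap_cases (cmp_of w.2) hg with e | e
  · rcases e.cases with e | e
    · exact e.2
    · have := eq_last e b eb.plt.1
      omega
  · exact absurd (eb.plt.1.desc k hg.lt' h2) e.not_desc
theorem ed_c (w : Wd M) (h a b k : ℕ) (ea : ED w h a) (_ : ED w h b) (h1 : a < k) (h2 : k < b) :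
    w.1.chi M k h ↔ ED w h k := by
  refine ⟨fun hk => ⟨hk, ?_⟩, fun e => e.1⟩
  have hg : Gap (pq w) k h := gap_iff.2 (Or.inr hk)
  rcases gap_cases (cmp_of w.2) hg with e | e
  · have := par_leftmost e ea.pop.1
    omega
  · exact e.2
theorem d_eu : D2 fun (w : Wd M) x y => SH (EU w) x y :=
  have h : D2 fun (w : Wd M) x y => EU w x y := d_chi.and (d_pr _)
  (h.zx.and h.zy).ex
theorem d_ed : D2 fun (w : Wd M) x y => SH (ED w) x y :=
  have h : D2 fun (w : Wd M) x y => ED w x y := d_chi.swap.and (d_pr _).swap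
  (h.zx.and h.zy).ex
section
variable {S : Wd M → ℕ → ℕ → Prop} (hS : D2 S) {P Q : Wd M → ℕ → Prop} (hP : D1 P) (hQ : D1 Q)
include hS hP
theorem d_hnext : D1 fun w i => ∃ j, i < j ∧ S w i j ∧ (∀ z, i < z → z < j → ¬ S w i z) ∧ P w j :=
  (d_lt.and (hS.and ((d_lt.xz.imp (d_lt.zy.imp hS.xz.neg)).all.and hP.snd))).ex
theorem d_hback : D1 fun w i => ∃ j, j < i ∧ S w i j ∧ (∀ z, z < i → j < z → ¬ S w i z) ∧ P w j :=
  (d_lt.swap.and (hS.and ((d_lt.zx.imp (d_lt.yz.imp hS.xz.neg)).all.and hP.snd))).ex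
include hQ
theorem d_huntil : D1 fun w i =>
    ∃ j, ¬ j < i ∧ S w i j ∧ Q w j ∧ ∀ z, ¬ z < i → z < j → S w i z → P w z :=
  (d_lt.swap.neg.and (hS.and (hQ.snd.and
    (d_lt.zx.neg.imp (d_lt.zy.imp (hS.xz.imp hP.thd))).all))).ex
theorem d_hsince : D1 fun w i =>
    ∃ j, ¬ i < j ∧ S w i j ∧ Q w j ∧ ∀ z, ¬ i < z → j < z → S w i z → P w z :=
  (d_lt.neg.and (hS.and (hQ.snd.and
    (d_lt.xz.neg.imp (d_lt.yz.imp (hS.xz.imp hP.thd))).all))).ex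
end
theorem d_sat (φ : POTL AP) : D1 fun (w : Wd M) i => POTL.Sat (w.1.frame M) φ i := by
  have hfd : ∀ (w : Wd M) x y y', Up (pq w) x y → Up (pq w) x y' → y = y' :=
    fun w x y y' h h' => up_unique h h'
  have hfl : ∀ (w : Wd M) x y, Up (pq w) x y → x < y := fun w x y h => h.lt'
  have hbd : ∀ (w : Wd M) x x' y, Par (pq w) x y → Par (pq w) x' y → x = x' :=
    fun w x x' y h h' => par_unique _ _ _ h h'
  have hbl : ∀ (w : Wd M) x y, Par (pq w) x y → x < y := fun w x y h => h.lt'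
  induction φ with
  | tt => exact fun a => Df.fal.neg.congr fun w v => by simp [POTL.Sat]
  | atom a => exact d_atom a
  | neg φ ih => exact ih.neg
  | orf φ ψ ih ih' => exact ih.or ih'
  | nextD φ ih =>
    refine (d_succ.and (d_deq.and ih.snd)).ex.congr fun w i => ?_
    simp [POTL.Sat, OPWordW.frame]
  | nextU φ ih =>
    refine (d_succ.and (d_ueq.and ih.snd)).ex.congr fun w i => ?_
    simp [POTL.Sat, OPWordW.frame]
  | backD φ ih =>
    refine (d_succ.swap.and (d_deq.swap.and ih.snd)).ex.congr fun w i => ?_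
    constructor
    · rintro ⟨h1, h2⟩
      exact ⟨i - 1, by omega, h2⟩
    · rintro ⟨j, rfl, h2⟩
      exact ⟨by omega, h2⟩
  | backU φ ih =>
    refine (d_succ.swap.and (d_ueq.swap.and ih.snd)).ex.congr fun w i => ?_
    constructor
    · rintro ⟨h1, h2⟩
      exact ⟨i - 1, by omega, h2⟩
    · rintro ⟨j, rfl, h2⟩
      exact ⟨by omega, h2⟩
  | chiFD φ ih => exact (d_chi.and (d_deq.and ih.snd)).ex
  | chiFU φ ih => exact (d_chi.and (d_ueq.and ih.snd)).ex
  | chiPD φ ih => exact (d_chi.swap.and (d_deq.swap.and ih.snd)).ex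
  | chiPU φ ih => exact (d_chi.swap.and (d_ueq.swap.and ih.snd)).ex
  | untilD φ ψ ih ih' =>
    refine ((d_src d_desc ih).and ih'.snd).ex.congr fun w i => ?_
    simp only [sat_untilD, bwd_src (hbd w) (hbl w)]
  | untilU φ ψ ih ih' =>
    refine ((d_src d_ups ih).and ih'.snd).ex.congr fun w i => ?_
    simp only [sat_untilU, fwd_src (hfd w) (hfl w)]
  | sinceD φ ψ ih ih' =>
    refine ((d_tgt d_desc ih).swap.and ih'.snd).ex.congr fun w i => ?_
    simp only [sat_sinceD, bwd_tgt (hbd w) (hbl w)]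
  | sinceU φ ψ ih ih' =>
    refine ((d_tgt d_ups ih).swap.and ih'.snd).ex.congr fun w i => ?_
    simp only [sat_sinceU, fwd_tgt (hfd w) (hfl w)]
  | hnextU φ ih =>
    refine (d_hnext d_eu ih).congr fun w i => Iff.trans ?_ (hnext_char (eu_u w))
    constructor
    · rintro ⟨h, _, h1, h2, h3, h4⟩
      exact ⟨h, ⟨h1, h2⟩, h3, h4⟩
    · rintro ⟨h, h1, h3, h4⟩
      exact ⟨h, h1.plt.1.lt', h1.1, h1.2, h3, h4⟩
  | hbackU φ ih =>
    refine (d_hback d_eu ih).congr fun w i => Iff.trans ?_ (hback_char (eu_u w))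
    constructor
    · rintro ⟨h, _, h1, h2, h3, h4⟩
      exact ⟨h, ⟨h1, h2⟩, h3, h4⟩
    · rintro ⟨h, h1, h3, h4⟩
      exact ⟨h, h1.plt.1.lt', h1.1, h1.2, h3, h4⟩
  | hnextD φ ih =>
    refine (d_hnext d_ed ih).congr fun w i => Iff.trans ?_ (hnext_char (ed_u w))
    constructor
    · rintro ⟨h, _, h1, h2, h3, h4⟩
      exact ⟨h, ⟨h1, h2⟩, h3, h4⟩
    · rintro ⟨h, h1, h3, h4⟩
      exact ⟨h, h1.pop.1.lt', h1.1, h1.2, h3, h4⟩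
  | hbackD φ ih =>
    refine (d_hback d_ed ih).congr fun w i => Iff.trans ?_ (hback_char (ed_u w))
    constructor
    · rintro ⟨h, _, h1, h2, h3, h4⟩
      exact ⟨h, ⟨h1, h2⟩, h3, h4⟩
    · rintro ⟨h, h1, h3, h4⟩
      exact ⟨h, h1.pop.1.lt', h1.1, h1.2, h3, h4⟩
  | huntilU φ ψ ih ih' =>
    refine (d_huntil d_eu ih ih').congr fun w i => Iff.trans ?_ (huntil_char (eu_u w) (eu_c w))
    constructor
    · rintro ⟨h, l, j, _, h1⟩
      exact ⟨h, l, j, h1⟩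
    · rintro ⟨h, l, j, h1⟩
      exact ⟨h, l, j, (h1.1.2.2.1 i (List.mem_of_mem_head? h1.2.1)).plt.1.lt', h1⟩
  | hsinceU φ ψ ih ih' =>
    refine (d_hsince d_eu ih ih').congr fun w i => Iff.trans ?_ (hsince_char (eu_u w) (eu_c w))
    constructor
    · rintro ⟨h, l, j, _, h1⟩
      exact ⟨h, l, j, h1⟩
    · rintro ⟨h, l, j, h1⟩
      exact ⟨h, l, j, (h1.1.2.2.1 j (List.mem_of_mem_head? h1.2.2.1)).plt.1.lt', h1⟩
  | huntilD φ ψ ih ih' =>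
    refine (d_huntil d_ed ih ih').congr fun w i => Iff.trans ?_ (huntil_char (ed_u w) (ed_c w))
    constructor
    · rintro ⟨h, l, j, _, h1⟩
      exact ⟨h, l, j, h1⟩
    · rintro ⟨h, l, j, h1⟩
      exact ⟨h, l, j, (h1.1.2.2.1 j (List.mem_of_mem_getLast? h1.2.2.1)).pop.1.lt', h1⟩
  | hsinceD φ ψ ih ih' =>
    refine (d_hsince d_ed ih ih').congr fun w i => Iff.trans ?_ (hsince_char (ed_u w) (ed_c w))
    constructor
    · rintro ⟨h, l, j, _, h1⟩
      exact ⟨h, l, j, h1⟩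
    · rintro ⟨h, l, j, h1⟩
      exact ⟨h, l, j, (h1.1.2.2.1 i (List.mem_of_mem_getLast? h1.2.1)).pop.1.lt', h1⟩
theorem potl_to_fo3 (M : OPM (Set AP)) (φ : POTL AP) :
    ∃ ν : FOV OPRel AP (Fin 3), ν.free ⊆ {0} ∧ ∀ w : OPWordW AP, w.Compatible M → ∀ i : ℕ,
      (POTL.Sat (w.frame M) φ i ↔ ν.Realize (wordRelIW M w) (wordUnIW w) (fun _ => i)) := by
  obtain ⟨f, hf⟩ := d_sat (M := M) φ 0
  refine ⟨.all 1 (.all 2 f), ?_, fun w hw i => ?_⟩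
  · rintro x ⟨⟨_, h2⟩, h1⟩
    simp only [Set.mem_singleton_iff] at h1 h2 ⊢
    revert x; intro x _ h2 h1
    fin_cases x <;> simp_all
  · simp only [FOV.Realize, hf ⟨w, hw⟩]
    simp
def FOV.ren {R U V V' : Type} (g : V → V') : FOV R U V → FOV R U V'
  | .fal => .fal
  | .rel r x y => .rel r (g x) (g y)
  | .un u x => .un u (g x)
  | .eqv x y => .eqv (g x) (g y)
  | .imp f f' => .imp (f.ren g) (f'.ren g)
  | .all x f => .all (g x) (f.ren g)
theorem FOV.ren_realize {R U V V' D : Type} [DecidableEq V] [DecidableEq V'] {g : V → V'}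
    (hg : Function.Injective g) (rI : R → D → D → Prop) (uI : U → D → Prop) (f : FOV R U V) :
    ∀ v : V' → D, (f.ren g).Realize rI uI v ↔ f.Realize rI uI (v ∘ g) := by
  induction f with
  | fal => exact fun v => Iff.rfl
  | rel r x y => exact fun v => Iff.rfl
  | un u x => exact fun v => Iff.rfl
  | eqv x y => exact fun v => Iff.rfl
  | imp f f' ih ih' => exact fun v => by simp only [FOV.ren, FOV.Realize, ih, ih']
  | all x f ih =>
    intro v
    simp only [FOV.ren, FOV.Realize, ih]
    refine forall_congr' fun d => ?_
    rw [Function.update_comp_eq_of_injective v hg]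
theorem FOV.ren_free {R U V V' : Type} {g : V → V'} (hg : Function.Injective g) (f : FOV R U V) :
    (f.ren g).free = g '' f.free := by
  induction f with
  | fal => simp [FOV.ren, FOV.free]
  | rel r x y => simp [FOV.ren, FOV.free, Set.image_pair]
  | un u x => simp [FOV.ren, FOV.free]
  | eqv x y => simp [FOV.ren, FOV.free, Set.image_pair]
  | imp f f' ih ih' => simp only [FOV.ren, FOV.free, ih, ih', Set.image_union]
  | all x f ih => simp only [FOV.ren, FOV.free, ih, Set.image_diff hg, Set.image_singleton]
end FO3
end OPLTheory
end
namespace OPLTheory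

/-- **FO-completeness of POTL on OP ω-words**, together with the three-variable
    property of FOL on OP ω-words. -/
theorem potl_equals_fo_omega {AP : Type} [Fintype AP] (M : OPM (Set AP)) :
    (∀ φ : POTL AP, ∃ ν : FOV OPRel AP ℕ, ν.free ⊆ {0} ∧
      ∀ w : OPWordW AP, w.Compatible M → ∀ i : ℕ,
        (POTL.Sat (w.frame M) φ i ↔
          ν.Realize (wordRelIW M w) (wordUnIW w) (fun _ => i))) ∧
    (∀ ν : FOV OPRel AP ℕ, ν.free ⊆ {0} → ∃ φ : POTL AP,
      ∀ w : OPWordW AP, w.Compatible M → ∀ i : ℕ,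
        (ν.Realize (wordRelIW M w) (wordUnIW w) (fun _ => i) ↔
          POTL.Sat (w.frame M) φ i)) ∧
    (∀ ν : FOV OPRel AP ℕ, ν.free ⊆ {0} →
      ∃ ν3 : FOV OPRel AP (Fin 3), ν3.free ⊆ {0} ∧
        ∀ w : OPWordW AP, w.Compatible M → ∀ i : ℕ,
          (ν.Realize (wordRelIW M w) (wordUnIW w) (fun _ => i) ↔
            ν3.Realize (wordRelIW M w) (wordUnIW w) (fun _ => i))) := by
  refine ⟨fun φ => ?_, fun ν hν => fo_to_potl M ν hν, fun ν hν => ?_⟩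
  · obtain ⟨ν, h1, h2⟩ := potl_to_fo3 M φ
    refine ⟨ν.ren Fin.val, ?_, fun w hw i => ?_⟩
    · rw [FOV.ren_free Fin.val_injective]
      rintro _ ⟨x, hx, rfl⟩
      have := h1 hx
      simp only [Set.mem_singleton_iff] at this ⊢
      rw [this]; rfl
    · rw [h2 w hw i, FOV.ren_realize Fin.val_injective]
      rfl
  · obtain ⟨φ, h⟩ := fo_to_potl M ν hν
    obtain ⟨ν3, h1, h2⟩ := potl_to_fo3 M φ
    exact ⟨ν3, h1, fun w hw i => (h w hw i).trans (h2 w hw i)⟩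

end OPLTheory
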